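/- Let a C¹-spacetime on ℝⁿ be globally hyperbolic, causally non-branching, and non-intertwining. If it satisfies Condition A, then it is finitely compact. -/

import Mathlib

open Set Filter Topology MeasureTheory
open scoped ENNReal NNReal

noncomputable section

/-- Points of ℝⁿ. -/
abbrev SpacetimePt (n : ℕ) := Fin n → ℝ

/-- Evaluation of a bilinear form given by a coefficient matrix. -/
def bilForm {n : ℕ} (g : Fin n → Fin n → ℝ) (u v : Fin n → ℝ) : ℝ :=
  ∑ i, ∑ j, g i j * u i * v j

/-- The Minkowski matrix diag(−1,1,…,1). -/
def minkowskiMatrix (n : ℕ) : Fin n → Fin n → ℝ := fun i j =>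
  if i = j then (if (i : ℕ) = 0 then -1 else 1) else 0

/-- A time-oriented C¹-spacetime on ℝⁿ: a C¹ family of symmetric bilinear forms of
Lorentzian signature (−,+,…,+), together with a continuous timelike vector field. -/
structure C1Spacetime (n : ℕ) where
  g : SpacetimePt n → Fin n → Fin n → ℝ
  g_contDiff : ContDiff ℝ 1 g
  g_symm : ∀ p i j, g p i j = g p j i
  g_lorentz : ∀ p : SpacetimePt n, ∃ L : (Fin n → ℝ) ≃ₗ[ℝ] (Fin n → ℝ),
    ∀ i j, bilForm (g p) (L (Pi.single i 1)) (L (Pi.single j 1)) = minkowskiMatrix n i j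
  X0 : SpacetimePt n → Fin n → ℝ
  X0_cont : Continuous X0
  X0_timelike : ∀ p, bilForm (g p) (X0 p) (X0 p) < 0

namespace C1Spacetime

variable {n : ℕ} (M : C1Spacetime n)

/-- The inverse metric. -/
def ginv (p : SpacetimePt n) : Matrix (Fin n) (Fin n) ℝ :=
  (Matrix.of (M.g p))⁻¹

/-- Christoffel symbols Γᵏᵢⱼ = ½ Σ_l gᵏˡ(∂ᵢ g_{jl} + ∂ⱼ g_{il} − ∂_l g_{ij}). -/
def christoffel (k i j : Fin n) (p : SpacetimePt n) : ℝ :=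
  (1 / 2) * ∑ l, M.ginv p k l *
    (fderiv ℝ (fun q => M.g q j l) p (Pi.single i 1)
      + fderiv ℝ (fun q => M.g q i l) p (Pi.single j 1)
      - fderiv ℝ (fun q => M.g q i j) p (Pi.single l 1))

/-- A geodesic on the interval `I` : a C² curve satisfying the geodesic equation. -/
def IsGeodesicOn (γ : ℝ → SpacetimePt n) (I : Set ℝ) : Prop :=
  ContDiffOn ℝ 2 γ I ∧ ∀ t ∈ I, ∀ k,
    derivWithin (fun s => derivWithin γ I s k) I t
      + ∑ i, ∑ j, M.christoffel k i j (γ t) *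
          derivWithin γ I t i * derivWithin γ I t j = 0

/-- `v` is a causal vector at `p`. -/
def CausalVec (p v : SpacetimePt n) : Prop := v ≠ 0 ∧ bilForm (M.g p) v v ≤ 0

/-- `v` is a timelike vector at `p`. -/
def TimelikeVec (p v : SpacetimePt n) : Prop := bilForm (M.g p) v v < 0

/-- A causal vector `v` at `p` is future-directed. -/
def FdVec (p v : SpacetimePt n) : Prop := bilForm (M.g p) v (M.X0 p) < 0

/-- A causal vector `v` at `p` is past-directed. -/
def PdVec (p v : SpacetimePt n) : Prop := 0 < bilForm (M.g p) v (M.X0 p)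

/-- A causal geodesic on `I`: the velocity is everywhere causal. -/
def IsCausalGeodesicOn (γ : ℝ → SpacetimePt n) (I : Set ℝ) : Prop :=
  M.IsGeodesicOn γ I ∧ ∀ t ∈ I, M.CausalVec (γ t) (derivWithin γ I t)

/-- A future-directed causal geodesic on `I`. -/
def IsFdCausalGeodesicOn (γ : ℝ → SpacetimePt n) (I : Set ℝ) : Prop :=
  M.IsGeodesicOn γ I ∧ ∀ t ∈ I,
    M.CausalVec (γ t) (derivWithin γ I t) ∧ M.FdVec (γ t) (derivWithin γ I t)

/-- A past-directed causal geodesic on `I`. -/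
def IsPdCausalGeodesicOn (γ : ℝ → SpacetimePt n) (I : Set ℝ) : Prop :=
  M.IsGeodesicOn γ I ∧ ∀ t ∈ I,
    M.CausalVec (γ t) (derivWithin γ I t) ∧ M.PdVec (γ t) (derivWithin γ I t)

/-- A geodesic `γ : [a,b] → ℝⁿ` branches at `t₀ ∈ (a,b)`. -/
def BranchesAt (γ : ℝ → SpacetimePt n) (a b t₀ : ℝ) : Prop :=
  ∃ ε > 0, a ≤ t₀ - ε ∧ t₀ + ε ≤ b ∧
    ∃ σ : ℝ → SpacetimePt n, M.IsGeodesicOn σ (Ioo (t₀ - ε) (t₀ + ε)) ∧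
      (∀ t ∈ Ioc (t₀ - ε) t₀, γ t = σ t) ∧
      (γ '' Ioo t₀ (t₀ + ε)) ∩ (σ '' Ioo t₀ (t₀ + ε)) = ∅

/-- No causal geodesic branches. -/
def CausallyNonBranching : Prop :=
  ∀ (γ : ℝ → SpacetimePt n) (a b : ℝ), a < b → M.IsCausalGeodesicOn γ (Icc a b) →
    ∀ t₀ ∈ Ioo a b, ¬ M.BranchesAt γ a b t₀

/-- Non-intertwining. -/
def NonIntertwining : Prop :=
  ∀ p : SpacetimePt n, ∃ U ∈ 𝓝 p, ∀ ε : ℝ, 0 < ε → ∀ γ₁ γ₂ : ℝ → SpacetimePt n,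
    M.IsCausalGeodesicOn γ₁ (Icc 0 ε) → M.IsCausalGeodesicOn γ₂ (Icc 0 ε) →
    (∀ t ∈ Icc (0:ℝ) ε, γ₁ t ∈ U) → (∀ t ∈ Icc (0:ℝ) ε, γ₂ t ∈ U) →
    γ₁ 0 = p → γ₂ 0 = p →
    derivWithin γ₁ (Icc 0 ε) 0 = derivWithin γ₂ (Icc 0 ε) 0 →
    (∀ t ∈ Icc (0:ℝ) ε, γ₁ t = γ₂ t) ∨
      ¬ ∃ z : SpacetimePt n, AccPt z (𝓟 ((γ₁ '' Ioc 0 ε) ∩ (γ₂ '' Ioc 0 ε)))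

/-- Domain of the causal exponential map at `p`. -/
def ExpDomain (p : SpacetimePt n) : Set (SpacetimePt n) :=
  {v | bilForm (M.g p) v v ≤ 0 ∧
    ∃ γ : ℝ → SpacetimePt n, M.IsCausalGeodesicOn γ (Icc 0 1) ∧ γ 0 = p ∧
      derivWithin γ (Icc 0 1) 0 = v}

/-- A future-directed causal path on the interval `I`: locally Lipschitz with almost
everywhere future-directed causal derivative. -/
def IsFdCausalPathOn (γ : ℝ → SpacetimePt n) (I : Set ℝ) : Prop :=
  I.OrdConnected ∧ I.Nonempty ∧
    (∀ t ∈ I, ∃ K : ℝ≥0, ∃ U ∈ 𝓝[I] t, LipschitzOnWith K γ U) ∧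
    ∀ᵐ t ∂(volume.restrict I), DifferentiableAt ℝ γ t ∧
      M.CausalVec (γ t) (deriv γ t) ∧ M.FdVec (γ t) (deriv γ t)

/-- A future-directed timelike path on the interval `I`. -/
def IsFdTimelikePathOn (γ : ℝ → SpacetimePt n) (I : Set ℝ) : Prop :=
  I.OrdConnected ∧ I.Nonempty ∧
    (∀ t ∈ I, ∃ K : ℝ≥0, ∃ U ∈ 𝓝[I] t, LipschitzOnWith K γ U) ∧
    ∀ᵐ t ∂(volume.restrict I), DifferentiableAt ℝ γ t ∧
      M.TimelikeVec (γ t) (deriv γ t) ∧ M.FdVec (γ t) (deriv γ t)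

/-- Chronological relation `p ≪ q`. -/
def chron (p q : SpacetimePt n) : Prop :=
  ∃ (γ : ℝ → SpacetimePt n) (a b : ℝ), a < b ∧ M.IsFdTimelikePathOn γ (Icc a b) ∧
    γ a = p ∧ γ b = q

/-- Causal relation `p ≤ q`. -/
def causalLe (p q : SpacetimePt n) : Prop :=
  p = q ∨ ∃ (γ : ℝ → SpacetimePt n) (a b : ℝ), a < b ∧ M.IsFdCausalPathOn γ (Icc a b) ∧
    γ a = p ∧ γ b = q

/-- g-length of a causal path on `[a,b]`. -/
def gLength (γ : ℝ → SpacetimePt n) (a b : ℝ) : ℝ :=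
  ∫ t in a..b, Real.sqrt (- bilForm (M.g (γ t)) (deriv γ t) (deriv γ t))

/-- Lorentzian distance. -/
def ldist (p q : SpacetimePt n) : ℝ≥0∞ :=
  ⨆ (γ : ℝ → SpacetimePt n) (a : ℝ) (b : ℝ) (_ : a < b)
    (_ : M.IsFdCausalPathOn γ (Icc a b)) (_ : γ a = p) (_ : γ b = q),
    ENNReal.ofReal (M.gLength γ a b)

/-- Non-total imprisonment: no future or past inextendible causal curve is contained
in a compact set (inextendible = no limit at the open end). -/
def NonImprisoning : Prop :=
  ∀ K : Set (SpacetimePt n), IsCompact K →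
    (∀ (a b : ℝ) (γ : ℝ → SpacetimePt n), M.IsFdCausalPathOn γ (Ico a b) →
      (¬ ∃ q, Tendsto γ (𝓝[<] b) (𝓝 q)) → ¬ ∀ t ∈ Ico a b, γ t ∈ K) ∧
    (∀ (a : ℝ) (γ : ℝ → SpacetimePt n), M.IsFdCausalPathOn γ (Ici a) →
      (¬ ∃ q, Tendsto γ atTop (𝓝 q)) → ¬ ∀ t ∈ Ici a, γ t ∈ K) ∧
    (∀ (a b : ℝ) (γ : ℝ → SpacetimePt n), M.IsFdCausalPathOn γ (Ioc a b) →
      (¬ ∃ q, Tendsto γ (𝓝[>] a) (𝓝 q)) → ¬ ∀ t ∈ Ioc a b, γ t ∈ K) ∧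
    (∀ (b : ℝ) (γ : ℝ → SpacetimePt n), M.IsFdCausalPathOn γ (Iic b) →
      (¬ ∃ q, Tendsto γ atBot (𝓝 q)) → ¬ ∀ t ∈ Iic b, γ t ∈ K)

/-- Global hyperbolicity. -/
def GloballyHyperbolic : Prop :=
  M.NonImprisoning ∧
    ∀ p q : SpacetimePt n, IsCompact {z : SpacetimePt n | M.causalLe p z ∧ M.causalLe z q}

/-- Finite compactness. -/
def FinitelyCompact : Prop :=
  ∀ B : ℝ, 0 < B → ∀ p q : SpacetimePt n, ∀ x : ℕ → SpacetimePt n,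
    ((∀ m, M.chron p q ∧ M.causalLe q (x m) ∧ M.ldist p (x m) ≤ ENNReal.ofReal B) →
      ∃ z : SpacetimePt n, MapClusterPt z atTop x) ∧
    ((∀ m, M.causalLe (x m) q ∧ M.chron q p ∧ M.ldist (x m) p ≤ ENNReal.ofReal B) →
      ∃ z : SpacetimePt n, MapClusterPt z atTop x)

/-- Timelike Cauchy completeness. -/
def TimelikeCauchyComplete : Prop :=
  ∀ (x : ℕ → SpacetimePt n) (B : ℕ → ℝ), (∀ m, 0 ≤ B m) → Tendsto B atTop (𝓝 0) →
    (((∀ m, M.chron (x m) (x (m + 1))) ∧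
        ∀ k m : ℕ, 0 < m → M.ldist (x k) (x (k + m)) ≤ ENNReal.ofReal (B k)) ∨
      ((∀ m, M.chron (x (m + 1)) (x m)) ∧
        ∀ k m : ℕ, 0 < m → M.ldist (x (k + m)) (x k) ≤ ENNReal.ofReal (B k))) →
    ∃ l : SpacetimePt n, Tendsto x atTop (𝓝 l)

/-- Condition A for C¹-spacetimes: for `x ≪ y` and every future inextendible
future-directed causal geodesic starting at `y` defined on `[0,c)` (`c ∈ (0,∞]`),
the Lorentzian distance `T(x, γ(t))` tends to infinity as `t → c`; dually for the past. -/
def ConditionA : Prop :=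
  (∀ x y : SpacetimePt n, M.chron x y →
    (∀ c : ℝ, 0 < c → ∀ γ : ℝ → SpacetimePt n, M.IsFdCausalGeodesicOn γ (Ico 0 c) →
      γ 0 = y → (¬ ∃ z, Tendsto γ (𝓝[<] c) (𝓝 z)) →
      Tendsto (fun t => M.ldist x (γ t)) (𝓝[<] c) (𝓝 ⊤)) ∧
    (∀ γ : ℝ → SpacetimePt n, M.IsFdCausalGeodesicOn γ (Ici 0) →
      γ 0 = y → (¬ ∃ z, Tendsto γ atTop (𝓝 z)) →
      Tendsto (fun t => M.ldist x (γ t)) atTop (𝓝 ⊤))) ∧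
  (∀ x y : SpacetimePt n, M.chron y x →
    (∀ c : ℝ, 0 < c → ∀ γ : ℝ → SpacetimePt n, M.IsPdCausalGeodesicOn γ (Ico 0 c) →
      γ 0 = y → (¬ ∃ z, Tendsto γ (𝓝[<] c) (𝓝 z)) →
      Tendsto (fun t => M.ldist (γ t) x) (𝓝[<] c) (𝓝 ⊤)) ∧
    (∀ γ : ℝ → SpacetimePt n, M.IsPdCausalGeodesicOn γ (Ici 0) →
      γ 0 = y → (¬ ∃ z, Tendsto γ atTop (𝓝 z)) →
      Tendsto (fun t => M.ldist (γ t) x) atTop (𝓝 ⊤)))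

end C1Spacetime

section BilForm

variable {n : ℕ} (G : Fin n → Fin n → ℝ)

lemma bilForm_add_left (u u' v : Fin n → ℝ) :
    bilForm G (u + u') v = bilForm G u v + bilForm G u' v := by
  simp only [bilForm, ← Finset.sum_add_distrib, Pi.add_apply]
  exact Finset.sum_congr rfl fun i _ => Finset.sum_congr rfl fun j _ => by ring

lemma bilForm_add_right (u v v' : Fin n → ℝ) :
    bilForm G u (v + v') = bilForm G u v + bilForm G u v' := by
  simp only [bilForm, ← Finset.sum_add_distrib, Pi.add_apply]
  exact Finset.sum_congr rfl fun i _ => Finset.sum_congr rfl fun j _ => by ring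

lemma bilForm_smul_left (c : ℝ) (u v : Fin n → ℝ) :
    bilForm G (c • u) v = c * bilForm G u v := by
  simp only [bilForm, Finset.mul_sum, Pi.smul_apply, smul_eq_mul]
  exact Finset.sum_congr rfl fun i _ => Finset.sum_congr rfl fun j _ => by ring

lemma bilForm_smul_right (c : ℝ) (u v : Fin n → ℝ) :
    bilForm G u (c • v) = c * bilForm G u v := by
  simp only [bilForm, Finset.mul_sum, Pi.smul_apply, smul_eq_mul]
  exact Finset.sum_congr rfl fun i _ => Finset.sum_congr rfl fun j _ => by ring

lemma bilForm_neg_left (u v : Fin n → ℝ) : bilForm G (-u) v = -bilForm G u v := by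
  simpa using bilForm_smul_left G (-1) u v

lemma bilForm_neg_right (u v : Fin n → ℝ) : bilForm G u (-v) = -bilForm G u v := by
  simpa using bilForm_smul_right G (-1) u v

lemma bilForm_sub_left (u u' v : Fin n → ℝ) :
    bilForm G (u - u') v = bilForm G u v - bilForm G u' v := by
  rw [sub_eq_add_neg, bilForm_add_left, bilForm_neg_left, ← sub_eq_add_neg]

lemma bilForm_zero_left (v : Fin n → ℝ) : bilForm G 0 v = 0 := by
  simp [bilForm]

lemma bilForm_zero_right (v : Fin n → ℝ) : bilForm G v 0 = 0 := by
  simp [bilForm]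

lemma bilForm_sum_left {ι : Type*} (s : Finset ι) (f : ι → Fin n → ℝ) (v : Fin n → ℝ) :
    bilForm G (∑ i ∈ s, f i) v = ∑ i ∈ s, bilForm G (f i) v := by
  classical
  induction s using Finset.induction_on with
  | empty => simp [bilForm_zero_left]
  | insert a s ha ih => rw [Finset.sum_insert ha, Finset.sum_insert ha, bilForm_add_left, ih]

lemma bilForm_sum_right {ι : Type*} (s : Finset ι) (f : ι → Fin n → ℝ) (v : Fin n → ℝ) :
    bilForm G v (∑ i ∈ s, f i) = ∑ i ∈ s, bilForm G v (f i) := by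
  classical
  induction s using Finset.induction_on with
  | empty => simp [bilForm_zero_right]
  | insert a s ha ih => rw [Finset.sum_insert ha, Finset.sum_insert ha, bilForm_add_right, ih]

lemma bilForm_comm (hG : ∀ i j, G i j = G j i) (u v : Fin n → ℝ) :
    bilForm G u v = bilForm G v u := by
  simp only [bilForm]
  rw [Finset.sum_comm]
  exact Finset.sum_congr rfl fun i _ => Finset.sum_congr rfl fun j _ => by rw [hG]; ring

lemma abs_bilForm_le (u v : Fin n → ℝ) :
    |bilForm G u v| ≤ (n : ℝ) ^ 2 * ‖G‖ * ‖u‖ * ‖v‖ := by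
  have h : ∀ i j, |G i j * u i * v j| ≤ ‖G‖ * ‖u‖ * ‖v‖ := fun i j => by
    rw [abs_mul, abs_mul]
    gcongr
    · exact (norm_le_pi_norm (G i) j).trans (norm_le_pi_norm G i)
    · exact norm_le_pi_norm u i
    · exact norm_le_pi_norm v j
  calc |bilForm G u v| ≤ ∑ i : Fin n, ∑ j : Fin n, ‖G‖ * ‖u‖ * ‖v‖ :=
        (Finset.abs_sum_le_sum_abs _ _).trans (Finset.sum_le_sum fun i _ =>
          (Finset.abs_sum_le_sum_abs _ _).trans (Finset.sum_le_sum fun j _ => h i j))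
    _ = _ := by simp; ring

lemma bilForm_sub_form (G' : Fin n → Fin n → ℝ) (u v : Fin n → ℝ) :
    bilForm (G - G') u v = bilForm G u v - bilForm G' u v := by
  simp only [bilForm, ← Finset.sum_sub_distrib, Pi.sub_apply]
  exact Finset.sum_congr rfl fun i _ => Finset.sum_congr rfl fun j _ => by ring

end BilForm

/-- The Euclidean norm on `ℝⁿ`. -/
def euclNorm {n : ℕ} (v : Fin n → ℝ) : ℝ := √(v ⬝ᵥ v)

section EuclNorm

variable {n : ℕ}

lemma dotProduct_self_nonneg_real (v : Fin n → ℝ) : 0 ≤ v ⬝ᵥ v :=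
  Finset.sum_nonneg fun i _ => mul_self_nonneg (v i)

lemma euclNorm_sq (v : Fin n → ℝ) : euclNorm v ^ 2 = v ⬝ᵥ v :=
  Real.sq_sqrt (dotProduct_self_nonneg_real v)

lemma euclNorm_nonneg (v : Fin n → ℝ) : 0 ≤ euclNorm v := Real.sqrt_nonneg _

lemma norm_le_euclNorm (v : Fin n → ℝ) : ‖v‖ ≤ euclNorm v := by
  refine (pi_norm_le_iff_of_nonneg (euclNorm_nonneg v)).2 fun i => ?_
  refine Real.abs_le_sqrt ?_
  rw [sq]
  exact Finset.single_le_sum (f := fun i => v i * v i) (fun i _ => mul_self_nonneg (v i))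
    (Finset.mem_univ i)

lemma euclNorm_sq_le (v : Fin n → ℝ) : euclNorm v ^ 2 ≤ n * ‖v‖ ^ 2 := by
  rw [euclNorm_sq]
  calc v ⬝ᵥ v ≤ ∑ _i : Fin n, ‖v‖ ^ 2 := Finset.sum_le_sum fun i _ => by
        rw [← sq, ← sq_abs]
        gcongr
        exact norm_le_pi_norm v i
    _ = n * ‖v‖ ^ 2 := by simp

lemma euclNorm_smul (c : ℝ) (v : Fin n → ℝ) : euclNorm (c • v) = |c| * euclNorm v := by
  rw [euclNorm, smul_dotProduct, dotProduct_smul, smul_eq_mul, smul_eq_mul, ← mul_assoc, ← sq,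
    Real.sqrt_mul (sq_nonneg c), Real.sqrt_sq_eq_abs, euclNorm]

lemma euclNorm_pos {v : Fin n → ℝ} (hv : v ≠ 0) : 0 < euclNorm v :=
  (norm_pos_iff.2 hv).trans_le (norm_le_euclNorm v)

@[fun_prop]
lemma continuous_euclNorm : Continuous (euclNorm (n := n)) := by
  unfold euclNorm dotProduct
  fun_prop

lemma norm_le_one_of_euclNorm_eq_one {v : Fin n → ℝ} (hv : euclNorm v = 1) : ‖v‖ ≤ 1 :=
  hv ▸ norm_le_euclNorm v

end EuclNorm

namespace C1Spacetime

variable {n : ℕ} (M : C1Spacetime n)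

lemma bilForm_symm (z u v : SpacetimePt n) : bilForm (M.g z) u v = bilForm (M.g z) v u :=
  bilForm_comm _ (M.g_symm z) u v

lemma continuous_g : Continuous M.g := M.g_contDiff.continuous

lemma continuous_bilForm {Y : Type*} [TopologicalSpace Y] {f u v : Y → SpacetimePt n}
    (hf : Continuous f) (hu : Continuous u) (hv : Continuous v) :
    Continuous fun y => bilForm (M.g (f y)) (u y) (v y) := by
  have h := M.continuous_g.comp hf
  have h' : ∀ i j, Continuous fun y => M.g (f y) i j := fun i j =>
    (continuous_apply j).comp ((continuous_apply i).comp h)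
  unfold bilForm
  fun_prop

/-- Vectors orthogonal to a timelike vector are spacelike. -/
lemma bilForm_pos_of_orthogonal {z X v : SpacetimePt n} (hX : bilForm (M.g z) X X < 0)
    (hv : bilForm (M.g z) v X = 0) (hv0 : v ≠ 0) : 0 < bilForm (M.g z) v v := by
  obtain ⟨L, hL⟩ := M.g_lorentz z
  have expand : ∀ a b : Fin n → ℝ, bilForm (M.g z) (L a) (L b) =
      ∑ i, ∑ j, a i * b j * minkowskiMatrix n i j := by
    intro a b
    conv_lhs => rw [pi_eq_sum_univ' a, pi_eq_sum_univ' b]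
    simp only [map_sum, map_smul, bilForm_sum_left, bilForm_sum_right, bilForm_smul_left,
      bilForm_smul_right]
    simp only [Finset.mul_sum]
    rw [Finset.sum_comm]
    refine Finset.sum_congr rfl fun i _ => Finset.sum_congr rfl fun j _ => ?_
    rw [← hL i j]
    ring
  obtain ⟨a, rfl⟩ := L.surjective X
  obtain ⟨b, rfl⟩ := L.surjective v
  rw [expand] at hX hv ⊢
  have hb0 : b ≠ 0 := fun h => hv0 (by rw [h, map_zero])
  clear expand hL
  cases n with
  | zero => exact absurd (Subsingleton.elim b 0) hb0
  | succ m =>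
    have key : ∀ a b : Fin (m+1) → ℝ, ∑ i, ∑ j, a i * b j * minkowskiMatrix (m+1) i j
        = -(a 0 * b 0) + ∑ i : Fin m, a i.succ * b i.succ := by
      intro a b
      simp [minkowskiMatrix, Fin.sum_univ_succ]
    rw [key] at hX hv ⊢
    have cs := Finset.sum_mul_sq_le_sq_mul_sq Finset.univ (fun i : Fin m => b i.succ)
      (fun i : Fin m => a i.succ)
    have e1 : ∀ c : Fin (m+1) → ℝ, ∑ i : Fin m, c i.succ * c i.succ = ∑ i : Fin m, c i.succ ^ 2 :=
      fun c => by simp only [sq]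
    rw [e1] at hX ⊢
    set A := ∑ i : Fin m, a i.succ ^ 2
    set B := ∑ i : Fin m, b i.succ ^ 2 with hB
    have hA0 : 0 ≤ A := Finset.sum_nonneg fun i _ => sq_nonneg _
    have hB0 : 0 ≤ B := Finset.sum_nonneg fun i _ => sq_nonneg _
    have hs : ∑ i : Fin m, b i.succ * a i.succ = b 0 * a 0 := by linarith
    rw [hs] at cs
    have ha0 : 0 < a 0 * a 0 := by linarith
    rcases hB0.eq_or_lt with h | h
    · exfalso
      apply hb0
      have h2 : ∀ i : Fin m, b i.succ = 0 := fun i => by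
        have := (Finset.sum_eq_zero_iff_of_nonneg (fun i _ => sq_nonneg (b (Fin.succ i)))).1
          (hB ▸ h.symm) i (Finset.mem_univ i)
        simpa using this
      have h3 : b 0 = 0 := by
        rw [← h, zero_mul] at cs
        have h4 : b 0 * a 0 = 0 := by nlinarith [sq_nonneg (b 0 * a 0)]
        rcases mul_eq_zero.1 h4 with h5 | h5
        · exact h5
        · rw [h5] at ha0; simp at ha0
      ext i
      refine Fin.cases h3 h2 i
    · have : (b 0 * b 0) * (a 0 * a 0) < B * (a 0 * a 0) := by nlinarith
      nlinarith [lt_of_mul_lt_mul_right this ha0.le]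

lemma bilForm_nonneg_of_orthogonal {z X v : SpacetimePt n} (hX : bilForm (M.g z) X X < 0)
    (hv : bilForm (M.g z) v X = 0) : 0 ≤ bilForm (M.g z) v v := by
  by_cases h : v = 0
  · rw [h, bilForm_zero_left]
  · exact (M.bilForm_pos_of_orthogonal hX hv h).le

/-- The reverse Cauchy–Schwarz inequality. -/
lemma reverse_cauchy_schwarz {z X : SpacetimePt n} (v : SpacetimePt n)
    (hX : bilForm (M.g z) X X < 0) :
    bilForm (M.g z) v v * bilForm (M.g z) X X ≤ bilForm (M.g z) v X ^ 2 := by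
  set N := bilForm (M.g z) X X
  set b := bilForm (M.g z) v X with hb
  have h : bilForm (M.g z) (N • v - b • X) X = 0 := by
    rw [bilForm_sub_left, bilForm_smul_left, bilForm_smul_left]
    ring
  have h2 := M.bilForm_nonneg_of_orthogonal hX h
  rw [M.bilForm_symm _ (N • v - b • X), bilForm_sub_left, bilForm_smul_left, bilForm_smul_left,
    M.bilForm_symm z X, h, M.bilForm_symm z v, bilForm_sub_left, bilForm_smul_left,
    bilForm_smul_left, M.bilForm_symm z X v, ← hb] at h2
  have hN : N < 0 := hX
  nlinarith

/-- Vectors `v` causal and future, `w` timelike and future have negative product. -/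
lemma bilForm_neg_of_future {z X v w : SpacetimePt n} (hX : bilForm (M.g z) X X < 0)
    (hv : bilForm (M.g z) v v ≤ 0) (hvX : bilForm (M.g z) v X < 0)
    (hw : bilForm (M.g z) w w < 0) (hwX : bilForm (M.g z) w X < 0) :
    bilForm (M.g z) v w < 0 := by
  set a := bilForm (M.g z) w X with ha
  set b := bilForm (M.g z) v X with hb
  have h : bilForm (M.g z) (a • v - b • w) X = 0 := by
    rw [bilForm_sub_left, bilForm_smul_left, bilForm_smul_left]
    ring
  have h2 := M.bilForm_nonneg_of_orthogonal hX h
  rw [bilForm_sub_left, bilForm_smul_left, bilForm_smul_left, M.bilForm_symm z v (_ - _),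
    M.bilForm_symm z w (_ - _), bilForm_sub_left, bilForm_sub_left, bilForm_smul_left,
    bilForm_smul_left, bilForm_smul_left, bilForm_smul_left, M.bilForm_symm z w v] at h2
  have hab : 0 < a * b := mul_pos_of_neg_of_neg hwX hvX
  have h3 : 0 < b * b := mul_pos_of_neg_of_neg hvX hvX
  by_contra hcon
  push Not at hcon
  nlinarith [mul_nonneg hab.le hcon, mul_nonneg_of_nonpos_of_nonpos (mul_nonneg_of_nonpos_of_nonpos hwX.le hwX.le |> neg_nonpos.2) hv, mul_pos_of_neg_of_neg (neg_neg_of_pos h3) hw]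

/-- Reverse Cauchy–Schwarz for future-directed vectors, in square-root form. -/
lemma sqrt_mul_sqrt_le_of_future {z X v w : SpacetimePt n} (hX : bilForm (M.g z) X X < 0)
    (hv : bilForm (M.g z) v v ≤ 0) (hvX : bilForm (M.g z) v X < 0)
    (hw : bilForm (M.g z) w w < 0) (hwX : bilForm (M.g z) w X < 0) :
    √(-bilForm (M.g z) w w) * √(-bilForm (M.g z) v v) ≤ -bilForm (M.g z) v w := by
  have h := M.bilForm_neg_of_future hX hv hvX hw hwX
  rw [← Real.sqrt_mul (by linarith)]
  refine Real.sqrt_le_iff.2 ⟨by linarith, ?_⟩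
  have := M.reverse_cauchy_schwarz v hw
  nlinarith

lemma bilForm_X0_ne_zero {z v : SpacetimePt n} (hv : M.CausalVec z v) :
    bilForm (M.g z) v (M.X0 z) ≠ 0 := fun h =>
  absurd hv.2 (not_le.2 (M.bilForm_pos_of_orthogonal (M.X0_timelike z) h hv.1))

/-- A dual characterisation of the causal cone together with its length function. -/
lemma causal_of_dual {z v : SpacetimePt n} {f : ℝ} (hf : 0 ≤ f)
    (hvX : bilForm (M.g z) v (M.X0 z) < 0)
    (h : ∀ w, bilForm (M.g z) w w < 0 → bilForm (M.g z) w (M.X0 z) < 0 →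
      √(-bilForm (M.g z) w w) * f ≤ -bilForm (M.g z) v w) :
    bilForm (M.g z) v v ≤ 0 ∧ f ≤ √(-bilForm (M.g z) v v) := by
  set X := M.X0 z
  set N := -bilForm (M.g z) X X with hN
  have hN0 : 0 < N := neg_pos.2 (M.X0_timelike z)
  set β := -bilForm (M.g z) v X with hβ
  have hβ0 : 0 < β := neg_pos.2 hvX
  set D := β ^ 2 / N with hD
  have hD0 : 0 < D := by positivity
  set u := v - (β / N) • X with hu
  have huX : bilForm (M.g z) u X = 0 := by
    rw [hu, bilForm_sub_left, bilForm_smul_left]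
    have : bilForm (M.g z) X X = -N := by rw [hN]; ring
    rw [this, show bilForm (M.g z) v X = -β by rw [hβ]; ring]
    field_simp
    ring
  set Q := bilForm (M.g z) u u with hQ
  have hQ0 : 0 ≤ Q := M.bilForm_nonneg_of_orthogonal (M.X0_timelike z) huX
  have hv : v = (β / N) • X + u := by rw [hu]; abel
  have hXX : bilForm (M.g z) X X = -N := by rw [hN]; ring
  have comb : ∀ θ : ℝ, bilForm (M.g z) v ((β / N) • X + θ • u) = -D + θ * Q := by
    intro θ
    rw [hv]
    simp only [bilForm_add_left, bilForm_add_right, bilForm_smul_left, bilForm_smul_right, huX,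
      M.bilForm_symm z X u, hXX, ← hQ, hD]
    field_simp
    ring
  have sqr : ∀ θ : ℝ, bilForm (M.g z) ((β / N) • X + θ • u) ((β / N) • X + θ • u)
      = -(D - θ ^ 2 * Q) := by
    intro θ
    simp only [bilForm_add_left, bilForm_add_right, bilForm_smul_left, bilForm_smul_right, huX,
      M.bilForm_symm z X u, hXX, ← hQ, hD]
    field_simp
    ring
  have key : ∀ θ : ℝ, θ ^ 2 * Q < D → √(D - θ ^ 2 * Q) * f ≤ D - θ * Q := by
    intro θ hθ
    have h1 := h ((β / N) • X + θ • u) (by rw [sqr]; linarith) (by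
      simp only [bilForm_add_left, bilForm_smul_left, huX, hXX]
      field_simp
      linarith)
    rw [sqr, comb, neg_neg] at h1
    linarith
  have hvv : bilForm (M.g z) v v = -(D - Q) := by
    have := sqr 1
    rw [one_smul, ← hv] at this
    rw [this]
    ring
  rw [hvv]
  rcases lt_trichotomy Q D with hlt | heq | hgt
  · refine ⟨by linarith, ?_⟩
    have h1 := key 1 (by linarith)
    have h2 : 0 < √(D - Q) := Real.sqrt_pos.2 (by linarith)
    have h3 := Real.mul_self_sqrt (show 0 ≤ D - Q by linarith)
    simp only [one_pow, one_mul] at h1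
    rw [neg_neg]
    exact le_of_mul_le_mul_left (by rw [h3]; exact h1) h2
  · refine ⟨by linarith, ?_⟩
    rw [heq, sub_self, neg_zero, neg_zero, Real.sqrt_zero]
    by_contra hf0
    push Not at hf0
    -- choose `θ = 1 - e`
    obtain ⟨e, he0, he1, he⟩ : ∃ e : ℝ, 0 < e ∧ e < 1 ∧ D * e < f ^ 2 := by
      refine ⟨min (1/2) (f ^ 2 / (2 * D)), by positivity, by
        exact (min_le_left _ _).trans_lt (by norm_num), ?_⟩
      calc D * min (1/2) (f ^ 2 / (2 * D)) ≤ D * (f ^ 2 / (2 * D)) := by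
            gcongr; exact min_le_right _ _
        _ = f ^ 2 / 2 := by field_simp
        _ < f ^ 2 := by nlinarith
    have hlt : (1 - e) ^ 2 * Q < D := by
      rw [heq]
      nlinarith [mul_pos (mul_pos hD0 he0) (show 0 < 2 - e by linarith)]
    have h1 := key (1 - e) hlt
    rw [heq] at h1
    have h2 : 0 ≤ D - (1 - e) ^ 2 * D := by rw [heq] at hlt; linarith
    have h3 : (√(D - (1 - e) ^ 2 * D) * f) ^ 2 ≤ (D - (1 - e) * D) ^ 2 := by
      gcongr
    rw [mul_pow, Real.sq_sqrt h2] at h3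
    have h4 : D * e * ((2 - e) * f ^ 2) ≤ D * e * (D * e) := by nlinarith
    have h5 := le_of_mul_le_mul_left h4 (by positivity)
    nlinarith [sq_nonneg f]
  · exfalso
    -- choose `θ` with `D / Q < θ` and `θ ^ 2 < D / Q`
    have hQpos : 0 < Q := hD0.trans hgt
    have hr : D / Q < 1 := (div_lt_one hQpos).2 hgt
    have hr0 : 0 < D / Q := by positivity
    have hlt : D / Q < √(D / Q) := by
      refine Real.lt_sqrt_of_sq_lt ?_
      nlinarith
    obtain ⟨θ, h1, h2⟩ := exists_between hlt
    have h3 : θ ^ 2 < D / Q := by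
      have := Real.sq_sqrt hr0.le
      nlinarith [Real.sqrt_nonneg (D / Q)]
    have h4 : θ ^ 2 * Q < D := (lt_div_iff₀ hQpos).1 h3
    have h5 : D < θ * Q := (div_lt_iff₀ hQpos).1 h1
    have h6 := key θ h4
    have : 0 ≤ √(D - θ ^ 2 * Q) * f := by positivity
    linarith

end C1Spacetime

namespace C1Spacetime

variable {n : ℕ} (M : C1Spacetime n)

/-- On a compact set future causal vectors are uniformly future. -/
lemma exists_future_bound {K : Set (SpacetimePt n)} (hK : IsCompact K) :
    ∃ c > 0, ∀ z ∈ K, ∀ v, M.CausalVec z v → M.FdVec z v →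
      bilForm (M.g z) v (M.X0 z) ≤ -(c * ‖v‖) := by
  have hX : Continuous fun x : SpacetimePt n × SpacetimePt n =>
      bilForm (M.g x.1) x.2 (M.X0 x.1) :=
    M.continuous_bilForm continuous_fst continuous_snd (M.X0_cont.comp continuous_fst)
  have hC1 : IsClosed {x : SpacetimePt n × SpacetimePt n | bilForm (M.g x.1) x.2 x.2 ≤ 0} :=
    isClosed_le (M.continuous_bilForm continuous_fst continuous_snd continuous_snd)
      continuous_const
  have hC2 : IsClosed {x : SpacetimePt n × SpacetimePt n |
      bilForm (M.g x.1) x.2 (M.X0 x.1) ≤ 0} := isClosed_le hX continuous_const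
  have hS := ((hK.prod (isCompact_sphere (0 : SpacetimePt n) 1)).inter_right hC1).inter_right hC2
  have hpos : ∀ x ∈ (K ×ˢ Metric.sphere (0 : SpacetimePt n) 1) ∩
      {x : SpacetimePt n × SpacetimePt n | bilForm (M.g x.1) x.2 x.2 ≤ 0} ∩
      {x : SpacetimePt n × SpacetimePt n | bilForm (M.g x.1) x.2 (M.X0 x.1) ≤ 0},
      0 < -bilForm (M.g x.1) x.2 (M.X0 x.1) := by
    rintro ⟨z, v⟩ ⟨⟨⟨hz, hv⟩, h1⟩, h2⟩
    have hv0 : v ≠ 0 := by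
      rintro rfl
      simp at hv
    exact neg_pos.2 (lt_of_le_of_ne h2 (M.bilForm_X0_ne_zero ⟨hv0, h1⟩))
  obtain ⟨c, hc0, hc⟩ := hS.exists_forall_le' hX.neg.continuousOn hpos
  refine ⟨c, hc0, fun z hz v hv hfd => ?_⟩
  have hn : 0 < ‖v‖ := norm_pos_iff.2 hv.1
  have e1 : bilForm (M.g z) (‖v‖⁻¹ • v) (‖v‖⁻¹ • v) ≤ 0 := by
    rw [bilForm_smul_left, bilForm_smul_right, ← mul_assoc]
    exact mul_nonpos_of_nonneg_of_nonpos (by positivity) hv.2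
  have e2 : bilForm (M.g z) (‖v‖⁻¹ • v) (M.X0 z) ≤ 0 := by
    rw [bilForm_smul_left]
    exact mul_nonpos_of_nonneg_of_nonpos (by positivity) (le_of_lt hfd)
  have e3 : ‖v‖⁻¹ • v ∈ Metric.sphere (0 : SpacetimePt n) 1 := by
    rw [mem_sphere_zero_iff_norm, norm_smul, norm_inv, norm_norm, inv_mul_cancel₀ hn.ne']
  have : c ≤ -bilForm (M.g z) (‖v‖⁻¹ • v) (M.X0 z) := hc (z, ‖v‖⁻¹ • v) ⟨⟨⟨hz, e3⟩, e1⟩, e2⟩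
  rw [bilForm_smul_left] at this
  have h2 : c * ‖v‖ ≤ -(‖v‖⁻¹ * bilForm (M.g z) v (M.X0 z)) * ‖v‖ := by gcongr
  have h3 : -(‖v‖⁻¹ * bilForm (M.g z) v (M.X0 z)) * ‖v‖ = -bilForm (M.g z) v (M.X0 z) := by
    field_simp
  linarith

lemma exists_bilForm_bound {K : Set (SpacetimePt n)} (hK : IsCompact K) :
    ∃ G > 0, ∀ z ∈ K, ‖M.X0 z‖ ≤ G ∧ ∀ u v, |bilForm (M.g z) u v| ≤ G * ‖u‖ * ‖v‖ := by
  obtain ⟨A, hA⟩ := hK.exists_bound_of_continuousOn M.continuous_g.continuousOn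
  obtain ⟨A', hA'⟩ := hK.exists_bound_of_continuousOn M.X0_cont.continuousOn
  refine ⟨max 1 (max A' (n ^ 2 * A)), by positivity, fun z hz => ⟨?_, fun u v => ?_⟩⟩
  · exact (hA' z hz).trans ((le_max_left _ _).trans (le_max_right _ _))
  · refine (abs_bilForm_le _ u v).trans ?_
    gcongr
    exact le_trans (by gcongr; exact hA z hz) ((le_max_right _ _).trans (le_max_right _ _))

lemma exists_bilForm_lipschitz {K : Set (SpacetimePt n)} (hK : IsCompact K) (hc : Convex ℝ K) :
    ∃ G > 0, ∀ z ∈ K, ∀ z' ∈ K, ∀ u v,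
      |bilForm (M.g z') u v - bilForm (M.g z) u v| ≤ G * ‖z' - z‖ * ‖u‖ * ‖v‖ := by
  obtain ⟨C, hC⟩ := M.g_contDiff.contDiffOn.exists_lipschitzOnWith one_ne_zero hc hK
  refine ⟨n ^ 2 * C + 1, by positivity, fun z hz z' hz' u v => ?_⟩
  rw [← bilForm_sub_form]
  refine (abs_bilForm_le _ u v).trans ?_
  have h := hC.norm_sub_le hz' hz
  have h' : (n : ℝ) ^ 2 * ‖M.g z' - M.g z‖ ≤ (n ^ 2 * C + 1) * ‖z' - z‖ := by
    calc (n : ℝ) ^ 2 * ‖M.g z' - M.g z‖ ≤ n ^ 2 * (C * ‖z' - z‖) :=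
          mul_le_mul_of_nonneg_left h (by positivity)
      _ ≤ (n ^ 2 * C + 1) * ‖z' - z‖ := by nlinarith [norm_nonneg (z' - z)]
  exact mul_le_mul_of_nonneg_right (mul_le_mul_of_nonneg_right h' (norm_nonneg _)) (norm_nonneg _)

lemma eventually_length_le (z w : SpacetimePt n) (hw : bilForm (M.g z) w w < 0)
    (hwX : bilForm (M.g z) w (M.X0 z) < 0) {δ : ℝ} (hδ : 0 < δ) :
    ∀ᶠ z' in 𝓝 z, ∀ v, ‖v‖ ≤ 1 → M.CausalVec z' v → M.FdVec z' v →
      √(-bilForm (M.g z) w w) * √(-bilForm (M.g z') v v) ≤ -bilForm (M.g z) v w + δ := by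
  let h : SpacetimePt n × SpacetimePt n → ℝ := fun x =>
    (√(-bilForm (M.g z) w w) - √(-bilForm (M.g x.1) w w)) * √(-bilForm (M.g x.1) x.2 x.2)
      + (bilForm (M.g z) x.2 w - bilForm (M.g x.1) x.2 w)
  have hh : Continuous h := by
    have h1 : Continuous fun x : SpacetimePt n × SpacetimePt n => bilForm (M.g x.1) w w :=
      M.continuous_bilForm continuous_fst continuous_const continuous_const
    have h2 : Continuous fun x : SpacetimePt n × SpacetimePt n => bilForm (M.g x.1) x.2 x.2 :=
      M.continuous_bilForm continuous_fst continuous_snd continuous_snd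
    have h3 : Continuous fun x : SpacetimePt n × SpacetimePt n => bilForm (M.g x.1) x.2 w :=
      M.continuous_bilForm continuous_fst continuous_snd continuous_const
    have h4 : Continuous fun x : SpacetimePt n × SpacetimePt n => bilForm (M.g z) x.2 w :=
      M.continuous_bilForm continuous_const continuous_snd continuous_const
    fun_prop
  have e1 : ∀ᶠ z' in 𝓝 z, ∀ v ∈ Metric.closedBall (0 : SpacetimePt n) 1, h (z', v) < δ := by
    refine (isCompact_closedBall 0 1).eventually_forall_of_forall_eventually fun v _ => ?_
    refine hh.continuousAt.eventually (gt_mem_nhds ?_)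
    simpa [h] using hδ
  have e2 : ∀ᶠ z' in 𝓝 z, bilForm (M.g z') w w < 0 :=
    (M.continuous_bilForm continuous_id continuous_const continuous_const).continuousAt.eventually
      (gt_mem_nhds hw)
  have e3 : ∀ᶠ z' in 𝓝 z, bilForm (M.g z') w (M.X0 z') < 0 :=
    (M.continuous_bilForm continuous_id continuous_const M.X0_cont).continuousAt.eventually
      (gt_mem_nhds hwX)
  filter_upwards [e1, e2, e3] with z' h1 h2 h3 v hv hc hf
  have := h1 v (by simpa using hv)
  have h4 := M.sqrt_mul_sqrt_le_of_future (M.X0_timelike z') hc.2 hf h2 h3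
  simp only [h] at this
  linarith

lemma eventually_future_bound (z : SpacetimePt n) :
    ∃ c > 0, ∀ᶠ z' in 𝓝 z, ∀ v, euclNorm v = 1 → M.CausalVec z' v → M.FdVec z' v →
      bilForm (M.g z) v (M.X0 z) ≤ -c := by
  obtain ⟨c, hc0, hc⟩ := M.exists_future_bound (isCompact_closedBall z 1)
  let h : SpacetimePt n × SpacetimePt n → ℝ := fun x =>
    bilForm (M.g z) x.2 (M.X0 z) - bilForm (M.g x.1) x.2 (M.X0 x.1)
  have hh : Continuous h :=
    (M.continuous_bilForm continuous_const continuous_snd continuous_const).sub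
      (M.continuous_bilForm continuous_fst continuous_snd (M.X0_cont.comp continuous_fst))
  have hs : ∀ v : SpacetimePt n, euclNorm v = 1 → 1 / (n + 1 : ℝ) ≤ ‖v‖ := fun v hv => by
    have h1 := euclNorm_sq_le v
    have h2 := norm_le_one_of_euclNorm_eq_one hv
    rw [hv] at h1
    rw [div_le_iff₀ (by positivity)]
    nlinarith [norm_nonneg v, mul_nonneg (Nat.cast_nonneg (α := ℝ) n) (norm_nonneg v)]
  have hc' : 0 < c * (1 / (n + 1 : ℝ)) / 2 := by positivity
  refine ⟨_, hc', ?_⟩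
  have e1 : ∀ᶠ z' in 𝓝 z, ∀ v ∈ Metric.closedBall (0 : SpacetimePt n) 1,
      h (z', v) < c * (1 / (n + 1 : ℝ)) / 2 := by
    refine (isCompact_closedBall 0 1).eventually_forall_of_forall_eventually fun v _ => ?_
    refine hh.continuousAt.eventually (gt_mem_nhds ?_)
    simpa [h] using hc'
  filter_upwards [e1, Metric.closedBall_mem_nhds z one_pos] with z' h1 h2 v hv hca hf
  have h3 := h1 v (by simpa using norm_le_one_of_euclNorm_eq_one hv)
  have h4 := hc z' h2 v hca hf
  simp only [h] at h3
  have h5 : c * (1 / (n + 1 : ℝ)) ≤ c * ‖v‖ := by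
    gcongr
    exact hs v hv
  linarith

end C1Spacetime

/-- The fundamental theorem of calculus for Lipschitz functions. -/
lemma LipschitzWith.integral_deriv_eq_sub_real {f : ℝ → ℝ} {K : ℝ≥0} (hf : LipschitzWith K f)
    (a b : ℝ) : ∫ t in a..b, deriv f t = f b - f a :=
  (hf.lipschitzOnWith.absolutelyContinuousOnInterval).integral_deriv_eq_sub

lemma norm_deriv_le_of_lipschitzWith {E : Type*} [NormedAddCommGroup E] [NormedSpace ℝ E]
    {f : ℝ → E} {K : ℝ≥0} (hf : LipschitzWith K f) (t : ℝ) : ‖deriv f t‖ ≤ K :=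
  norm_deriv_le_of_lipschitz hf

/-- Integration of a vector-valued derivative of a Lipschitz curve in `ℝⁿ`. -/
lemma LipschitzWith.integral_deriv_eq_sub_pi {n : ℕ} {f : ℝ → Fin n → ℝ} {K : ℝ≥0}
    (hf : LipschitzWith K f) (a b : ℝ) : ∫ t in a..b, deriv f t = f b - f a := by
  have hInt : IntervalIntegrable (deriv f) volume a b := by
    refine (intervalIntegrable_const (c := (K : ℝ))).mono_fun
      (measurable_deriv f).aestronglyMeasurable (ae_of_all _ fun t => ?_)
    simpa using norm_deriv_le_of_lipschitzWith hf t
  ext i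
  have hi : LipschitzWith K fun t => f t i := fun x y => (edist_le_pi_edist (f x) (f y) i).trans (hf x y)
  rw [Pi.sub_apply, ← hi.integral_deriv_eq_sub_real a b]
  have := ContinuousLinearMap.intervalIntegral_comp_comm
    (ContinuousLinearMap.proj (R := ℝ) (φ := fun _ : Fin n => ℝ) i) hInt
  simp only [ContinuousLinearMap.proj_apply] at this
  rw [← this]
  refine intervalIntegral.integral_congr_ae ?_
  filter_upwards [hf.ae_differentiableAt_real] with t ht _
  exact ((hasDerivAt_pi.1 ht.hasDerivAt) i).deriv.symm

lemma LipschitzWith.volume_image_eq_zero {s : ℝ → ℝ} {K : ℝ≥0} (hs : LipschitzWith K s)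
    {N : Set ℝ} (hN : volume N = 0) : volume (s '' N) = 0 := by
  have h := hs.hausdorffMeasure_image_le zero_le_one N
  have h1 : (Measure.hausdorffMeasure 1 : Measure ℝ) = volume := MeasureTheory.hausdorffMeasure_real
  rw [h1] at h
  simpa [hN] using h

lemma IntervalIntegrable.of_measurable_of_bound {E : Type*} [NormedAddCommGroup E]
    {f : ℝ → E} {C a b : ℝ}
    (hf : AEStronglyMeasurable f volume) (hC : ∀ t, ‖f t‖ ≤ C) :
    IntervalIntegrable f volume a b :=
  (intervalIntegrable_const (c := C)).mono_fun hf.restrict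
    (ae_of_all _ fun t => (hC t).trans (le_abs_self C))

namespace C1Spacetime

variable {n : ℕ} (M : C1Spacetime n)

/-- The Lorentzian speed of a curve. -/
def speed (γ : ℝ → SpacetimePt n) (t : ℝ) : ℝ :=
  √(-bilForm (M.g (γ t)) (deriv γ t) (deriv γ t))

/-- A future causal curve on `[0,ℓ]` parametrized by Euclidean arclength and extended
constantly. -/
structure NCurve (γ : ℝ → SpacetimePt n) (ℓ : ℝ) : Prop where
  pos : 0 < ℓ
  lip : LipschitzWith 1 γ
  left : ∀ s ≤ 0, γ s = γ 0
  right : ∀ s, ℓ ≤ s → γ s = γ ℓ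
  ae : ∀ᵐ s, s ∈ Ioo 0 ℓ → DifferentiableAt ℝ γ s ∧ M.CausalVec (γ s) (deriv γ s) ∧
    M.FdVec (γ s) (deriv γ s) ∧ euclNorm (deriv γ s) = 1

variable {M}

lemma gLength_eq (γ : ℝ → SpacetimePt n) (a b : ℝ) :
    M.gLength γ a b = ∫ t in a..b, M.speed γ t := rfl

lemma speed_nonneg (γ : ℝ → SpacetimePt n) (t : ℝ) : 0 ≤ M.speed γ t := Real.sqrt_nonneg _

lemma measurable_bilForm_deriv {γ : ℝ → SpacetimePt n} (hγ : Continuous γ) :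
    Measurable fun t => bilForm (M.g (γ t)) (deriv γ t) (deriv γ t) := by
  have hg : ∀ i j, Measurable fun t => M.g (γ t) i j := fun i j =>
    ((continuous_apply j).comp ((continuous_apply i).comp (M.continuous_g.comp hγ))).measurable
  have hd : ∀ i, Measurable fun t => deriv γ t i := fun i =>
    (measurable_pi_apply i).comp (measurable_deriv γ)
  unfold bilForm
  exact Finset.measurable_fun_sum _ fun i _ => Finset.measurable_fun_sum _ fun j _ =>
    ((hg i j).mul (hd i)).mul (hd j)

lemma measurable_speed {γ : ℝ → SpacetimePt n} (hγ : Continuous γ) : Measurable (M.speed γ) :=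
  (measurable_bilForm_deriv hγ).neg.sqrt

/-- A causal path on a compact interval agrees with a constantly extended Lipschitz curve. -/
lemma IsFdCausalPathOn.exists_lipschitz {γ : ℝ → SpacetimePt n} {a b : ℝ} (hab : a < b)
    (h : M.IsFdCausalPathOn γ (Icc a b)) :
    ∃ (K : ℝ≥0) (γ' : ℝ → SpacetimePt n), LipschitzWith K γ' ∧ (∀ t ∈ Icc a b, γ' t = γ t) ∧
      (∀ t ≤ a, γ' t = γ a) ∧ (∀ t, b ≤ t → γ' t = γ b) ∧
      (∀ t ∈ Ioo a b, deriv γ' t = deriv γ t) ∧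
      ∀ᵐ t, t ∈ Ioo a b → DifferentiableAt ℝ γ' t ∧ M.CausalVec (γ' t) (deriv γ' t) ∧
        M.FdVec (γ' t) (deriv γ' t) := by
  obtain ⟨-, -, hl, hae⟩ := h
  have hloc : LocallyLipschitzOn (Icc a b) γ := fun t ht => hl t ht
  obtain ⟨K, hK⟩ := hloc.exists_lipschitzOnWith_of_compact isCompact_Icc
  have hp : ∀ t, (projIcc a b hab.le t : ℝ) ∈ Icc a b := fun t => (projIcc a b hab.le t).2
  have heq : ∀ t ∈ Icc a b, γ (projIcc a b hab.le t) = γ t := fun t ht => by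
    rw [projIcc_of_mem hab.le ht]
  have hnhds : ∀ t ∈ Ioo a b, (fun t => γ (projIcc a b hab.le t)) =ᶠ[𝓝 t] γ := fun t ht => by
    filter_upwards [Ioo_mem_nhds ht.1 ht.2] with u hu using heq u (Ioo_subset_Icc_self hu)
  refine ⟨K, fun t => γ (projIcc a b hab.le t), ?_, heq, fun t ht => ?_, fun t ht => ?_,
    fun t ht => (hnhds t ht).deriv_eq, ?_⟩
  · refine LipschitzWith.of_dist_le_mul fun x y => (hK.dist_le_mul _ (hp x) _ (hp y)).trans ?_
    gcongr
    have := (LipschitzWith.projIcc hab.le).dist_le_mul x y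
    simpa [Subtype.dist_eq] using this
  · simp [projIcc_of_le_left hab.le ht]
  · simp [projIcc_of_right_le hab.le ht]
  · rw [ae_restrict_iff' measurableSet_Icc] at hae
    filter_upwards [hae] with t ht htI
    obtain ⟨h1, h2, h3⟩ := ht (Ioo_subset_Icc_self htI)
    rw [(hnhds t htI).deriv_eq, heq t (Ioo_subset_Icc_self htI)]
    exact ⟨h1.congr_of_eventuallyEq (hnhds t htI), h2, h3⟩

lemma CausalVec.smul {z v : SpacetimePt n} (h : M.CausalVec z v) {c : ℝ} (hc : 0 < c) :
    M.CausalVec z (c • v) := by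
  refine ⟨smul_ne_zero hc.ne' h.1, ?_⟩
  rw [bilForm_smul_left, bilForm_smul_right, ← mul_assoc]
  exact mul_nonpos_of_nonneg_of_nonpos (by positivity) h.2

lemma FdVec.smul {z v : SpacetimePt n} (h : M.FdVec z v) {c : ℝ} (hc : 0 < c) :
    M.FdVec z (c • v) := by
  rw [FdVec, bilForm_smul_left]
  exact mul_neg_of_pos_of_neg hc h

/-- Reparametrization by Euclidean arclength. -/
theorem IsFdCausalPathOn.exists_ncurve {γ : ℝ → SpacetimePt n} {a b : ℝ} (hab : a < b)
    (h : M.IsFdCausalPathOn γ (Icc a b)) :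
    ∃ (σ : ℝ → SpacetimePt n) (ℓ : ℝ), M.NCurve σ ℓ ∧ σ 0 = γ a ∧ σ ℓ = γ b ∧
      M.gLength σ 0 ℓ = M.gLength γ a b := by
  obtain ⟨K, f, hf, hfe, hfl, hfr, hfd, hae⟩ := h.exists_lipschitz hab
  let e : ℝ → ℝ := fun t => if t ∈ Ioo a b then euclNorm (deriv f t) else 1
  have heb : ∀ t, ‖e t‖ ≤ n * K ^ 2 + 1 := fun t => by
    by_cases ht : t ∈ Ioo a b
    · simp only [e, ht, if_true, Real.norm_eq_abs, abs_of_nonneg (euclNorm_nonneg _)]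
      have h1 := euclNorm_sq_le (deriv f t)
      have h2 : ‖deriv f t‖ ^ 2 ≤ (K : ℝ) ^ 2 :=
        pow_le_pow_left₀ (norm_nonneg _) (norm_deriv_le_of_lipschitzWith hf t) 2
      nlinarith [mul_le_mul_of_nonneg_left h2 (Nat.cast_nonneg (α := ℝ) n),
        sq_nonneg (euclNorm (deriv f t) - 1)]
    · simp only [e, ht, if_false, norm_one]
      nlinarith [mul_nonneg (Nat.cast_nonneg (α := ℝ) n) (sq_nonneg (K : ℝ))]
  have hem : Measurable e := Measurable.ite measurableSet_Ioo
    (continuous_euclNorm.measurable.comp (measurable_deriv f)) measurable_const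
  have hei : ∀ x y, IntervalIntegrable e volume x y := fun x y =>
    .of_measurable_of_bound hem.aestronglyMeasurable heb
  have hepos : ∀ᵐ t, 0 < e t := by
    filter_upwards [hae] with t ht
    by_cases hI : t ∈ Ioo a b
    · simpa only [e, hI, if_true] using euclNorm_pos (ht hI).2.1.1
    · simp only [e, hI, if_false, zero_lt_one]
  let s : ℝ → ℝ := fun t => ∫ u in a..t, e u
  have hsub : ∀ x y, s y - s x = ∫ u in x..y, e u := fun x y =>
    intervalIntegral.integral_interval_sub_left (hei _ _) (hei _ _)
  have hsm : StrictMono s := fun x y hxy => by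
    have h1 : 0 < ∫ u in x..y, e u := by
      rw [intervalIntegral.integral_pos_iff_support_of_nonneg_ae'
        (ae_restrict_of_ae (hepos.mono fun t ht => ht.le)) (hei x y)]
      refine ⟨hxy, ?_⟩
      have : (Function.support e ∩ Ioc x y : Set ℝ) =ᵐ[volume] (Ioc x y : Set ℝ) := by
        filter_upwards [hepos] with t ht
        exact propext ⟨fun h => h.2, fun h => ⟨ht.ne', h⟩⟩
      rw [measure_congr this]
      simp [hxy]
    have := hsub x y
    linarith
  have hsl : LipschitzWith ⟨n * K ^ 2 + 1, by positivity⟩ s := by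
    refine LipschitzWith.of_dist_le_mul fun x y => ?_
    rw [dist_comm, dist_eq_norm, dist_comm x y, Real.dist_eq, hsub]
    exact intervalIntegral.norm_integral_le_of_norm_le_const fun t _ => heb t
  have hsc : Continuous s := hsl.continuous
  have hsr : ∀ t, b ≤ t → s t = s b + (t - b) := fun t ht => by
    have : ∫ u in b..t, e u = ∫ u in b..t, (1 : ℝ) := by
      refine intervalIntegral.integral_congr fun u hu => ?_
      rw [uIcc_of_le ht] at hu
      simp [e, hu.1]
    have h2 := hsub b t
    simp only [this, intervalIntegral.integral_const, smul_eq_mul, mul_one] at h2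
    linarith
  have hsleft : ∀ t, t ≤ a → s t = t - a := fun t ht => by
    have : ∫ u in a..t, e u = ∫ u in a..t, (1 : ℝ) := by
      refine intervalIntegral.integral_congr fun u hu => ?_
      rw [uIcc_of_ge ht] at hu
      simp [e, hu.2]
    simp only [intervalIntegral.integral_const, smul_eq_mul, mul_one] at this
    exact this
  have hsurj : Function.Surjective s := by
    refine hsc.surjective ?_ ?_
    · refine Tendsto.congr' (f₁ := fun t => s b + (t - b)) ?_
        (tendsto_atTop_add_const_left _ _ (tendsto_atTop_add_const_right _ _ tendsto_id))
      filter_upwards [eventually_ge_atTop b] with t ht using (hsr t ht).symm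
    · refine Tendsto.congr' (f₁ := fun t => t - a) ?_
        (tendsto_atBot_add_const_right _ _ tendsto_id)
      filter_upwards [eventually_le_atBot a] with t ht using (hsleft t ht).symm
  let S : ℝ ≃o ℝ := hsm.orderIsoOfSurjective s hsurj
  let r : ℝ → ℝ := S.symm
  have hrs : ∀ t, r (s t) = t := fun t => S.symm_apply_apply t
  have hsr' : ∀ u, s (r u) = u := fun u => S.apply_symm_apply u
  have hrc : Continuous r := S.symm.continuous
  have hrm : StrictMono r := S.symm.strictMono
  have hsa : s a = 0 := by simp [s]
  have hr0 : r 0 = a := by rw [← hsa, hrs]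
  have hrb : r (s b) = b := hrs b
  have hℓ : 0 < s b := by rw [← hsa]; exact hsm hab
  have hlip : LipschitzWith 1 fun u => f (r u) := by
    have key : ∀ x y, x ≤ y → ‖f y - f x‖ ≤ s y - s x := fun x y hxy => by
      rw [hsub, ← hf.integral_deriv_eq_sub_pi x y]
      refine intervalIntegral.norm_integral_le_of_norm_le hxy ?_ (hei x y)
      have hne : ∀ c : ℝ, ∀ᵐ t : ℝ, t ≠ c := fun c => by simp [ae_iff]
      filter_upwards [hne a, hne b] with t hta htb _
      by_cases ht : t ∈ Ioo a b
      · simpa only [e, ht, if_true] using norm_le_euclNorm _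
      · have : deriv f t = 0 := by
          rcases lt_or_ge t a with h1 | h1
          · have : f =ᶠ[𝓝 t] fun _ => γ a := by
              filter_upwards [Iio_mem_nhds h1] with u hu using hfl u (le_of_lt hu)
            rw [this.deriv_eq, deriv_const]
          · have h2 : b < t := lt_of_le_of_ne
              (not_lt.1 fun h2 => ht ⟨lt_of_le_of_ne h1 hta.symm, h2⟩) htb.symm
            have : f =ᶠ[𝓝 t] fun _ => γ b := by
              filter_upwards [Ioi_mem_nhds h2] with u hu using hfr u (le_of_lt hu)
            rw [this.deriv_eq, deriv_const]
        simp only [e, ht, if_false, this, norm_zero, zero_le_one]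
    refine LipschitzWith.of_dist_le_mul fun u v => ?_
    rw [NNReal.coe_one, one_mul]
    rcases le_total u v with huv | huv
    · have := key (r u) (r v) (hrm.monotone huv)
      rw [hsr', hsr', ← dist_eq_norm, dist_comm] at this
      exact this.trans (by rw [dist_comm, Real.dist_eq]; exact le_abs_self _)
    · have := key (r v) (r u) (hrm.monotone huv)
      rw [hsr', hsr', ← dist_eq_norm] at this
      exact this.trans (by rw [Real.dist_eq]; exact le_abs_self _)
  -- the good set
  have hgood : ∀ᵐ t, t ∈ Ioo a b → DifferentiableAt ℝ f t ∧ M.CausalVec (f t) (deriv f t) ∧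
      M.FdVec (f t) (deriv f t) ∧ HasDerivAt s (euclNorm (deriv f t)) t := by
    have hloc : LocallyIntegrable e volume := by
      rw [locallyIntegrable_iff]
      intro k hk
      exact Integrable.mono' (g := fun _ => (n * K ^ 2 + 1 : ℝ))
        (integrableOn_const (hs := hk.measure_lt_top.ne)) hem.aestronglyMeasurable (ae_of_all _ heb)
    filter_upwards [hae, LocallyIntegrable.ae_hasDerivAt_integral hloc] with t ht h2 htI
    obtain ⟨h3, h4, h5⟩ := ht htI
    refine ⟨h3, h4, h5, ?_⟩
    have := h2 a
    simpa only [e, htI, if_true] using this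
  obtain ⟨N, hNsub, hNm, hN0⟩ := exists_measurable_superset_of_null (ae_iff.1 hgood)
  have hg : ∀ t ∈ Ioo a b \ N, DifferentiableAt ℝ f t ∧ M.CausalVec (f t) (deriv f t) ∧
      M.FdVec (f t) (deriv f t) ∧ HasDerivAt s (euclNorm (deriv f t)) t := fun t ht => by
    by_contra hcon
    exact ht.2 (hNsub fun h => hcon (h ht.1))
  have hσ : ∀ t ∈ Ioo a b \ N, HasDerivAt (fun u => f (r u))
      ((euclNorm (deriv f t))⁻¹ • deriv f t) (s t) := fun t ht => by
    obtain ⟨h1, h2, h3, h4⟩ := hg t ht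
    have hr' : HasDerivAt r (euclNorm (deriv f t))⁻¹ (s t) :=
      HasDerivAt.of_local_left_inverse hrc.continuousAt (by rw [hrs]; exact h4)
        (euclNorm_pos h2.1).ne' (Eventually.of_forall hsr')
    have h1' : HasDerivAt f (deriv f t) (r (s t)) := by rw [hrs]; exact h1.hasDerivAt
    exact h1'.scomp (s t) hr'
  have himg0 : volume (s '' N) = 0 := hsl.volume_image_eq_zero hN0
  have himg : ∀ u ∈ Ioo 0 (s b), u ∉ s '' N → ∃ t ∈ Ioo a b \ N, s t = u := fun u hu hN => by
    refine ⟨r u, ⟨⟨?_, ?_⟩, fun hc => hN ⟨r u, hc, hsr' u⟩⟩, hsr' u⟩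
    · rw [← hr0]; exact hrm hu.1
    · rw [← hrb]; exact hrm hu.2
  refine ⟨fun u => f (r u), s b, ⟨hℓ, hlip, ?_, ?_, ?_⟩, ?_, ?_, ?_⟩
  · intro u hu
    have h1 : r u ≤ a := by rw [← hr0]; exact hrm.monotone hu
    simp only [hr0]
    rw [hfl _ h1, hfl _ le_rfl]
  · intro u hu
    have h1 : b ≤ r u := by rw [← hrb]; exact hrm.monotone hu
    simp only [hrb]
    rw [hfr _ h1, hfr _ le_rfl]
  · have : ∀ᵐ u, u ∉ s '' N := measure_eq_zero_iff_ae_notMem.1 himg0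
    filter_upwards [this] with u hu hI
    obtain ⟨t, ht, rfl⟩ := himg u hI hu
    obtain ⟨h1, h2, h3, h4⟩ := hg t ht
    have hd := hσ t ht
    have hpos := inv_pos.2 (euclNorm_pos h2.1)
    rw [hd.deriv]
    simp only [hrs]
    refine ⟨hd.differentiableAt, h2.smul hpos, h3.smul hpos, ?_⟩
    rw [euclNorm_smul, abs_of_pos hpos, inv_mul_cancel₀ (euclNorm_pos h2.1).ne']
  · simp only [hr0]
    exact hfl _ le_rfl
  · simp only [hrb]
    exact hfr _ le_rfl
  · rw [gLength_eq, gLength_eq, intervalIntegral.integral_of_le hℓ.le,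
      intervalIntegral.integral_of_le hab.le, integral_Ioc_eq_integral_Ioo,
      integral_Ioc_eq_integral_Ioo]
    have e1 : ∫ u in Ioo 0 (s b), M.speed (fun u => f (r u)) u =
        ∫ u in s '' (Ioo a b \ N), M.speed (fun u => f (r u)) u := by
      refine setIntegral_congr_set ?_
      have : ∀ᵐ u, u ∉ s '' N := measure_eq_zero_iff_ae_notMem.1 himg0
      filter_upwards [this] with u hu
      refine propext ⟨fun hI => ?_, ?_⟩
      · obtain ⟨t, ht, rfl⟩ := himg u hI hu
        exact ⟨t, ht, rfl⟩
      · rintro ⟨t, ht, rfl⟩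
        exact ⟨by rw [← hsa]; exact hsm ht.1.1, hsm ht.1.2⟩
    have e2 : ∫ t in Ioo a b, M.speed γ t = ∫ t in Ioo a b \ N, M.speed γ t := by
      refine setIntegral_congr_set ?_
      have : ∀ᵐ u, u ∉ N := by rw [ae_iff]; simpa using hN0
      filter_upwards [this] with u hu
      exact propext ⟨fun hI => ⟨hI, hu⟩, fun hI => hI.1⟩
    rw [e1, e2, integral_image_eq_integral_abs_deriv_smul (measurableSet_Ioo.diff hNm)
      (fun t ht => (hg t ht).2.2.2.hasDerivWithinAt) hsm.injective.injOn]
    refine setIntegral_congr_fun (measurableSet_Ioo.diff hNm) fun t ht => ?_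
    obtain ⟨h1, h2, h3, h4⟩ := hg t ht
    have hpos := euclNorm_pos h2.1
    simp only [speed, (hσ t ht).deriv, hrs, bilForm_smul_left, bilForm_smul_right, smul_eq_mul,
      abs_of_pos hpos, ← hfd t ht.1, ← hfe t (Ioo_subset_Icc_self ht.1)]
    have : -((euclNorm (deriv f t))⁻¹ * ((euclNorm (deriv f t))⁻¹ *
        bilForm (M.g (f t)) (deriv f t) (deriv f t))) =
        ((euclNorm (deriv f t))⁻¹) ^ 2 * -bilForm (M.g (f t)) (deriv f t) (deriv f t) := by ring
    rw [this, Real.sqrt_mul (by positivity), Real.sqrt_sq (by positivity), ← mul_assoc,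
      mul_inv_cancel₀ hpos.ne', one_mul]

end C1Spacetime

namespace C1Spacetime

variable {n : ℕ} {M : C1Spacetime n}

lemma isFdCausalPathOn_of_lipschitz {f : ℝ → SpacetimePt n} {K : ℝ≥0} {a b : ℝ} (hab : a ≤ b)
    (hf : LipschitzWith K f)
    (hae : ∀ᵐ t, t ∈ Ioo a b → DifferentiableAt ℝ f t ∧ M.CausalVec (f t) (deriv f t) ∧
      M.FdVec (f t) (deriv f t)) : M.IsFdCausalPathOn f (Icc a b) := by
  refine ⟨ordConnected_Icc, nonempty_Icc.2 hab,
    fun t _ => ⟨K, univ, univ_mem, hf.lipschitzOnWith⟩, ?_⟩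
  rw [← restrict_Ioo_eq_restrict_Icc, ae_restrict_iff' measurableSet_Ioo]
  exact hae

lemma exists_speed_bound {f : ℝ → SpacetimePt n} {K : ℝ≥0} (hf : LipschitzWith K f)
    (a b : ℝ) : ∃ C, ∀ t ∈ uIcc a b, M.speed f t ≤ C := by
  obtain ⟨G, hG0, hG⟩ := M.exists_bilForm_bound
    ((isCompact_uIcc (a := a) (b := b)).image hf.continuous)
  refine ⟨√(G * K * K), fun t ht => Real.sqrt_le_sqrt ?_⟩
  refine (neg_le_abs _).trans (((hG _ (mem_image_of_mem f ht)).2 _ _).trans ?_)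
  gcongr <;> exact norm_deriv_le_of_lipschitzWith hf t

lemma intervalIntegrable_speed {f : ℝ → SpacetimePt n} {K : ℝ≥0} (hf : LipschitzWith K f)
    (a b : ℝ) : IntervalIntegrable (M.speed f) volume a b := by
  obtain ⟨C, hC⟩ := exists_speed_bound (M := M) hf a b
  refine (intervalIntegrable_const (c := C)).mono_fun
    (measurable_speed hf.continuous).aestronglyMeasurable ?_
  rw [EventuallyLE, ae_restrict_iff' measurableSet_uIoc]
  refine ae_of_all _ fun t ht => ?_
  rw [Real.norm_of_nonneg (speed_nonneg f t)]
  exact (hC t (uIoc_subset_uIcc ht)).trans (le_abs_self C)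

lemma gLength_nonneg (γ : ℝ → SpacetimePt n) {a b : ℝ} (hab : a ≤ b) : 0 ≤ M.gLength γ a b :=
  intervalIntegral.integral_nonneg hab fun t _ => speed_nonneg γ t

lemma le_ldist {γ : ℝ → SpacetimePt n} {a b : ℝ} (hab : a < b)
    (h : M.IsFdCausalPathOn γ (Icc a b)) :
    ENNReal.ofReal (M.gLength γ a b) ≤ M.ldist (γ a) (γ b) :=
  le_iSup_of_le γ <| le_iSup_of_le a <| le_iSup_of_le b <| le_iSup_of_le hab <|
    le_iSup_of_le h <| le_iSup_of_le rfl <| le_iSup_of_le rfl le_rfl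

lemma gLength_congr {γ γ' : ℝ → SpacetimePt n} {a b : ℝ} (hab : a ≤ b)
    (h : ∀ t ∈ Ioo a b, γ t = γ' t) : M.gLength γ a b = M.gLength γ' a b := by
  rw [gLength_eq, gLength_eq, intervalIntegral.integral_of_le hab,
    intervalIntegral.integral_of_le hab, integral_Ioc_eq_integral_Ioo,
    integral_Ioc_eq_integral_Ioo]
  refine setIntegral_congr_fun measurableSet_Ioo fun t ht => ?_
  have : γ =ᶠ[𝓝 t] γ' := by
    filter_upwards [Ioo_mem_nhds ht.1 ht.2] with u hu using h u hu
  simp only [speed, this.deriv_eq, h t ht]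

/-- Concatenation of causal paths. -/
lemma exists_concat {β σ : ℝ → SpacetimePt n} {a b c d : ℝ} (hab : a < b) (hcd : c < d)
    (hβ : M.IsFdCausalPathOn β (Icc a b)) (hσ : M.IsFdCausalPathOn σ (Icc c d))
    (hw : β b = σ c) :
    ∃ η : ℝ → SpacetimePt n, M.IsFdCausalPathOn η (Icc a (b + (d - c))) ∧ η a = β a ∧
      η (b + (d - c)) = σ d ∧
      M.gLength η a (b + (d - c)) = M.gLength β a b + M.gLength σ c d := by
  obtain ⟨K, f, hf, hfe, hfl, hfr, hfd, hae⟩ := hβ.exists_lipschitz hab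
  obtain ⟨K', f', hf', hfe', hfl', hfr', hfd', hae'⟩ := hσ.exists_lipschitz hcd
  let η : ℝ → SpacetimePt n := fun t => f t + (f' (t + (c - b)) - β b)
  have hη1 : ∀ t ≤ b, η t = f t := fun t ht => by
    simp [η, hfl' (t + (c - b)) (by linarith), hw]
  have hη2 : ∀ t, b ≤ t → η t = f' (t + (c - b)) := fun t ht => by
    simp [η, hfr t ht]
  have hshift : LipschitzWith 1 fun t : ℝ => t + (c - b) :=
    LipschitzWith.of_dist_le_mul fun x y => by simp
  have hη : LipschitzWith (K + (K' * 1 + 0)) η :=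
    hf.add ((hf'.comp hshift).sub (LipschitzWith.const _))
  have hn1 : ∀ t < b, η =ᶠ[𝓝 t] f := fun t ht => by
    filter_upwards [Iio_mem_nhds ht] with u hu using hη1 u (le_of_lt hu)
  have hn2 : ∀ t, b < t → η =ᶠ[𝓝 t] fun t => f' (t + (c - b)) := fun t ht => by
    filter_upwards [Ioi_mem_nhds ht] with u hu using hη2 u (le_of_lt hu)
  have hpath : M.IsFdCausalPathOn η (Icc a (b + (d - c))) := by
    refine isFdCausalPathOn_of_lipschitz (by linarith) hη ?_
    have hq : Measure.QuasiMeasurePreserving (fun t : ℝ => t + (c - b)) volume volume :=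
      (measurePreserving_add_right volume (c - b)).quasiMeasurePreserving
    have hne : ∀ᵐ t : ℝ, t ≠ b := by simp [ae_iff]
    filter_upwards [hae, hq.ae hae', hne] with t h1 h2 h3 ht
    rcases lt_or_gt_of_ne h3 with h | h
    · obtain ⟨h4, h5⟩ := h1 ⟨ht.1, h⟩
      rw [(hn1 t h).deriv_eq, hη1 t h.le]
      exact ⟨h4.congr_of_eventuallyEq (hn1 t h), h5⟩
    · obtain ⟨h4, h5⟩ := h2 ⟨by linarith, by linarith [ht.2]⟩
      rw [(hn2 t h).deriv_eq, hη2 t h.le, deriv_comp_add_const]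
      exact ⟨(h4.comp (f := fun t => t + (c - b)) t (by fun_prop)).congr_of_eventuallyEq (hn2 t h), h5⟩
  refine ⟨η, hpath, ?_, ?_, ?_⟩
  · rw [hη1 a hab.le, hfe a ⟨le_rfl, hab.le⟩]
  · rw [hη2 _ (by linarith), hfr' _ (by linarith)]
  · have hi := intervalIntegrable_speed (M := M) hη
    rw [gLength_eq, ← intervalIntegral.integral_add_adjacent_intervals (hi a b) (hi b _),
      ← gLength_eq, ← gLength_eq]
    congr 1
    · exact gLength_congr hab.le fun t ht =>
        (hη1 t ht.2.le).trans (hfe t (Ioo_subset_Icc_self ht))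
    · rw [gLength_congr (γ' := fun t => σ (t + (c - b))) (by linarith), gLength_eq, gLength_eq]
      · have : M.speed (fun t => σ (t + (c - b))) = fun t => M.speed σ (t + (c - b)) := by
          ext t
          simp only [speed, deriv_comp_add_const]
        rw [this, intervalIntegral.integral_comp_add_right]
        congr 1 <;> ring
      · intro t ht
        exact (hη2 t ht.1.le).trans (hfe' _ ⟨by linarith [ht.1], by linarith [ht.2]⟩)

lemma ldist_mono_right {p w x : SpacetimePt n} (h : M.causalLe w x) :
    M.ldist p w ≤ M.ldist p x := by
  rcases h with rfl | ⟨σ, c, d, hcd, hσ, rfl, rfl⟩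
  · exact le_rfl
  refine iSup_le fun β => iSup_le fun a => iSup_le fun b => iSup_le fun hab => iSup_le fun hβ =>
    iSup_le fun ha => iSup_le fun hb => ?_
  obtain ⟨η, h1, h2, h3, h4⟩ := exists_concat hab hcd hβ hσ hb
  have := le_ldist (by linarith) h1
  rw [h2, h3, h4, ha] at this
  refine le_trans (ENNReal.ofReal_le_ofReal ?_) this
  linarith [gLength_nonneg (M := M) σ hcd.le]

namespace NCurve

variable {γ : ℝ → SpacetimePt n} {ℓ : ℝ}

lemma isFdCausalPathOn (h : M.NCurve γ ℓ) {s t : ℝ} (hs : 0 ≤ s) (hst : s ≤ t) (ht : t ≤ ℓ) :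
    M.IsFdCausalPathOn γ (Icc s t) := by
  refine isFdCausalPathOn_of_lipschitz hst h.lip ?_
  filter_upwards [h.ae] with u hu hI
  obtain ⟨h1, h2, h3, -⟩ := hu ⟨hs.trans_lt hI.1, hI.2.trans_le ht⟩
  exact ⟨h1, h2, h3⟩

lemma causalLe (h : M.NCurve γ ℓ) {s t : ℝ} (hs : 0 ≤ s) (hst : s ≤ t) (ht : t ≤ ℓ) :
    M.causalLe (γ s) (γ t) := by
  rcases hst.eq_or_lt with rfl | hlt
  · exact Or.inl rfl
  · exact Or.inr ⟨γ, s, t, hlt, h.isFdCausalPathOn hs hst ht, rfl, rfl⟩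

end NCurve

end C1Spacetime

lemma integral_bilForm_deriv {n : ℕ} {f : ℝ → Fin n → ℝ} {K : ℝ≥0} (hf : LipschitzWith K f)
    (G : Fin n → Fin n → ℝ) (w : Fin n → ℝ) (a b : ℝ) :
    ∫ t in a..b, bilForm G (deriv f t) w = bilForm G (f b - f a) w := by
  let φ : (Fin n → ℝ) →ₗ[ℝ] ℝ :=
    { toFun := fun u => bilForm G u w
      map_add' := fun u v => bilForm_add_left G u v w
      map_smul' := fun c u => bilForm_smul_left G c u w }
  have hInt : IntervalIntegrable (deriv f) volume a b :=
    .of_measurable_of_bound (measurable_deriv f).aestronglyMeasurable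
      (norm_deriv_le_of_lipschitzWith hf)
  have := ContinuousLinearMap.intervalIntegral_comp_comm φ.toContinuousLinearMap hInt
  rw [hf.integral_deriv_eq_sub_pi] at this
  exact this

lemma intervalIntegrable_bilForm_deriv {n : ℕ} {f : ℝ → Fin n → ℝ} {K : ℝ≥0}
    (hf : LipschitzWith K f)
    (G : Fin n → Fin n → ℝ) (w : Fin n → ℝ) (a b : ℝ) :
    IntervalIntegrable (fun t => bilForm G (deriv f t) w) volume a b := by
  have hc : Continuous fun u : Fin n → ℝ => bilForm G u w := by
    unfold bilForm
    fun_prop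
  refine .of_measurable_of_bound (C := n ^ 2 * ‖G‖ * K * ‖w‖)
    (hc.measurable.comp (measurable_deriv f)).aestronglyMeasurable fun t => ?_
  refine (abs_bilForm_le G _ w).trans ?_
  gcongr
  exact norm_deriv_le_of_lipschitzWith hf t

lemma Ultrafilter.exists_tendsto_of_isCompact {X ι : Type*} [TopologicalSpace X]
    (U : Ultrafilter ι) {f : ι → X} {K : Set X} (hK : IsCompact K) (hf : ∀ᶠ k in U, f k ∈ K) :
    ∃ x ∈ K, Tendsto f U (𝓝 x) :=
  hK.ultrafilter_le_nhds (U.map f) (le_principal_iff.2 hf)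

namespace C1Spacetime

variable {n : ℕ} {M : C1Spacetime n}

namespace NCurve

variable {γ : ℝ → SpacetimePt n} {ℓ : ℝ}

lemma mul_gLength_le (h : M.NCurve γ ℓ) {s t c δ : ℝ} {z w : SpacetimePt n}
    (hs : 0 ≤ s) (hst : s ≤ t) (ht : t ≤ ℓ)
    (hV : ∀ u ∈ Ioo s t, ∀ v, ‖v‖ ≤ 1 → M.CausalVec (γ u) v → M.FdVec (γ u) v →
      c * √(-bilForm (M.g (γ u)) v v) ≤ -bilForm (M.g z) v w + δ) :
    c * M.gLength γ s t ≤ -bilForm (M.g z) (γ t - γ s) w + δ * (t - s) := by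
  have hb := intervalIntegrable_bilForm_deriv h.lip (M.g z) w s t
  have hb' : IntervalIntegrable (fun u => -bilForm (M.g z) (deriv γ u) w) volume s t := hb.neg
  have e1 : -bilForm (M.g z) (γ t - γ s) w + δ * (t - s) =
      ∫ u in s..t, (-bilForm (M.g z) (deriv γ u) w + δ) := by
    rw [intervalIntegral.integral_add hb' intervalIntegrable_const,
      intervalIntegral.integral_neg, integral_bilForm_deriv h.lip]
    simp [mul_comm]
  rw [e1, gLength_eq, ← intervalIntegral.integral_const_mul]
  refine intervalIntegral.integral_mono_ae_restrict hst
    ((intervalIntegrable_speed h.lip s t).const_mul c) (hb'.add intervalIntegrable_const) ?_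
  rw [← restrict_Ioo_eq_restrict_Icc]
  refine (ae_restrict_iff' measurableSet_Ioo).2 ?_
  filter_upwards [h.ae] with u hu hI
  obtain ⟨-, h2, h3, h4⟩ := hu ⟨hs.trans_lt hI.1, hI.2.trans_le ht⟩
  exact hV u hI _ (norm_le_one_of_euclNorm_eq_one h4) h2 h3

lemma bilForm_X0_le (h : M.NCurve γ ℓ) {s t c : ℝ} {z w : SpacetimePt n}
    (hs : 0 ≤ s) (hst : s ≤ t) (ht : t ≤ ℓ)
    (hV : ∀ u ∈ Ioo s t, ∀ v, euclNorm v = 1 → M.CausalVec (γ u) v → M.FdVec (γ u) v →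
      bilForm (M.g z) v w ≤ -c) :
    bilForm (M.g z) (γ t - γ s) w ≤ -c * (t - s) := by
  have hb := intervalIntegrable_bilForm_deriv h.lip (M.g z) w s t
  have e1 : -c * (t - s) = ∫ u in s..t, -c := by simp [mul_comm]
  rw [e1, ← integral_bilForm_deriv h.lip]
  refine intervalIntegral.integral_mono_ae_restrict hst hb intervalIntegrable_const ?_
  rw [← restrict_Ioo_eq_restrict_Icc]
  refine (ae_restrict_iff' measurableSet_Ioo).2 ?_
  filter_upwards [h.ae] with u hu hI
  obtain ⟨-, h2, h3, h4⟩ := hu ⟨hs.trans_lt hI.1, hI.2.trans_le ht⟩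
  exact hV u hI _ h4 h2 h3

end NCurve

/-- Speeds of 1-Lipschitz curves with bounded starting points are locally uniformly bounded. -/
lemma exists_uniform_speed_bound (M : C1Spacetime n) (R T : ℝ) :
    ∃ C : ℝ≥0, ∀ γ : ℝ → SpacetimePt n, LipschitzWith 1 γ → ‖γ 0‖ ≤ R →
      LipschitzOnWith C (fun s => M.gLength γ 0 s) (Icc (-T) T) := by
  obtain ⟨G, hG0, hG⟩ := M.exists_bilForm_bound (isCompact_closedBall (0 : SpacetimePt n) (R + T))
  refine ⟨⟨√G, Real.sqrt_nonneg _⟩, fun γ hγ h0 => LipschitzOnWith.of_dist_le_mul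
    fun x hx y hy => ?_⟩
  have hi := intervalIntegrable_speed (M := M) hγ
  rw [dist_comm, dist_comm x y, dist_eq_norm, Real.dist_eq, gLength_eq, gLength_eq,
    intervalIntegral.integral_interval_sub_left (hi _ _) (hi _ _)]
  refine intervalIntegral.norm_integral_le_of_norm_le_const fun t ht => ?_
  have ht' : t ∈ Icc (-T) T := (ordConnected_Icc.uIcc_subset hx hy) (uIoc_subset_uIcc ht)
  have hz : γ t ∈ Metric.closedBall (0 : SpacetimePt n) (R + T) := by
    rw [mem_closedBall_zero_iff]
    have h1 := hγ.norm_sub_le t 0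
    have h2 : ‖t - 0‖ ≤ T := by rw [sub_zero, Real.norm_eq_abs]; exact abs_le.2 ht'
    have h3 := norm_le_norm_add_norm_sub' (γ t) (γ 0)
    simp only [NNReal.coe_one, one_mul] at h1
    linarith
  rw [Real.norm_of_nonneg (speed_nonneg γ t)]
  refine Real.sqrt_le_sqrt ((neg_le_abs _).trans (((hG _ hz).2 _ _).trans ?_))
  have h4 : ‖deriv γ t‖ ≤ 1 := norm_deriv_le_of_lipschitzWith hγ t
  calc G * ‖deriv γ t‖ * ‖deriv γ t‖ ≤ G * 1 * 1 := by gcongr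
    _ = G := by ring

/-- Pointwise ultralimits of normalized curves with bounded starting points. -/
lemma exists_ultralimit (U : Ultrafilter ℕ) {γ : ℕ → ℝ → SpacetimePt n} {R : ℝ}
    (hγ : ∀ k, LipschitzWith 1 (γ k)) (hR : ∀ k, ‖γ k 0‖ ≤ R) :
    ∃ (γ' : ℝ → SpacetimePt n) (F : ℝ → ℝ), (∀ s, Tendsto (fun k => γ k s) U (𝓝 (γ' s))) ∧
      ∀ s, Tendsto (fun k => M.gLength (γ k) 0 s) U (𝓝 (F s)) := by
  have h1 : ∀ s, ∃ z, Tendsto (fun k => γ k s) U (𝓝 z) := fun s => by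
    obtain ⟨z, -, hz⟩ := U.exists_tendsto_of_isCompact (f := fun k => γ k s)
      (isCompact_closedBall (0 : SpacetimePt n) (R + |s|)) (Eventually.of_forall fun k => by
        rw [mem_closedBall_zero_iff]
        have h1 := (hγ k).norm_sub_le s 0
        have h3 := norm_le_norm_add_norm_sub' (γ k s) (γ k 0)
        simp only [NNReal.coe_one, one_mul, sub_zero, Real.norm_eq_abs] at h1
        linarith [hR k])
    exact ⟨z, hz⟩
  have h2 : ∀ s, ∃ z, Tendsto (fun k => M.gLength (γ k) 0 s) U (𝓝 z) := fun s => by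
    obtain ⟨C, hC⟩ := exists_uniform_speed_bound M R |s|
    obtain ⟨z, -, hz⟩ := U.exists_tendsto_of_isCompact (f := fun k => M.gLength (γ k) 0 s)
      (isCompact_closedBall (0 : ℝ) (C * |s|)) (Eventually.of_forall fun k => by
        have := (hC (γ k) (hγ k) (hR k)).norm_sub_le (x := s) (y := 0)
          (abs_le.1 le_rfl) ⟨by simp, by simp⟩
        rw [mem_closedBall_zero_iff]
        simpa [gLength_eq] using this)
    exact ⟨z, hz⟩
  choose γ' hγ' using h1
  choose F hF using h2
  exact ⟨γ', F, hγ', hF⟩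

lemma lipschitzWith_of_tendsto {l : Filter ℕ} [l.NeBot] {γ : ℕ → ℝ → SpacetimePt n}
    {γ' : ℝ → SpacetimePt n} (hγ : ∀ k, LipschitzWith 1 (γ k))
    (hlim : ∀ s, Tendsto (fun k => γ k s) l (𝓝 (γ' s))) : LipschitzWith 1 γ' := by
  refine LipschitzWith.of_dist_le_mul fun x y => ?_
  exact le_of_tendsto ((hlim x).dist (hlim y)) (Eventually.of_forall fun k => (hγ k).dist_le_mul x y)

section Limit

variable {l : Filter ℕ} {γ : ℕ → ℝ → SpacetimePt n} {ℓ : ℕ → ℝ}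
  {γ' : ℝ → SpacetimePt n} {F : ℝ → ℝ} {Λ : ℝ}

/-- Near a point of the limit curve the approximating curves stay in a given neighborhood. -/
lemma exists_radius_forall_mem (hγ : ∀ k, M.NCurve (γ k) (ℓ k))
    (hlim : ∀ s, Tendsto (fun k => γ k s) l (𝓝 (γ' s))) (u : ℝ) {V : Set (SpacetimePt n)}
    (hV : V ∈ 𝓝 (γ' u)) :
    ∃ r > 0, ∀ᶠ k in l, ∀ s ∈ Ioo (u - r) (u + r), γ k s ∈ V := by
  obtain ⟨ε, hε, hball⟩ := Metric.mem_nhds_iff.1 hV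
  refine ⟨ε / 2, by positivity, ?_⟩
  filter_upwards [(hlim u).eventually (Metric.ball_mem_nhds _ (half_pos hε))] with k hk s hs
  refine hball ?_
  rw [Metric.mem_ball]
  have h1 := (hγ k).lip.dist_le_mul s u
  rw [NNReal.coe_one, one_mul, Real.dist_eq] at h1
  have h2 : |s - u| < ε / 2 := abs_lt.2 ⟨by linarith [hs.1], by linarith [hs.2]⟩
  linarith [dist_triangle (γ k s) (γ k u) (γ' u)]

variable [l.NeBot]

lemma limit_future_bound (hγ : ∀ k, M.NCurve (γ k) (ℓ k))
    (hlim : ∀ s, Tendsto (fun k => γ k s) l (𝓝 (γ' s)))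
    (hΛ : ∀ s < Λ, ∀ᶠ k in l, s < ℓ k) {z : SpacetimePt n} {c : ℝ} {V : Set (SpacetimePt n)}
    (hV : ∀ z' ∈ V, ∀ v, euclNorm v = 1 → M.CausalVec z' v → M.FdVec z' v →
      bilForm (M.g z) v (M.X0 z) ≤ -c) {s t : ℝ} (hs : 0 ≤ s) (hst : s ≤ t) (ht : t < Λ)
    (hst' : ∀ᶠ k in l, ∀ u ∈ Ioo s t, γ k u ∈ V) :
    bilForm (M.g z) (γ' t - γ' s) (M.X0 z) ≤ -c * (t - s) := by
  have hc : Continuous fun v : SpacetimePt n => bilForm (M.g z) v (M.X0 z) :=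
    M.continuous_bilForm continuous_const continuous_id continuous_const
  refine le_of_tendsto ((hc.tendsto _).comp ((hlim t).sub (hlim s))) ?_
  filter_upwards [hΛ t ht, hst'] with k h1 h2
  exact (hγ k).bilForm_X0_le hs hst h1.le fun u hu => hV _ (h2 u hu)

lemma limit_length_bound (hγ : ∀ k, M.NCurve (γ k) (ℓ k))
    (hlim : ∀ s, Tendsto (fun k => γ k s) l (𝓝 (γ' s)))
    (hF : ∀ s, Tendsto (fun k => M.gLength (γ k) 0 s) l (𝓝 (F s)))
    (hΛ : ∀ s < Λ, ∀ᶠ k in l, s < ℓ k) {z w : SpacetimePt n} {c δ : ℝ} {V : Set (SpacetimePt n)}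
    (hV : ∀ z' ∈ V, ∀ v, ‖v‖ ≤ 1 → M.CausalVec z' v → M.FdVec z' v →
      c * √(-bilForm (M.g z') v v) ≤ -bilForm (M.g z) v w + δ)
    {s t : ℝ} (hs : 0 ≤ s) (hst : s ≤ t) (ht : t < Λ)
    (hst' : ∀ᶠ k in l, ∀ u ∈ Ioo s t, γ k u ∈ V) :
    c * (F t - F s) ≤ -bilForm (M.g z) (γ' t - γ' s) w + δ * (t - s) := by
  have hc : Continuous fun v : SpacetimePt n => -bilForm (M.g z) v w + δ * (t - s) :=
    (M.continuous_bilForm continuous_const continuous_id continuous_const).neg.add continuous_const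
  refine le_of_tendsto_of_tendsto (((hF t).sub (hF s)).const_mul c)
    ((hc.tendsto _).comp ((hlim t).sub (hlim s))) ?_
  filter_upwards [hΛ t ht, hst'] with k h1 h2
  have hi := intervalIntegrable_speed (M := M) (hγ k).lip
  have := (hγ k).mul_gLength_le hs hst h1.le fun u hu => hV _ (h2 u hu)
  simp only [gLength_eq] at this ⊢
  rwa [intervalIntegral.integral_interval_sub_left (hi _ _) (hi _ _)]

/-- The limit curve theorem at a point of differentiability. -/
lemma limit_causal_at (hγ : ∀ k, M.NCurve (γ k) (ℓ k))
    (hlim : ∀ s, Tendsto (fun k => γ k s) l (𝓝 (γ' s)))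
    (hF : ∀ s, Tendsto (fun k => M.gLength (γ k) 0 s) l (𝓝 (F s)))
    (hΛ : ∀ s < Λ, ∀ᶠ k in l, s < ℓ k) {u : ℝ} (hu : u ∈ Ioo 0 Λ)
    (hd : DifferentiableAt ℝ γ' u) {f : ℝ} (hf : HasDerivAt F f u) (hf0 : 0 ≤ f) :
    M.CausalVec (γ' u) (deriv γ' u) ∧ M.FdVec (γ' u) (deriv γ' u) ∧ f ≤ M.speed γ' u := by
  have hslope : Tendsto (fun t => (t - u)⁻¹ • (γ' t - γ' u)) (𝓝[>] u) (𝓝 (deriv γ' u)) :=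
    (hasDerivAt_iff_tendsto_slope.1 hd.hasDerivAt).mono_left
      (nhdsWithin_mono _ fun t (ht : u < t) => ht.ne')
  have hslopeF : Tendsto (fun t => (t - u)⁻¹ * (F t - F u)) (𝓝[>] u) (𝓝 f) :=
    (hasDerivAt_iff_tendsto_slope.1 hf).mono_left
      (nhdsWithin_mono _ fun t (ht : u < t) => ht.ne')
  have hcb : ∀ w, Continuous fun v : SpacetimePt n => bilForm (M.g (γ' u)) v w := fun w =>
    M.continuous_bilForm continuous_const continuous_id continuous_const
  have hfd : M.FdVec (γ' u) (deriv γ' u) := by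
    obtain ⟨c, hc0, hc⟩ := M.eventually_future_bound (γ' u)
    obtain ⟨r, hr, hr'⟩ := exists_radius_forall_mem hγ hlim u hc
    refine lt_of_le_of_lt (b := -c) ?_ (by linarith)
    refine le_of_tendsto (((hcb (M.X0 (γ' u))).tendsto _).comp hslope) ?_
    filter_upwards [Ioo_mem_nhdsGT (show u < min Λ (u + r) from lt_min hu.2 (by linarith))]
      with t ht
    have htu : 0 < t - u := sub_pos.2 ht.1
    have h1 := limit_future_bound hγ hlim hΛ (V := {z' | _}) (fun z' hz' => hz') hu.1.le ht.1.le
      (ht.2.trans_le (min_le_left _ _)) (hr'.mono fun k hk x hx => hk x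
        ⟨by linarith [hx.1], hx.2.trans (ht.2.trans_le (min_le_right _ _))⟩)
    simp only [Function.comp_apply, bilForm_smul_left]
    rw [inv_mul_le_iff₀ htu]
    linarith
  have hmain := M.causal_of_dual hf0 hfd fun w hw hwX => by
    refine le_of_forall_pos_le_add fun δ hδ => ?_
    obtain ⟨r, hr, hr'⟩ := exists_radius_forall_mem hγ hlim u
      (M.eventually_length_le (γ' u) w hw hwX hδ)
    have hc := ((((hcb w).tendsto _).comp hslope).neg).add_const δ
    refine le_of_tendsto_of_tendsto (hslopeF.const_mul _) hc ?_
    filter_upwards [Ioo_mem_nhdsGT (show u < min Λ (u + r) from lt_min hu.2 (by linarith))]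
      with t ht
    have htu : 0 < t - u := sub_pos.2 ht.1
    have h1 := limit_length_bound hγ hlim hF hΛ (V := {z' | _}) (fun z' hz' => hz') hu.1.le ht.1.le
      (ht.2.trans_le (min_le_left _ _)) (hr'.mono fun k hk x hx => hk x
        ⟨by linarith [hx.1], hx.2.trans (ht.2.trans_le (min_le_right _ _))⟩)
    simp only [Function.comp_apply, bilForm_smul_left]
    have h2 := mul_le_mul_of_nonneg_left h1 (inv_nonneg.2 htu.le)
    have h3 : (t - u)⁻¹ * (δ * (t - u)) = δ := by field_simp
    rw [mul_add, h3] at h2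
    linarith
  refine ⟨⟨?_, hmain.1⟩, hfd, hmain.2⟩
  intro h0
  rw [FdVec, h0, bilForm_zero_left] at hfd
  exact lt_irrefl _ hfd

end Limit

lemma gLength_mono {γ : ℝ → SpacetimePt n} {K : ℝ≥0} (hγ : LipschitzWith K γ) :
    Monotone fun s => M.gLength γ 0 s := fun s t hst => by
  have hi := intervalIntegrable_speed (M := M) hγ
  have h1 := intervalIntegral.integral_interval_sub_left (hi 0 t) (hi 0 s)
  have h2 := gLength_nonneg (M := M) γ hst
  simp only [gLength_eq] at *
  linarith

section Limit

variable {l : Filter ℕ} [l.NeBot] {γ : ℕ → ℝ → SpacetimePt n} {ℓ : ℕ → ℝ}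
  {γ' : ℝ → SpacetimePt n} {F : ℝ → ℝ} {Λ : ℝ}

lemma limit_ae (hγ : ∀ k, M.NCurve (γ k) (ℓ k))
    (hlim : ∀ s, Tendsto (fun k => γ k s) l (𝓝 (γ' s)))
    (hF : ∀ s, Tendsto (fun k => M.gLength (γ k) 0 s) l (𝓝 (F s)))
    (hΛ : ∀ s < Λ, ∀ᶠ k in l, s < ℓ k) :
    ∀ᵐ u, u ∈ Ioo 0 Λ → DifferentiableAt ℝ γ' u ∧ M.CausalVec (γ' u) (deriv γ' u) ∧
      M.FdVec (γ' u) (deriv γ' u) ∧ deriv F u ≤ M.speed γ' u := by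
  have hl := lipschitzWith_of_tendsto (fun k => (hγ k).lip) hlim
  have hm : Monotone F := fun s t hst => le_of_tendsto_of_tendsto (hF s) (hF t)
    (Eventually.of_forall fun k => gLength_mono (hγ k).lip hst)
  filter_upwards [hl.ae_differentiableAt_real, hm.ae_differentiableAt] with u h1 h2 hu
  exact ⟨h1, limit_causal_at hγ hlim hF hΛ hu h1 h2.hasDerivAt hm.deriv_nonneg⟩

lemma limit_length_le (hγ : ∀ k, M.NCurve (γ k) (ℓ k))
    (hlim : ∀ s, Tendsto (fun k => γ k s) l (𝓝 (γ' s)))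
    (hF : ∀ s, Tendsto (fun k => M.gLength (γ k) 0 s) l (𝓝 (F s)))
    (hΛ : ∀ s < Λ, ∀ᶠ k in l, s < ℓ k) {R : ℝ} (hR : ∀ k, ‖γ k 0‖ ≤ R) (hΛ0 : 0 ≤ Λ) :
    F Λ ≤ M.gLength γ' 0 Λ := by
  have hl := lipschitzWith_of_tendsto (fun k => (hγ k).lip) hlim
  obtain ⟨C, hC⟩ := exists_uniform_speed_bound M R Λ
  have hFl : LipschitzOnWith C F (Icc (-Λ) Λ) := LipschitzOnWith.of_dist_le_mul
    fun x hx y hy => le_of_tendsto ((hF x).dist (hF y)) (Eventually.of_forall fun k =>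
      (hC (γ k) (hγ k).lip (hR k)).dist_le_mul x hx y hy)
  have hac : AbsolutelyContinuousOnInterval F 0 Λ :=
    LipschitzOnWith.absolutelyContinuousOnInterval (hFl.mono (by
      rw [uIcc_of_le hΛ0]; exact Icc_subset_Icc_left (by linarith)))
  have hF0 : F 0 = 0 := tendsto_nhds_unique (hF 0) (by simp [gLength_eq])
  have h1 := hac.integral_deriv_eq_sub
  rw [hF0, sub_zero] at h1
  rw [← h1, gLength_eq]
  refine intervalIntegral.integral_mono_ae_restrict hΛ0 hac.intervalIntegrable_deriv
    (intervalIntegrable_speed hl _ _) ?_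
  rw [← restrict_Ioo_eq_restrict_Icc]
  refine (ae_restrict_iff' measurableSet_Ioo).2 ?_
  filter_upwards [limit_ae hγ hlim hF hΛ] with u hu hI using (hu hI).2.2.2

lemma limit_not_tendsto (hγ : ∀ k, M.NCurve (γ k) (ℓ k))
    (hlim : ∀ s, Tendsto (fun k => γ k s) l (𝓝 (γ' s)))
    (hℓ : ∀ s, ∀ᶠ k in l, s < ℓ k) : ¬ ∃ z, Tendsto γ' atTop (𝓝 z) := by
  rintro ⟨z, hz⟩
  obtain ⟨c, hc0, hc⟩ := M.eventually_future_bound z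
  obtain ⟨ε, hε, hball⟩ := Metric.mem_nhds_iff.1 hc
  have hε3 : 0 < ε / 3 := by positivity
  have key : ∀ᶠ s in atTop, bilForm (M.g z) (γ' (s + ε / 3) - γ' s) (M.X0 z) ≤ -c * (ε / 3) := by
    filter_upwards [eventually_ge_atTop 0, hz.eventually (Metric.ball_mem_nhds z hε3)]
      with s hs0 hs
    have := limit_future_bound (Λ := s + ε / 3 + 1) hγ hlim (fun s _ => hℓ s) hball hs0
      (t := s + ε / 3) (by linarith) (by linarith) ?_
    · simpa using this
    · filter_upwards [(hlim s).eventually (Metric.ball_mem_nhds _ hε3)] with k hk u hu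
      have h1 := (hγ k).lip.dist_le_mul u s
      rw [NNReal.coe_one, one_mul, Real.dist_eq, abs_of_pos (by linarith [hu.1])] at h1
      rw [Metric.mem_ball]
      linarith [dist_triangle (γ k u) (γ k s) z, dist_triangle (γ k s) (γ' s) z, hu.2]
  have hcb : Continuous fun v : SpacetimePt n => bilForm (M.g z) v (M.X0 z) :=
    M.continuous_bilForm continuous_const continuous_id continuous_const
  have h2 := (hcb.tendsto _).comp
    ((hz.comp (tendsto_atTop_add_const_right _ (ε / 3) tendsto_id)).sub hz)
  have h3 := le_of_tendsto h2 key
  rw [sub_self, bilForm_zero_left] at h3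
  nlinarith

end Limit

/-- Normalized curves in a compact set have bounded Euclidean length. -/
lemma NonImprisoning.exists_length_bound (hM : M.NonImprisoning) {J : Set (SpacetimePt n)}
    (hJ : IsCompact J) :
    ∃ L, ∀ γ ℓ, M.NCurve γ ℓ → (∀ s ∈ Icc 0 ℓ, γ s ∈ J) → ℓ ≤ L := by
  by_contra! hcon
  choose γ ℓ hγ hJγ hℓ using fun k : ℕ => hcon k
  obtain ⟨R, hR⟩ := hJ.isBounded.exists_norm_le
  let U : Ultrafilter ℕ := hyperfilter ℕ
  have hU : (U : Filter ℕ) ≤ atTop := by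
    rw [← Nat.cofinite_eq_atTop]; exact hyperfilter_le_cofinite
  obtain ⟨γ', F, hlim, hF⟩ := exists_ultralimit (M := M) U (fun k => (hγ k).lip)
    (fun k => hR _ (hJγ k 0 ⟨le_rfl, (hγ k).pos.le⟩))
  have hev : ∀ s, ∀ᶠ k in (U : Filter ℕ), s < ℓ k := fun s => by
    obtain ⟨m, hm⟩ := exists_nat_gt s
    filter_upwards [hU (eventually_ge_atTop m)] with k hk
    exact (hm.trans_le (Nat.cast_le.2 hk)).trans (hℓ k)
  have hl := lipschitzWith_of_tendsto (fun k => (hγ k).lip) hlim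
  refine (hM J hJ).2.1 0 γ' ⟨ordConnected_Ici, nonempty_Ici,
    fun t _ => ⟨1, univ, univ_mem, hl.lipschitzOnWith⟩, ?_⟩ (limit_not_tendsto hγ hlim hev) ?_
  · rw [← restrict_Ioi_eq_restrict_Ici, ae_restrict_iff' measurableSet_Ioi]
    have : ∀ m : ℕ, _ := fun m => limit_ae (Λ := m) hγ hlim hF (fun s _ => hev s)
    filter_upwards [ae_all_iff.2 this] with u hu hu0
    obtain ⟨m, hm⟩ := exists_nat_gt u
    obtain ⟨h1, h2, h3, -⟩ := hu m ⟨hu0, hm⟩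
    exact ⟨h1, h2, h3⟩
  · intro t ht
    refine hJ.isClosed.mem_of_tendsto (hlim t) ?_
    filter_upwards [hev t] with k hk using hJγ k t ⟨ht, hk.le⟩

variable (M) in
/-- A length-maximizing normalized curve. -/
structure MaxCurve (γ : ℝ → SpacetimePt n) (ℓ : ℝ) : Prop extends M.NCurve γ ℓ where
  max : ∀ (β : ℝ → SpacetimePt n) (a b : ℝ), a < b → M.IsFdCausalPathOn β (Icc a b) →
    β a = γ 0 → β b = γ ℓ → M.gLength β a b ≤ M.gLength γ 0 ℓ

/-- Existence of maximizers in globally hyperbolic spacetimes. -/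
theorem GloballyHyperbolic.exists_maxCurve (hM : M.GloballyHyperbolic) {p z : SpacetimePt n}
    (hpz : M.causalLe p z) (hne : p ≠ z) :
    ∃ γ ℓ, M.MaxCurve γ ℓ ∧ γ 0 = p ∧ γ ℓ = z := by
  obtain ⟨L, hL⟩ := hM.1.exists_length_bound (hM.2 p z)
  let S : Set ℝ := {x | ∃ γ ℓ, M.NCurve γ ℓ ∧ γ 0 = p ∧ γ ℓ = z ∧ M.gLength γ 0 ℓ = x}
  have hLe : ∀ γ ℓ, M.NCurve γ ℓ → γ 0 = p → γ ℓ = z → ℓ ≤ L := fun γ ℓ h h0 h1 => by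
    refine hL γ ℓ h fun s hs => ⟨?_, ?_⟩
    · rw [← h0]; exact h.causalLe le_rfl hs.1 hs.2
    · rw [← h1]; exact h.causalLe hs.1 hs.2 le_rfl
  have hpath : ∀ (β : ℝ → SpacetimePt n) (a b : ℝ), a < b → M.IsFdCausalPathOn β (Icc a b) →
      β a = p → β b = z → M.gLength β a b ∈ S := fun β a b hab hβ ha hb => by
    obtain ⟨σ, ℓ, h1, h2, h3, h4⟩ := hβ.exists_ncurve hab
    exact ⟨σ, ℓ, h1, h2.trans ha, h3.trans hb, h4⟩
  have hSne : S.Nonempty := by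
    rcases hpz with h | ⟨β, a, b, hab, hβ, ha, hb⟩
    · exact absurd h hne
    · exact ⟨_, hpath β a b hab hβ ha hb⟩
  obtain ⟨C, hC⟩ := exists_uniform_speed_bound M ‖p‖ L
  have hSb : BddAbove S := by
    refine ⟨C * L, ?_⟩
    rintro _ ⟨γ, ℓ, h, h0, h1, rfl⟩
    have hℓ := hLe γ ℓ h h0 h1
    have h2 := (hC γ h.lip (by rw [h0])).norm_sub_le (x := ℓ) (y := 0)
      ⟨by linarith [h.pos], hℓ⟩ ⟨by linarith [h.pos], by linarith [h.pos]⟩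
    have h3 : M.gLength γ 0 0 = 0 := by simp [gLength_eq]
    simp only [h3, sub_zero, Real.norm_eq_abs, abs_of_pos h.pos] at h2
    exact (le_abs_self _).trans (h2.trans (by gcongr))
  obtain ⟨x, -, hx, hxS⟩ := exists_seq_tendsto_sSup hSne hSb
  choose γ ℓ hγ h0 h1 hlen using hxS
  let U : Ultrafilter ℕ := hyperfilter ℕ
  have hU : (U : Filter ℕ) ≤ atTop := by
    rw [← Nat.cofinite_eq_atTop]; exact hyperfilter_le_cofinite
  have hR : ∀ k, ‖γ k 0‖ ≤ ‖p‖ := fun k => by rw [h0]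
  obtain ⟨γ', F, hlim, hF⟩ := exists_ultralimit (M := M) U (fun k => (hγ k).lip) hR
  have hℓL : ∀ k, ℓ k ≤ L := fun k => hLe _ _ (hγ k) (h0 k) (h1 k)
  have hℓl : ∀ k, ‖z - p‖ ≤ ℓ k := fun k => by
    have := (hγ k).lip.norm_sub_le (ℓ k) 0
    rwa [h0, h1, NNReal.coe_one, one_mul, sub_zero, Real.norm_of_nonneg (hγ k).pos.le] at this
  obtain ⟨Λ, hΛmem, hΛ⟩ := U.exists_tendsto_of_isCompact (f := ℓ) (isCompact_Icc (a := ‖z - p‖)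
    (b := L)) (Eventually.of_forall fun k => ⟨hℓl k, hℓL k⟩)
  have hΛ0 : 0 < Λ := (norm_pos_iff.2 (sub_ne_zero.2 hne.symm)).trans_le hΛmem.1
  have hev : ∀ s < Λ, ∀ᶠ k in (U : Filter ℕ), s < ℓ k := fun s hs => hΛ.eventually (lt_mem_nhds hs)
  have hl := lipschitzWith_of_tendsto (fun k => (hγ k).lip) hlim
  have hγ0 : γ' 0 = p := tendsto_nhds_unique (hlim 0) (by simp [h0])
  have hdist : Tendsto (fun k => |ℓ k - Λ|) U (𝓝 0) := by
    have := (hΛ.sub_const Λ).abs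
    simpa using this
  have hγΛ : γ' Λ = z := by
    refine tendsto_nhds_unique (hlim Λ) ?_
    rw [tendsto_iff_dist_tendsto_zero]
    refine squeeze_zero (fun _ => dist_nonneg) (fun k => ?_) hdist
    have := (hγ k).lip.dist_le_mul Λ (ℓ k)
    rwa [h1, NNReal.coe_one, one_mul, dist_comm Λ, Real.dist_eq] at this
  have hFΛ : F Λ = sSup S := by
    refine tendsto_nhds_unique (hF Λ) ?_
    have h3 : Tendsto (fun k => M.gLength (γ k) 0 Λ - x k) U (𝓝 0) := by
      rw [tendsto_zero_iff_abs_tendsto_zero]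
      refine squeeze_zero (fun _ => abs_nonneg _) (fun k => ?_)
        (by simpa using hdist.const_mul (C : ℝ))
      have := (hC (γ k) (hγ k).lip (hR k)).norm_sub_le (x := Λ) (y := ℓ k)
        ⟨by linarith [hΛmem.2], hΛmem.2⟩ ⟨by linarith [hΛmem.2, (hγ k).pos], hℓL k⟩
      simpa only [hlen, Real.norm_eq_abs, abs_sub_comm Λ, Function.comp_apply] using this
    simpa using h3.add (hx.mono_left hU)
  have hlen' := limit_length_le hγ hlim hF hev hR hΛ0.le
  have hP : M.IsFdCausalPathOn γ' (Icc 0 Λ) := by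
    refine isFdCausalPathOn_of_lipschitz hΛ0.le hl ?_
    filter_upwards [limit_ae hγ hlim hF hev] with u hu hI
    obtain ⟨h1, h2, h3, -⟩ := hu hI
    exact ⟨h1, h2, h3⟩
  obtain ⟨σ, ℓ', h2, h3, h4, h5⟩ := hP.exists_ncurve hΛ0
  refine ⟨σ, ℓ', ⟨h2, fun β a b hab hβ ha hb => ?_⟩, h3.trans hγ0, h4.trans hγΛ⟩
  rw [h5]
  refine le_trans ?_ hlen'
  rw [hFΛ]
  exact le_csSup hSb (hpath β a b hab hβ (ha.trans (h3.trans hγ0)) (hb.trans (h4.trans hγΛ)))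

end C1Spacetime

lemma one_div_le_norm_of_euclNorm_eq_one {n : ℕ} {v : Fin n → ℝ} (hv : euclNorm v = 1) :
    1 / (n + 1 : ℝ) ≤ ‖v‖ := by
  have h1 := euclNorm_sq_le v
  have h2 := norm_le_one_of_euclNorm_eq_one hv
  rw [hv] at h1
  rw [div_le_iff₀ (by positivity)]
  nlinarith [norm_nonneg v, mul_nonneg (Nat.cast_nonneg (α := ℝ) n) (norm_nonneg v)]

namespace C1Spacetime

variable {n : ℕ} (M : C1Spacetime n)

/-- Future-directedness of unit causal vectors is stable under uniformly small perturbations. -/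
lemma exists_stable_future {K : Set (SpacetimePt n)} (hK : IsCompact K) :
    ∃ ρ > 0, ∀ z ∈ K, ∀ z' ∈ K, ∀ v v', euclNorm v = 1 → M.CausalVec z v → M.FdVec z v →
      ‖z' - z‖ ≤ ρ → ‖v' - v‖ ≤ ρ → M.FdVec z' v' := by
  obtain ⟨c, hc0, hc⟩ := M.exists_future_bound hK
  have hX : Continuous fun x : SpacetimePt n × SpacetimePt n =>
      bilForm (M.g x.1) x.2 (M.X0 x.1) :=
    M.continuous_bilForm continuous_fst continuous_snd (M.X0_cont.comp continuous_fst)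
  have hu := (hK.prod (isCompact_closedBall (0 : SpacetimePt n) 2)).uniformContinuousOn_of_continuous
    hX.continuousOn
  have hc1 : 0 < c * (1 / (n + 1 : ℝ)) := by positivity
  obtain ⟨ρ, hρ, h⟩ := Metric.uniformContinuousOn_iff.1 hu _ hc1
  refine ⟨min (ρ / 2) 1, by positivity, fun z hz z' hz' v v' hv hca hfd h1 h2 => ?_⟩
  have hv1 := norm_le_one_of_euclNorm_eq_one hv
  have hv' : ‖v'‖ ≤ 2 := by
    have := norm_le_norm_add_norm_sub' v' v
    linarith [h2.trans (min_le_right _ _)]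
  have h3 := h (z, v) ⟨hz, by rw [mem_closedBall_zero_iff]; linarith⟩ (z', v')
    ⟨hz', by rw [mem_closedBall_zero_iff]; exact hv'⟩ (by
      rw [dist_comm, Prod.dist_eq, dist_eq_norm, dist_eq_norm]
      refine max_lt ?_ ?_
      · linarith [h1.trans (min_le_left _ _)]
      · linarith [h2.trans (min_le_left _ _)])
  rw [Real.dist_eq] at h3
  have h4 := hc z hz v hca hfd
  have h5 : c * (1 / (n + 1 : ℝ)) ≤ c * ‖v‖ :=
    mul_le_mul_of_nonneg_left (one_div_le_norm_of_euclNorm_eq_one hv) hc0.le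
  have h6 := (abs_lt.1 h3).1
  change bilForm (M.g z') v' (M.X0 z') < 0
  change -(c * (1 / (n + 1 : ℝ))) < bilForm (M.g z) v (M.X0 z) - bilForm (M.g z') v' (M.X0 z') at h6
  linarith

lemma bilForm_add_smul_self (z v ψ : SpacetimePt n) (ε : ℝ) :
    bilForm (M.g z) (v + ε • ψ) (v + ε • ψ) =
      bilForm (M.g z) v v + 2 * ε * bilForm (M.g z) v ψ + ε ^ 2 * bilForm (M.g z) ψ ψ := by
  simp only [bilForm_add_left, bilForm_add_right, bilForm_smul_left, bilForm_smul_right]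
  rw [M.bilForm_symm z ψ v]
  ring

/-- Uniform estimates for the change of a unit causal vector under a variation. -/
lemma exists_variation_constants {K : Set (SpacetimePt n)} (hK : IsCompact K) (hcv : Convex ℝ K) :
    ∃ c₁ > 0, ∃ C₂ > 0, ∃ Kc > 0, ∃ ρ > 0, ∀ z ∈ K, ∀ v, euclNorm v = 1 → M.CausalVec z v →
      M.FdVec z v → ∀ (w ψ : SpacetimePt n) (ε D : ℝ), 0 < ε → ‖w‖ ≤ D → ‖ψ‖ ≤ D → ε * D ≤ ρ →
      z + ε • w ∈ K →
      M.FdVec (z + ε • w) (v + ε • ψ) ∧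
      -bilForm (M.g z) v v - ε * (C₂ * D) ≤
        -bilForm (M.g (z + ε • w)) (v + ε • ψ) (v + ε • ψ) ∧
      ∀ φ, ψ = φ • M.X0 z → Kc * ‖w‖ ≤ φ →
        -bilForm (M.g z) v v + ε * (c₁ * φ) ≤
          -bilForm (M.g (z + ε • w)) (v + ε • ψ) (v + ε • ψ) := by
  obtain ⟨c, hc0, hc⟩ := M.exists_future_bound hK
  obtain ⟨G, hG0, hG⟩ := M.exists_bilForm_bound hK
  obtain ⟨L, hL0, hL⟩ := M.exists_bilForm_lipschitz hK hcv
  obtain ⟨ρ, hρ0, hρ⟩ := M.exists_stable_future hK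
  set c₁ := c * (1 / (n + 1 : ℝ)) with hc₁
  have hc₁0 : 0 < c₁ := by positivity
  refine ⟨c₁, hc₁0, 3 * G + 4 * L, by positivity, 4 * L / c₁, by positivity, min ρ 1,
    by positivity, fun z hz v hv hca hfd w ψ ε D hε hw hψ hεD hzw => ?_⟩
  have hv1 := norm_le_one_of_euclNorm_eq_one hv
  have hD0 : 0 ≤ D := (norm_nonneg w).trans hw
  have hεw : ‖ε • w‖ ≤ ε * D := by rw [norm_smul, Real.norm_of_nonneg hε.le]; gcongr
  have hεψ : ‖ε • ψ‖ ≤ ε * D := by rw [norm_smul, Real.norm_of_nonneg hε.le]; gcongr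
  have hεD1 : ε * D ≤ 1 := hεD.trans (min_le_right _ _)
  have hv2 : ‖v + ε • ψ‖ ≤ 2 := (norm_add_le _ _).trans (by linarith)
  have hlip : bilForm (M.g (z + ε • w)) (v + ε • ψ) (v + ε • ψ) ≤
      bilForm (M.g z) (v + ε • ψ) (v + ε • ψ) + 4 * L * ε * ‖w‖ := by
    have h1 := (abs_le.1 (hL z hz (z + ε • w) hzw (v + ε • ψ) (v + ε • ψ))).2
    have h2 : L * ‖z + ε • w - z‖ * ‖v + ε • ψ‖ * ‖v + ε • ψ‖ ≤ L * (ε * ‖w‖) * 2 * 2 := by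
      have : ‖z + ε • w - z‖ = ε * ‖w‖ := by
        rw [add_sub_cancel_left, norm_smul, Real.norm_of_nonneg hε.le]
      rw [this]
      gcongr
    linarith
  rw [M.bilForm_add_smul_self z] at hlip
  have hεψ' : ε * ‖ψ‖ ≤ 1 := by nlinarith
  refine ⟨?_, ?_, fun φ hφ hφw => ?_⟩
  · refine hρ z hz _ hzw v _ hv hca hfd ?_ ?_
    · rw [add_sub_cancel_left]; exact hεw.trans (hεD.trans (min_le_left _ _))
    · rw [add_sub_cancel_left]; exact hεψ.trans (hεD.trans (min_le_left _ _))
  · have h1 : bilForm (M.g z) v ψ ≤ G * D := by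
      refine (le_abs_self _).trans (((hG z hz).2 v ψ).trans ?_)
      calc G * ‖v‖ * ‖ψ‖ ≤ G * 1 * D := by gcongr
        _ = G * D := by ring
    have h2 : ε * bilForm (M.g z) ψ ψ ≤ G * D := by
      have h3 : bilForm (M.g z) ψ ψ ≤ G * ‖ψ‖ * ‖ψ‖ :=
        (le_abs_self _).trans ((hG z hz).2 ψ ψ)
      calc ε * bilForm (M.g z) ψ ψ ≤ ε * (G * ‖ψ‖ * ‖ψ‖) := by gcongr
        _ = G * (ε * ‖ψ‖) * ‖ψ‖ := by ring
        _ ≤ G * 1 * D := by gcongr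
        _ = G * D := by ring
    have h4 := mul_le_mul_of_nonneg_left h1 hε.le
    have h5 := mul_le_mul_of_nonneg_left h2 hε.le
    have h6 : L * ε * ‖w‖ ≤ L * ε * D := by gcongr
    nlinarith
  · have h1 : bilForm (M.g z) v ψ ≤ -(φ * c₁) := by
      rw [hφ, bilForm_smul_right]
      have hφ0 : 0 ≤ φ := le_trans (by positivity) hφw
      have h5 : c₁ ≤ c * ‖v‖ :=
        mul_le_mul_of_nonneg_left (one_div_le_norm_of_euclNorm_eq_one hv) hc0.le
      have h6 := mul_le_mul_of_nonneg_left ((hc z hz v hca hfd).trans (neg_le_neg h5)) hφ0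
      linarith
    have h2 : bilForm (M.g z) ψ ψ ≤ 0 := by
      rw [hφ, bilForm_smul_right, bilForm_smul_left, ← mul_assoc]
      exact mul_nonpos_of_nonneg_of_nonpos (mul_self_nonneg φ) (M.X0_timelike z).le
    have h3 : 4 * L * ‖w‖ ≤ c₁ * φ := by
      rw [div_mul_eq_mul_div, div_le_iff₀ hc₁0] at hφw
      linarith
    have h4 := mul_le_mul_of_nonneg_left h1 hε.le
    have h5 := mul_le_mul_of_nonneg_left h3 hε.le
    have h6 := mul_nonpos_of_nonneg_of_nonpos (sq_nonneg ε) h2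
    nlinarith

end C1Spacetime

lemma locallyIntegrable_of_measurable_of_bound {E : Type*} [NormedAddCommGroup E]
    {f : ℝ → E} {C : ℝ} (hf : AEStronglyMeasurable f volume) (hC : ∀ t, ‖f t‖ ≤ C) :
    LocallyIntegrable f volume := by
  rw [locallyIntegrable_iff]
  intro k hk
  exact Integrable.mono' (g := fun _ => C)
    (integrableOn_const (hs := hk.measure_lt_top.ne)) hf.restrict (ae_of_all _ hC)

namespace C1Spacetime

variable {n : ℕ} {M : C1Spacetime n}

/-- A primitive of a bounded measurable field. -/
lemma lipschitzWith_primitive {ψ : ℝ → SpacetimePt n} {B : ℝ≥0} (hψ : Measurable ψ)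
    (hB : ∀ s, ‖ψ s‖ ≤ B) (v₀ : SpacetimePt n) :
    LipschitzWith B fun s => v₀ + ∫ u in (0:ℝ)..s, ψ u := by
  have hi : ∀ x y, IntervalIntegrable ψ volume x y := fun x y =>
    .of_measurable_of_bound hψ.aestronglyMeasurable hB
  refine LipschitzWith.of_dist_le_mul fun x y => ?_
  rw [dist_comm, dist_comm x y, dist_add_left, dist_eq_norm, Real.dist_eq,
    intervalIntegral.integral_interval_sub_left (hi _ _) (hi _ _)]
  exact intervalIntegral.norm_integral_le_of_norm_le_const fun t _ => hB t

/-- A pointwise estimate along a variation yields a causal path together with a length estimate. -/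
lemma NCurve.variation {α : ℝ → SpacetimePt n} {ℓ : ℝ} (hα : M.NCurve α ℓ)
    {ψ : ℝ → SpacetimePt n} {B : ℝ≥0} (hψ : Measurable ψ) (hB : ∀ s, ‖ψ s‖ ≤ B)
    (v₀ : SpacetimePt n) (ε : ℝ) {h : ℝ → ℝ} (hh : IntervalIntegrable h volume 0 ℓ)
    (hpt : ∀ᵐ s, s ∈ Ioo 0 ℓ →
      M.FdVec (α s + ε • (v₀ + ∫ u in (0:ℝ)..s, ψ u)) (deriv α s + ε • ψ s) ∧
      bilForm (M.g (α s + ε • (v₀ + ∫ u in (0:ℝ)..s, ψ u))) (deriv α s + ε • ψ s)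
        (deriv α s + ε • ψ s) ≤ 0 ∧
      M.speed α s + ε * h s ≤ √(-bilForm (M.g (α s + ε • (v₀ + ∫ u in (0:ℝ)..s, ψ u)))
        (deriv α s + ε • ψ s) (deriv α s + ε • ψ s))) :
    M.IsFdCausalPathOn (fun s => α s + ε • (v₀ + ∫ u in (0:ℝ)..s, ψ u)) (Icc 0 ℓ) ∧
      M.gLength α 0 ℓ + ε * ∫ s in (0:ℝ)..ℓ, h s ≤
        M.gLength (fun s => α s + ε • (v₀ + ∫ u in (0:ℝ)..s, ψ u)) 0 ℓ := by
  set β : ℝ → SpacetimePt n := fun s => α s + ε • (v₀ + ∫ u in (0:ℝ)..s, ψ u) with hβdef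
  have hW := lipschitzWith_primitive hψ hB v₀
  have hsm : LipschitzWith ‖ε‖₊ fun w : SpacetimePt n => ε • w := lipschitzWith_smul ε
  have hβ : LipschitzWith (1 + ‖ε‖₊ * B) β := hα.lip.add (hsm.comp hW)
  have hd : ∀ᵐ s, s ∈ Ioo 0 ℓ → HasDerivAt β (deriv α s + ε • ψ s) s := by
    filter_upwards [hα.ae, LocallyIntegrable.ae_hasDerivAt_integral
      (locallyIntegrable_of_measurable_of_bound hψ.aestronglyMeasurable hB)] with s h1 h2 hs
    exact (h1 hs).1.hasDerivAt.add (((h2 0).const_add v₀).const_smul ε)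
  constructor
  · refine isFdCausalPathOn_of_lipschitz hα.pos.le hβ ?_
    filter_upwards [hd, hpt] with s h1 h2 hs
    obtain ⟨h3, h4, -⟩ := h2 hs
    rw [(h1 hs).deriv]
    refine ⟨(h1 hs).differentiableAt, ⟨fun h0 => ?_, h4⟩, h3⟩
    rw [FdVec, h0, bilForm_zero_left] at h3
    exact lt_irrefl _ h3
  · rw [gLength_eq, gLength_eq, ← intervalIntegral.integral_const_mul,
      ← intervalIntegral.integral_add (intervalIntegrable_speed hα.lip _ _) (hh.const_mul ε)]
    refine intervalIntegral.integral_mono_ae_restrict hα.pos.le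
      ((intervalIntegrable_speed hα.lip _ _).add (hh.const_mul ε))
      (intervalIntegrable_speed hβ _ _) ?_
    rw [← restrict_Ioo_eq_restrict_Icc]
    refine (ae_restrict_iff' measurableSet_Ioo).2 ?_
    filter_upwards [hd, hpt] with s h1 h2 hs
    have := (h2 hs).2.2
    simpa only [speed, (h1 hs).deriv] using this

end C1Spacetime

lemma sub_sq_le_of_le {τ y η : ℝ} (hy : 0 ≤ y) (hyη : y ≤ η) (hη : η ≤ τ) :
    (τ - y) ^ 2 ≤ τ ^ 2 - y * η := by
  nlinarith [mul_le_mul_of_nonneg_left hyη hy, mul_le_mul_of_nonneg_left hη hy]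

lemma add_sq_le_of_le {τ y κ : ℝ} (hτ : τ ≤ κ) (hy : 0 ≤ y) (hyκ : y ≤ κ) :
    (τ + y) ^ 2 ≤ τ ^ 2 + y * (4 * κ) := by
  nlinarith [mul_le_mul_of_nonneg_left hyκ hy, mul_le_mul_of_nonneg_left hτ hy]

namespace C1Spacetime

variable {n : ℕ} {M : C1Spacetime n}

lemma NCurve.norm_le {α : ℝ → SpacetimePt n} {ℓ : ℝ} (hα : M.NCurve α ℓ) (s : ℝ) :
    ‖α s‖ ≤ ‖α 0‖ + ℓ := by
  have key : ∀ t ∈ Icc 0 ℓ, ‖α t‖ ≤ ‖α 0‖ + ℓ := fun t ht => by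
    have h1 := hα.lip.dist_le_mul t 0
    rw [dist_eq_norm, Real.dist_eq, sub_zero, abs_of_nonneg ht.1, NNReal.coe_one, one_mul] at h1
    have := norm_le_norm_add_norm_sub' (α t) (α 0)
    linarith [ht.2]
  have hℓ := hα.pos.le
  rcases le_total s 0 with h | h
  · rw [hα.left s h]; exact key 0 ⟨le_rfl, hℓ⟩
  rcases le_total ℓ s with h' | h'
  · rw [hα.right s h']; exact key ℓ ⟨hℓ, le_rfl⟩
  · exact key s ⟨h, h'⟩

lemma speed_sq {γ : ℝ → SpacetimePt n} {t : ℝ} (h : M.CausalVec (γ t) (deriv γ t)) :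
    M.speed γ t ^ 2 = -bilForm (M.g (γ t)) (deriv γ t) (deriv γ t) :=
  Real.sq_sqrt (neg_nonneg.2 h.2)

/-- The first variation of a maximizer under variations with fixed endpoints is nonpositive. -/
lemma MaxCurve.integral_nonpos {α : ℝ → SpacetimePt n} {ℓ : ℝ} (hα : M.MaxCurve α ℓ)
    {ψ : ℝ → SpacetimePt n} {B : ℝ≥0} (hψ : Measurable ψ) (hB : ∀ s, ‖ψ s‖ ≤ B)
    (hψ0 : ∫ u in (0:ℝ)..ℓ, ψ u = 0) {ε : ℝ} (hε : 0 < ε) {h : ℝ → ℝ}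
    (hh : IntervalIntegrable h volume 0 ℓ)
    (hpt : ∀ᵐ s, s ∈ Ioo 0 ℓ →
      M.FdVec (α s + ε • ∫ u in (0:ℝ)..s, ψ u) (deriv α s + ε • ψ s) ∧
      bilForm (M.g (α s + ε • ∫ u in (0:ℝ)..s, ψ u)) (deriv α s + ε • ψ s)
        (deriv α s + ε • ψ s) ≤ 0 ∧
      M.speed α s + ε * h s ≤ √(-bilForm (M.g (α s + ε • ∫ u in (0:ℝ)..s, ψ u))
        (deriv α s + ε • ψ s) (deriv α s + ε • ψ s))) :
    ∫ s in (0:ℝ)..ℓ, h s ≤ 0 := by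
  obtain ⟨h1, h2⟩ := hα.toNCurve.variation hψ hB 0 ε hh (by simpa only [zero_add] using hpt)
  have h3 := hα.max _ 0 ℓ hα.pos h1 (by simp) (by simp [hψ0])
  by_contra hcon
  have := mul_pos hε (not_le.1 hcon)
  linarith

set_option maxHeartbeats 400000 in
/-- On short intervals, a maximizer which is timelike on a set of positive measure is uniformly
timelike. -/
lemma MaxCurve.exists_local_bound {α : ℝ → SpacetimePt n} {ℓ : ℝ} (hα : M.MaxCurve α ℓ) :
    ∃ δ > 0, ∀ c d, 0 ≤ c → d ≤ ℓ → d - c ≤ δ → ∀ η > 0, ∀ E ⊆ Ioo c d, MeasurableSet E →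
      volume E ≠ 0 → (∀ s ∈ E, η ≤ M.speed α s) →
      ∃ κ > 0, ∀ᵐ s, s ∈ Ioo c d → κ ≤ M.speed α s := by
  set R := ‖α 0‖ + ℓ with hR
  set K := Metric.closedBall (0 : SpacetimePt n) (R + 1) with hKdef
  have hK : IsCompact K := isCompact_closedBall _ _
  have hαR : ∀ s, ‖α s‖ ≤ R := hα.toNCurve.norm_le
  have hαK : ∀ s, α s ∈ K := fun s => by
    rw [hKdef, mem_closedBall_zero_iff]; linarith [hαR s]
  obtain ⟨c₁, hc₁, C₂, hC₂, Kc, hKc, ρ, hρ, hvar⟩ :=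
    M.exists_variation_constants hK (convex_closedBall _ _)
  obtain ⟨G, hG0, hG⟩ := M.exists_bilForm_bound hK
  set A := 4 * G * Kc with hA
  have hA0 : 0 < A := by positivity
  refine ⟨1 / A, by positivity, fun c d hc0 hdℓ hcd η hη E hEcd hEm hE0 hEη => ?_⟩
  have hEfin : volume E ≠ ⊤ := (measure_mono hEcd).trans_lt measure_Ioo_lt_top |>.ne
  set e := volume.real E with he
  have he0 : 0 < e := ENNReal.toReal_pos hE0 hEfin
  have hq0 : 0 < C₂ * G * (4 * e + 2) + 1 := by positivity
  set κ := min (c₁ * η / (4 * (C₂ * G * (4 * e + 2) + 1))) η with hκ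
  have hκ0 : 0 < κ := by positivity
  have hκη : κ ≤ η := min_le_right _ _
  have hκq : (C₂ * G * (4 * e + 2) + 1) / η ≤ c₁ / (4 * κ) := by
    have h1 : κ ≤ c₁ * η / (4 * (C₂ * G * (4 * e + 2) + 1)) := min_le_left _ _
    rw [le_div_iff₀ (by positivity)] at h1
    rw [div_le_div_iff₀ hη (by positivity)]
    linarith
  refine ⟨κ, hκ0, ?_⟩
  by_contra hcon
  have hτm : Measurable (M.speed α) := measurable_speed hα.lip.continuous
  set P := Ioo c d \ E with hP
  have hPm : MeasurableSet P := measurableSet_Ioo.diff hEm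
  set N := {s | M.speed α s < κ} ∩ P with hN
  have hNm : MeasurableSet N := (measurableSet_lt hτm measurable_const).inter hPm
  have hNfin : volume N ≠ ⊤ :=
    (measure_mono (inter_subset_right.trans sdiff_subset)).trans_lt measure_Ioo_lt_top |>.ne
  have hPfin : volume P ≠ ⊤ := (measure_mono sdiff_subset).trans_lt measure_Ioo_lt_top |>.ne
  have hN0 : volume N ≠ 0 := fun h0 => hcon <| by
    filter_upwards [measure_eq_zero_iff_ae_notMem.1 h0] with s hs hscd
    by_contra hlt
    rw [not_le] at hlt
    exact hs ⟨hlt, hscd, fun hsE => absurd (hEη s hsE) (not_le.2 (hlt.trans_le hκη))⟩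
  set m := volume.real N with hm
  have hm0 : 0 < m := ENNReal.toReal_pos hN0 hNfin
  have hPle : volume.real P ≤ 1 / A := by
    rcases le_total c d with h | h
    · refine (measureReal_mono sdiff_subset measure_Ioo_lt_top.ne).trans ?_
      rw [Real.volume_real_Ioo_of_le h]; exact hcd
    · have : P = ∅ := by rw [hP, Ioo_eq_empty (not_lt.2 h), empty_sdiff]
      rw [this, measureReal_empty]; positivity
  -- the variation field
  set φ : ℝ → ℝ := fun s => m * A + N.indicator 1 s with hφ
  have hφm : Measurable φ := measurable_const.add (measurable_one.indicator hNm)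
  have hφ0 : ∀ s, m * A ≤ φ s := fun s =>
    le_add_of_nonneg_right (indicator_nonneg (fun _ _ => zero_le_one) s)
  have hφ1 : ∀ s, φ s ≤ m * A + 1 := fun s => by
    simp only [hφ]
    gcongr
    exact indicator_le' (fun _ _ => le_rfl) (fun _ _ => zero_le_one) s
  have hmA : 0 < m * A := mul_pos hm0 hA0
  set θ : ℝ → SpacetimePt n := fun s => φ s • M.X0 (α s) with hθ
  have hθm : Measurable θ := hφm.smul (M.X0_cont.comp hα.lip.continuous).measurable
  have hθle : ∀ s, ‖θ s‖ ≤ G * φ s := fun s => by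
    rw [hθ]
    simp only
    rw [norm_smul, Real.norm_of_nonneg (hmA.le.trans (hφ0 s)), mul_comm]
    have := (hG _ (hαK s)).1
    have := hmA.le.trans (hφ0 s)
    gcongr
  set y : SpacetimePt n := -(1 / e) • ∫ s in P, θ s with hy
  have hφi : ∀ S : Set ℝ, volume S ≠ ⊤ → IntegrableOn φ S := fun S hS =>
    Measure.integrableOn_of_bounded hS hφm.aestronglyMeasurable (M := m * A + 1)
      (ae_of_all _ fun s => by rw [Real.norm_of_nonneg (hmA.le.trans (hφ0 s))]; exact hφ1 s)
  have hθi : IntegrableOn θ P := Integrable.mono' ((hφi P hPfin).const_mul G)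
    hθm.aestronglyMeasurable (ae_of_all _ hθle)
  have hφP : ∫ s in P, φ s ≤ 2 * m := by
    have h1 : ∫ s in P, φ s = volume.real P * (m * A) + m := by
      have hi : IntegrableOn (N.indicator (1 : ℝ → ℝ)) P :=
        (integrable_indicator_iff hNm).2 (integrableOn_const (hs := hNfin)) |>.integrableOn
      have hi0 : Integrable (fun _ : ℝ => m * A) (volume.restrict P) :=
        integrableOn_const (hs := hPfin)
      simp only [hφ]
      rw [integral_add hi0 hi, setIntegral_const, smul_eq_mul,
        integral_indicator_one hNm, measureReal_restrict_apply hNm,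
        inter_eq_left.2 inter_subset_right]
    rw [h1]
    have : volume.real P * (m * A) ≤ 1 / A * (m * A) := by gcongr
    have h2 : 1 / A * (m * A) = m := by field_simp
    linarith
  have hyle : ‖y‖ ≤ 2 * G * m / e := by
    rw [hy, norm_smul, norm_neg, Real.norm_of_nonneg (by positivity)]
    have h1 : ‖∫ s in P, θ s‖ ≤ G * (2 * m) := by
      refine (norm_integral_le_of_norm_le ((hφi P hPfin).const_mul G) (ae_of_all _ hθle)).trans ?_
      rw [integral_const_mul]
      gcongr
    calc 1 / e * ‖∫ s in P, θ s‖ ≤ 1 / e * (G * (2 * m)) := by gcongr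
      _ = 2 * G * m / e := by ring
  set ψ : ℝ → SpacetimePt n := fun s => P.indicator θ s + E.indicator (fun _ => y) s with hψ
  have hPE : Disjoint P E := disjoint_sdiff_left
  have hψP : ∀ s ∈ P, ψ s = θ s := fun s hs => by
    simp [hψ, hs, disjoint_left.1 hPE hs]
  have hψE : ∀ s ∈ E, ψ s = y := fun s hs => by
    simp [hψ, hs, disjoint_right.1 hPE hs]
  have hψO : ∀ s, s ∉ Ioo c d → ψ s = 0 := fun s hs => by
    have h1 : s ∉ P := fun h => hs h.1
    have h2 : s ∉ E := fun h => hs (hEcd h)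
    simp [hψ, h1, h2]
  have hψm : Measurable ψ := (hθm.indicator hPm).add (measurable_const.indicator hEm)
  have hψi1 : Integrable (P.indicator θ) := (integrable_indicator_iff hPm).2 hθi
  have hψi2 : Integrable (E.indicator fun _ => y) :=
    (integrable_indicator_iff hEm).2 (integrableOn_const (hs := hEfin))
  have hψi : Integrable ψ := hψi1.add hψi2
  set b : ℝ → ℝ := fun s => P.indicator (fun s => G * φ s) s +
    E.indicator (fun _ => 2 * G * m / e) s with hb
  have hbi1 : Integrable (P.indicator fun s => G * φ s) :=
    (integrable_indicator_iff hPm).2 ((hφi P hPfin).const_mul G)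
  have hbi2 : Integrable (E.indicator fun _ => 2 * G * m / e) :=
    (integrable_indicator_iff hEm).2 (integrableOn_const (hs := hEfin))
  have hbint : ∫ s, b s ≤ 4 * G * m := by
    simp only [hb]
    rw [integral_add hbi1 hbi2, integral_indicator hPm, integral_indicator hEm, setIntegral_const,
      integral_const_mul, smul_eq_mul, ← he]
    have h1 : e * (2 * G * m / e) = 2 * G * m := by field_simp
    have h2 := mul_le_mul_of_nonneg_left hφP hG0.le
    linarith
  have hψb : ∀ s, ‖ψ s‖ ≤ b s := fun s => by
    refine (norm_add_le _ _).trans (add_le_add ?_ ?_)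
    · by_cases hs : s ∈ P <;> simp [hs, hθle s]
    · by_cases hs : s ∈ E <;> simp [hs, hyle]
  have hWle : ∀ s, ‖∫ u in (0:ℝ)..s, ψ u‖ ≤ 4 * G * m := fun s => by
    refine intervalIntegral.norm_integral_le_integral_norm_uIoc.trans ?_
    have hbn : ∀ s, 0 ≤ b s := fun s => (norm_nonneg _).trans (hψb s)
    calc ∫ u in uIoc 0 s, ‖ψ u‖ ≤ ∫ u, ‖ψ u‖ :=
          setIntegral_le_integral hψi.norm (ae_of_all _ fun _ => norm_nonneg _)
      _ ≤ ∫ u, b u := integral_mono hψi.norm (hbi1.add hbi2) hψb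
      _ ≤ _ := hbint
  have hψall : ∫ u, ψ u = 0 := by
    simp only [hψ]
    rw [integral_add hψi1 hψi2, integral_indicator hPm, integral_indicator hEm, setIntegral_const,
      ← he, hy, smul_smul]
    have : e * -(1 / e) = -1 := by field_simp
    rw [this, neg_one_smul, add_neg_cancel]
  have hψd : ∀ t, 0 ≤ t → d ≤ t → ∫ u in (0:ℝ)..t, ψ u = 0 := fun t ht hdt => by
    rw [intervalIntegral.integral_of_le ht, ← hψall]
    exact setIntegral_eq_integral_of_forall_compl_eq_zero fun s hs =>
      hψO s fun h => hs ⟨hc0.trans_lt h.1, h.2.le.trans hdt⟩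
  have hψc : ∀ t, 0 ≤ t → t ≤ c → ∫ u in (0:ℝ)..t, ψ u = 0 := fun t ht hdt => by
    rw [intervalIntegral.integral_of_le ht]
    exact setIntegral_eq_zero_of_forall_eq_zero fun s hs =>
      hψO s fun h => absurd h.1 (not_lt.2 (hs.2.trans hdt))
  have hψ0 := hψd ℓ hα.pos.le hdℓ
  set DE := G * m * (4 + 2 / e) with hDE
  have hDE0 : 0 < DE := by positivity
  set D := DE + G * (m * A + 1) with hD
  have hGA : 0 < G * (m * A + 1) := by positivity
  have hD0 : 0 < D := by positivity
  have hW4 : 4 * G * m ≤ DE := by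
    have : 0 ≤ G * m * (2 / e) := by positivity
    rw [hDE]; linarith
  have hyDE : ‖y‖ ≤ DE := by
    refine hyle.trans ?_
    have : G * m * (2 / e) = 2 * G * m / e := by ring
    have h2 : 0 ≤ G * m * 4 := by positivity
    rw [hDE, ← this]; linarith
  have hψD : ∀ s, ‖ψ s‖ ≤ D := fun s => by
    by_cases h1 : s ∈ P
    · rw [hψP s h1]
      have := mul_le_mul_of_nonneg_left (hφ1 s) hG0.le
      linarith [hθle s]
    by_cases h2 : s ∈ E
    · rw [hψE s h2]; linarith
    · rw [hψO s fun h => h1 ⟨h, h2⟩, norm_zero]; exact hD0.le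
  obtain ⟨ε, hε0, hε1, hε2, hε3, hε4⟩ : ∃ ε > 0, ε * D ≤ ρ ∧ ε * D ≤ 1 ∧ ε * c₁ ≤ κ ^ 2 ∧
      ε * (C₂ * DE) ≤ η ^ 2 := by
    refine ⟨min (min (ρ / D) (1 / D)) (min (κ ^ 2 / c₁) (η ^ 2 / (C₂ * DE))), by positivity,
      ?_, ?_, ?_, ?_⟩
    · rw [← le_div_iff₀ hD0]; exact (min_le_left _ _).trans (min_le_left _ _)
    · rw [← le_div_iff₀ hD0]; exact (min_le_left _ _).trans (min_le_right _ _)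
    · rw [← le_div_iff₀ hc₁]; exact (min_le_right _ _).trans (min_le_left _ _)
    · rw [← le_div_iff₀ (by positivity)]; exact (min_le_right _ _).trans (min_le_right _ _)
  set h : ℝ → ℝ := fun s => N.indicator (fun _ => c₁ / (4 * κ)) s -
    E.indicator (fun _ => C₂ * DE / η) s with hh
  have hhi1 : Integrable (N.indicator fun _ => c₁ / (4 * κ)) :=
    (integrable_indicator_iff hNm).2 (integrableOn_const (hs := hNfin))
  have hhi2 : Integrable (E.indicator fun _ => C₂ * DE / η) :=
    (integrable_indicator_iff hEm).2 (integrableOn_const (hs := hEfin))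
  have hInt := hα.integral_nonpos (B := ⟨D, hD0.le⟩) hψm hψD hψ0 hε0
    (hhi1.sub hhi2).intervalIntegrable (h := h) ?_
  · have hO : ∫ s in Ioc 0 ℓ, h s = ∫ s, h s :=
      setIntegral_eq_integral_of_forall_compl_eq_zero fun s hs => by
        have h0 : s ∉ Ioo c d := fun h => hs ⟨hc0.trans_lt h.1, h.2.le.trans hdℓ⟩
        have h1 : s ∉ N := fun h => h0 h.2.1
        have h2 : s ∉ E := fun h => h0 (hEcd h)
        simp [hh, h1, h2]
    rw [intervalIntegral.integral_of_le hα.pos.le, hO] at hInt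
    simp only [hh] at hInt
    rw [integral_sub hhi1 hhi2, integral_indicator hNm, integral_indicator hEm, setIntegral_const,
      setIntegral_const, smul_eq_mul, smul_eq_mul, ← he, ← hm] at hInt
    have h1 : e * (C₂ * DE / η) = m * ((C₂ * G * (4 * e + 2)) / η) := by
      rw [hDE]; field_simp
    have h2 := mul_le_mul_of_nonneg_left hκq hm0.le
    rw [add_div, mul_add] at h2
    have h3 : 0 < m * (1 / η) := by positivity
    linarith
  · filter_upwards [hα.ae] with s hs hsℓ
    obtain ⟨-, hca, hfd, hu⟩ := hs hsℓ
    have hτ := speed_sq hca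
    have hτ0 := speed_nonneg (M := M) α s
    have hWs := hWle s
    set w := ∫ u in (0:ℝ)..s, ψ u with hw
    have hwK : α s + ε • w ∈ K := by
      rw [hKdef, mem_closedBall_zero_iff]
      refine (norm_add_le _ _).trans (add_le_add (hαR s) ?_)
      rw [norm_smul, Real.norm_of_nonneg hε0.le]
      exact (mul_le_mul_of_nonneg_left (hWs.trans (hW4.trans (le_add_of_nonneg_right hGA.le)))
        hε0.le).trans hε2
    by_cases hsE : s ∈ E
    · have hsN : s ∉ N := fun h => h.2.2 hsE
      obtain ⟨v1, v2, -⟩ := hvar (α s) (hαK s) (deriv α s) hu hca hfd w (ψ s) ε DE hε0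
        (hWs.trans hW4) (by rw [hψE s hsE]; exact hyDE)
        ((mul_le_mul_of_nonneg_left (le_add_of_nonneg_right hGA.le) hε0.le).trans hε1) hwK
      have hEs := hEη s hsE
      rw [← hτ] at v2
      have h5 : η ^ 2 ≤ M.speed α s ^ 2 := pow_le_pow_left₀ hη.le hEs 2
      refine ⟨v1, by linarith, Real.le_sqrt_of_sq_le (le_trans ?_ v2)⟩
      simp only [hh, indicator_of_notMem hsN, indicator_of_mem hsE, zero_sub]
      set x := ε * (C₂ * DE) with hx
      have hx0 : 0 < x := by positivity
      have e1 : ε * -(C₂ * DE / η) = -(x / η) := by rw [hx]; ring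
      rw [e1]
      have h6 : x / η ≤ η := by rw [div_le_iff₀ hη]; linarith
      have h7 : 0 < x / η := by positivity
      have h8 : x / η * η = x := by field_simp
      have h9 := sub_sq_le_of_le h7.le h6 hEs
      rwa [h8, sub_eq_add_neg] at h9
    · have hφs : ∀ (hs : s ∈ P), Kc * ‖w‖ ≤ φ s := fun _ => by
        refine le_trans ?_ (hφ0 s)
        calc Kc * ‖w‖ ≤ Kc * (4 * G * m) := by gcongr
          _ = m * A := by rw [hA]; ring
      by_cases hsP : s ∈ P
      · obtain ⟨v1, -, v3⟩ := hvar (α s) (hαK s) (deriv α s) hu hca hfd w (ψ s) ε D hε0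
          (hWs.trans (hW4.trans (le_add_of_nonneg_right hGA.le))) (hψD s) hε1 hwK
        have v4 := v3 (φ s) (hψP s hsP) (hφs hsP)
        rw [← hτ] at v4
        have hφp := hmA.trans_le (hφ0 s)
        have hp : 0 < ε * (c₁ * φ s) := by positivity
        refine ⟨v1, by linarith [sq_nonneg (M.speed α s)], Real.le_sqrt_of_sq_le (le_trans ?_ v4)⟩
        by_cases hsN : s ∈ N
        · simp only [hh, indicator_of_mem hsN, indicator_of_notMem hsE, sub_zero]
          have h1 : (1:ℝ) ≤ φ s := by
            simp only [hφ, indicator_of_mem hsN, Pi.one_apply]; linarith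
          have h2 : ε * c₁ ≤ ε * (c₁ * φ s) := by
            have : c₁ * 1 ≤ c₁ * φ s := by gcongr
            have := mul_le_mul_of_nonneg_left this hε0.le
            linarith
          have h3 : M.speed α s < κ := hsN.1
          set x := ε * c₁ with hx
          have hx0 : 0 < x := by positivity
          have e1 : ε * (c₁ / (4 * κ)) = x / (4 * κ) := by rw [hx]; ring
          rw [e1]
          have h7 : 0 < x / (4 * κ) := by positivity
          have h8 : x / (4 * κ) * (4 * κ) = x := by field_simp
          have h9 : x / (4 * κ) ≤ κ := by rw [div_le_iff₀ (by positivity)]; linarith [sq_nonneg κ]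
          have h10 := add_sq_le_of_le h3.le h7.le h9
          rw [h8] at h10
          linarith
        · simp only [hh, indicator_of_notMem hsN, indicator_of_notMem hsE, sub_zero, mul_zero,
            add_zero]
          linarith
      · have hscd : s ∉ Ioo c d := fun h => hsP ⟨h, hsE⟩
        have hsN : s ∉ N := fun h => hsP h.2
        have hw0 : w = 0 := by
          rcases le_or_gt s c with h1 | h1
          · exact hψc s hsℓ.1.le h1
          · exact hψd s hsℓ.1.le (not_lt.1 fun h2 => hscd ⟨h1, h2⟩)
        simp only [hh, indicator_of_notMem hsN, indicator_of_notMem hsE, sub_zero, mul_zero,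
          add_zero, hw0, hψO s hscd, smul_zero]
        exact ⟨hfd, hca.2, le_rfl⟩

end C1Spacetime

lemma ae_Ioo_union {p : ℝ → Prop} {a b c : ℝ} (h1 : ∀ᵐ s, s ∈ Ioo a b → p s)
    (h2 : ∀ᵐ s, s ∈ Ioo b c → p s) : ∀ᵐ s, s ∈ Ioo a c → p s := by
  filter_upwards [h1, h2, Measure.ae_ne volume b] with s h1 h2 hne hs
  rcases lt_or_gt_of_ne hne with h | h
  · exact h1 ⟨hs.1, h⟩
  · exact h2 ⟨h, hs.2⟩

/-- A lower bound on one piece of a partition propagates to the whole interval if it propagates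
within short intervals. -/
lemma exists_ae_lower_bound {τ : ℝ → ℝ} {ℓ δ : ℝ} (hτm : Measurable τ) (hℓ : 0 < ℓ) (hδ : 0 < δ)
    (hτ0 : ∀ s, 0 ≤ τ s) (hpos : ∫ s in (0:ℝ)..ℓ, τ s ≠ 0)
    (hloc : ∀ c d, 0 ≤ c → d ≤ ℓ → d - c ≤ δ → ∀ η > 0, ∀ E ⊆ Ioo c d, MeasurableSet E →
      volume E ≠ 0 → (∀ s ∈ E, η ≤ τ s) → ∃ κ > 0, ∀ᵐ s, s ∈ Ioo c d → κ ≤ τ s) :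
    ∃ κ > 0, ∀ᵐ s, s ∈ Ioo 0 ℓ → κ ≤ τ s := by
  obtain ⟨N, hN⟩ := exists_nat_gt (2 * ℓ / δ)
  have hN0 : (0:ℝ) < N := lt_of_le_of_lt (by positivity) hN
  set h := ℓ / N with hh
  have hh0 : 0 < h := by positivity
  have hhδ : 2 * h ≤ δ := by
    rw [div_lt_iff₀ hδ] at hN
    rw [hh, ← mul_div_assoc, div_le_iff₀ hN0]
    linarith
  have hNh : N * h = ℓ := by rw [hh]; field_simp
  have hle : ∀ i : ℕ, i ≤ N → i * h ≤ ℓ := fun i hi => by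
    rw [← hNh]; gcongr
  set Q : ℕ → Prop := fun i => ∃ κ > 0, ∀ᵐ s, s ∈ Ioo (i * h) ((i + 1 : ℕ) * h) → κ ≤ τ s with hQ
  have hmem : ∀ i : ℕ, Q i → ∀ a b, a ≤ i * h → (i + 1 : ℕ) * h ≤ b → 0 ≤ a → b ≤ ℓ → b - a ≤ δ →
      ∃ κ > 0, ∀ᵐ s, s ∈ Ioo a b → κ ≤ τ s := by
    rintro i ⟨κ, hκ, hae⟩ a b ha hb ha0 hbℓ hab
    refine hloc a b ha0 hbℓ hab κ hκ (Ioo (i * h) ((i + 1 : ℕ) * h) ∩ {s | κ ≤ τ s})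
      (inter_subset_left.trans (Ioo_subset_Ioo ha hb))
      (measurableSet_Ioo.inter (measurableSet_le measurable_const hτm)) ?_ fun s hs => hs.2
    have : (Ioo (i * h) ((i + 1 : ℕ) * h) ∩ {s | κ ≤ τ s} : Set ℝ) =ᵐ[volume]
        Ioo (i * h) ((i + 1 : ℕ) * h) := by
      filter_upwards [hae] with s hs
      exact propext ⟨fun h => h.1, fun h => ⟨h, hs h⟩⟩
    rw [measure_congr this, Real.volume_Ioo]
    simp only [ne_eq, ENNReal.ofReal_eq_zero, not_le]
    push_cast
    linarith
  have hsub : ∀ {a b a' b' : ℝ}, a ≤ a' → b' ≤ b → (∃ κ > 0, ∀ᵐ s, s ∈ Ioo a b → κ ≤ τ s) →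
      ∃ κ > 0, ∀ᵐ s, s ∈ Ioo a' b' → κ ≤ τ s := fun ha hb ⟨κ, hκ, hae⟩ =>
    ⟨κ, hκ, hae.mono fun s hs h' => hs (Ioo_subset_Ioo ha hb h')⟩
  have hstep : ∀ i : ℕ, i + 2 ≤ N → (Q i ↔ Q (i + 1)) := fun i hi => by
    have hb : ((i + 2 : ℕ) : ℝ) * h ≤ ℓ := hle _ hi
    have h1 : (i : ℝ) * h ≤ (i + 1 : ℕ) * h := by gcongr; simp
    have h2 : ((i + 1 : ℕ) : ℝ) * h ≤ (i + 2 : ℕ) * h := by gcongr; simp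
    have h3 : (i + 2 : ℕ) * h - i * h ≤ δ := by push_cast; linarith
    have h4 : (0:ℝ) ≤ i * h := by positivity
    exact ⟨fun hi => hsub h1 le_rfl (hmem i hi _ _ le_rfl h2 h4 hb h3),
      fun hi => hsub le_rfl h2 (hmem (i + 1) hi _ _ h1 le_rfl h4 hb h3)⟩
  have hall0 : ∀ i : ℕ, i + 1 ≤ N → (Q i ↔ Q 0) := by
    intro i
    induction i with
    | zero => exact fun _ => Iff.rfl
    | succ k ih => exact fun hk => (hstep k hk).symm.trans (ih (by omega))
  have hchain : ∀ p : ℝ → Prop, (∀ i : ℕ, i + 1 ≤ N →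
      ∀ᵐ s, s ∈ Ioo (i * h) ((i + 1 : ℕ) * h) → p s) → ∀ᵐ s, s ∈ Ioo 0 ℓ → p s := by
    intro p hp
    have : ∀ i : ℕ, i ≤ N → ∀ᵐ s, s ∈ Ioo 0 (i * h) → p s := by
      intro i
      induction i with
      | zero => simp
      | succ k ih => exact fun hk => ae_Ioo_union (ih (by omega)) (hp k hk)
    have := this N le_rfl
    rwa [hNh] at this
  by_cases hQ0 : Q 0
  · have hQa : ∀ i : ℕ, ∃ κ > 0, i + 1 ≤ N →
        ∀ᵐ s, s ∈ Ioo (i * h) ((i + 1 : ℕ) * h) → κ ≤ τ s := fun i => by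
      by_cases hi : i + 1 ≤ N
      · obtain ⟨κ, hκ, h1⟩ := (hall0 i hi).2 hQ0
        exact ⟨κ, hκ, fun _ => h1⟩
      · exact ⟨1, one_pos, fun h => absurd h hi⟩
    choose κ hκ hκae using hQa
    have hne : (Finset.range (N + 1)).Nonempty := ⟨0, by simp⟩
    refine ⟨(Finset.range (N + 1)).inf' hne κ, (Finset.lt_inf'_iff _).2 fun i _ => hκ i,
      hchain _ fun i hi => (hκae i hi).mono fun s hs h' => (Finset.inf'_le _ ?_).trans (hs h')⟩
    simp only [Finset.mem_range]; omega
  · exfalso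
    refine hpos ?_
    have h0 : ∀ᵐ s, s ∈ Ioo 0 ℓ → τ s = 0 := by
      refine hchain _ fun i hi => ?_
      have hnQ : ¬ Q i := fun h => hQ0 ((hall0 i hi).1 h)
      have : ∀ k : ℕ, ∀ᵐ s, ¬ (s ∈ Ioo (i * h) ((i + 1 : ℕ) * h) ∧ 1 / (k + 1 : ℝ) ≤ τ s) := by
        intro k
        have hk : (0:ℝ) < 1 / (k + 1 : ℝ) := by positivity
        by_contra hcon
        refine hnQ (hloc _ _ (by positivity) (hle _ hi) (by push_cast; linarith) _ hk
          {s | s ∈ Ioo (i * h) ((i + 1 : ℕ) * h) ∧ 1 / (k + 1 : ℝ) ≤ τ s} (fun s hs => hs.1)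
          (measurableSet_Ioo.inter (measurableSet_le measurable_const hτm)) (fun h0 => hcon ?_)
          fun s hs => hs.2)
        exact measure_eq_zero_iff_ae_notMem.1 h0
      filter_upwards [ae_all_iff.2 this] with s hs hsi
      by_contra hne
      obtain ⟨k, hk⟩ := exists_nat_one_div_lt (lt_of_le_of_ne (hτ0 s) (Ne.symm hne))
      exact hs k ⟨hsi, hk.le⟩
    rw [intervalIntegral.integral_of_le hℓ.le, integral_Ioc_eq_integral_Ioo]
    exact setIntegral_eq_zero_of_ae_eq_zero h0

namespace C1Spacetime

variable {n : ℕ} {M : C1Spacetime n}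

/-- A maximizer of positive length is uniformly timelike. -/
theorem MaxCurve.exists_speed_lower_bound {α : ℝ → SpacetimePt n} {ℓ : ℝ} (hα : M.MaxCurve α ℓ)
    (hpos : 0 < M.gLength α 0 ℓ) : ∃ κ > 0, ∀ᵐ s, s ∈ Ioo 0 ℓ → κ ≤ M.speed α s := by
  obtain ⟨δ, hδ, h⟩ := hα.exists_local_bound
  exact exists_ae_lower_bound (measurable_speed hα.lip.continuous) hα.pos hδ (speed_nonneg α)
    hpos.ne' h

end C1Spacetime

lemma HasDerivWithinAt.bilForm {n : ℕ} {G : ℝ → Fin n → Fin n → ℝ} {u v : ℝ → Fin n → ℝ}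
    {G' : Fin n → Fin n → ℝ} {u' v' : Fin n → ℝ} {S : Set ℝ} {t : ℝ}
    (hG : HasDerivWithinAt G G' S t) (hu : HasDerivWithinAt u u' S t)
    (hv : HasDerivWithinAt v v' S t) :
    HasDerivWithinAt (fun s => _root_.bilForm (G s) (u s) (v s))
      (_root_.bilForm G' (u t) (v t) + _root_.bilForm (G t) u' (v t) +
        _root_.bilForm (G t) (u t) v') S t := by
  have hG' : ∀ i j, HasDerivWithinAt (fun s => G s i j) (G' i j) S t := fun i j =>
    hasDerivWithinAt_pi.1 (hasDerivWithinAt_pi.1 hG i) j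
  have h := HasDerivWithinAt.fun_sum (u := Finset.univ) fun i _ =>
    HasDerivWithinAt.fun_sum (u := Finset.univ) fun j _ =>
      ((hG' i j).fun_mul (hasDerivWithinAt_pi.1 hu i)).fun_mul (hasDerivWithinAt_pi.1 hv j)
  refine h.congr_deriv ?_
  simp only [_root_.bilForm, ← Finset.sum_add_distrib]
  refine Finset.sum_congr rfl fun i _ => Finset.sum_congr rfl fun j _ => ?_
  ring

namespace C1Spacetime

variable {n : ℕ} (M : C1Spacetime n)

/-- The directional derivative of the metric. -/
def dg (z w : SpacetimePt n) : Fin n → Fin n → ℝ := fderiv ℝ M.g z w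

lemma dg_smul (c : ℝ) (z w : SpacetimePt n) : M.dg z (c • w) = c • M.dg z w := map_smul _ _ _

lemma continuous_dg {Y : Type*} [TopologicalSpace Y] {f u : Y → SpacetimePt n}
    (hf : Continuous f) (hu : Continuous u) : Continuous fun y => M.dg (f y) (u y) :=
  ((M.g_contDiff.continuous_fderiv one_ne_zero).comp hf).clm_apply hu

lemma hasDerivWithinAt_g {α : ℝ → SpacetimePt n} {v : SpacetimePt n} {S : Set ℝ} {t : ℝ}
    (h : HasDerivWithinAt α v S t) : HasDerivWithinAt (fun s => M.g (α s)) (M.dg (α t) v) S t :=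
  ((M.g_contDiff.differentiable one_ne_zero).differentiableAt.hasFDerivAt).comp_hasDerivWithinAt t h

lemma hasDerivAt_bilForm_variation (z v w ψ : SpacetimePt n) :
    HasDerivAt (fun ε : ℝ => bilForm (M.g (z + ε • w)) (v + ε • ψ) (v + ε • ψ))
      (2 * bilForm (M.g z) v ψ + bilForm (M.dg z w) v v) 0 := by
  have hl : ∀ a b : SpacetimePt n, HasDerivWithinAt (fun ε : ℝ => a + ε • b) b univ 0 := fun a b => by
    have := ((hasDerivAt_id (0:ℝ)).smul_const b).const_add a
    simpa using this
  have h1 := M.hasDerivWithinAt_g (hl z w)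
  have h2 := h1.bilForm (hl v ψ) (hl v ψ)
  rw [hasDerivWithinAt_univ] at h2
  refine h2.congr_deriv ?_
  simp only [zero_smul, add_zero]
  rw [M.bilForm_symm z ψ v]
  ring

lemma exists_variation_bound {K : Set (SpacetimePt n)} (hK : IsCompact K) (hcv : Convex ℝ K) :
    ∃ C > 0, ∀ z ∈ K, ∀ v, ‖v‖ ≤ 1 → ∀ (w ψ : SpacetimePt n) (ε D : ℝ), 0 < ε → ‖w‖ ≤ D →
      ‖ψ‖ ≤ D → ε * D ≤ 1 → z + ε • w ∈ K →
      |bilForm (M.g (z + ε • w)) (v + ε • ψ) (v + ε • ψ) - bilForm (M.g z) v v| ≤ ε * (C * D) := by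
  obtain ⟨G, hG0, hG⟩ := M.exists_bilForm_bound hK
  obtain ⟨L, hL0, hL⟩ := M.exists_bilForm_lipschitz hK hcv
  refine ⟨3 * G + 4 * L, by positivity, fun z hz v hv1 w ψ ε D hε hw hψ hεD hzw => ?_⟩
  have hD0 : 0 ≤ D := (norm_nonneg w).trans hw
  have hεψ : ‖ε • ψ‖ ≤ ε * D := by rw [norm_smul, Real.norm_of_nonneg hε.le]; gcongr
  have hv2 : ‖v + ε • ψ‖ ≤ 2 := (norm_add_le _ _).trans (by linarith)
  have h1 : |bilForm (M.g (z + ε • w)) (v + ε • ψ) (v + ε • ψ) -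
      bilForm (M.g z) (v + ε • ψ) (v + ε • ψ)| ≤ 4 * L * ε * D := by
    refine (hL z hz (z + ε • w) hzw (v + ε • ψ) (v + ε • ψ)).trans ?_
    have : ‖z + ε • w - z‖ = ε * ‖w‖ := by
      rw [add_sub_cancel_left, norm_smul, Real.norm_of_nonneg hε.le]
    rw [this]
    calc L * (ε * ‖w‖) * ‖v + ε • ψ‖ * ‖v + ε • ψ‖ ≤ L * (ε * D) * 2 * 2 := by gcongr
      _ = 4 * L * ε * D := by ring
  have h2 : |bilForm (M.g z) v ψ| ≤ G * D := by
    refine ((hG z hz).2 v ψ).trans ?_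
    calc G * ‖v‖ * ‖ψ‖ ≤ G * 1 * D := by gcongr
      _ = G * D := by ring
  have h3 : |ε * bilForm (M.g z) ψ ψ| ≤ G * D := by
    rw [abs_mul, abs_of_pos hε]
    calc ε * |bilForm (M.g z) ψ ψ| ≤ ε * (G * D * D) := by
          have := (hG z hz).2 ψ ψ
          refine mul_le_mul_of_nonneg_left (this.trans ?_) hε.le
          gcongr
      _ = G * D * (ε * D) := by ring
      _ ≤ G * D * 1 := by gcongr
      _ = G * D := by ring
  have h4 : |bilForm (M.g z) (v + ε • ψ) (v + ε • ψ) - bilForm (M.g z) v v| ≤ 3 * G * ε * D := by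
    rw [M.bilForm_add_smul_self z]
    have : bilForm (M.g z) v v + 2 * ε * bilForm (M.g z) v ψ + ε ^ 2 * bilForm (M.g z) ψ ψ -
        bilForm (M.g z) v v = ε * (2 * bilForm (M.g z) v ψ + ε * bilForm (M.g z) ψ ψ) := by ring
    rw [this, abs_mul, abs_of_pos hε]
    have h5 : |2 * bilForm (M.g z) v ψ + ε * bilForm (M.g z) ψ ψ| ≤ 3 * (G * D) := by
      rw [abs_le] at *
      constructor <;> linarith
    have := mul_le_mul_of_nonneg_left h5 hε.le
    linarith
  have := abs_sub_le (bilForm (M.g (z + ε • w)) (v + ε • ψ) (v + ε • ψ))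
    (bilForm (M.g z) (v + ε • ψ) (v + ε • ψ)) (bilForm (M.g z) v v)
  linarith

variable {M}

lemma abs_sqrt_sub_le {a τ κ : ℝ} (ha : 0 ≤ a) (hκ : 0 < κ) (hτ : κ ≤ τ) :
    |√a - τ| ≤ |a - τ ^ 2| / κ := by
  rw [le_div_iff₀ hκ]
  have h1 : a - τ ^ 2 = (√a - τ) * (√a + τ) := by
    nlinarith [Real.sq_sqrt ha]
  have h2 : κ ≤ |√a + τ| := by
    have := Real.sqrt_nonneg a
    rw [abs_of_nonneg (by linarith)]
    linarith
  rw [h1, abs_mul]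
  gcongr

lemma MaxCurve.first_variation_nonpos {α : ℝ → SpacetimePt n} {ℓ : ℝ} (hα : M.MaxCurve α ℓ)
    {κ : ℝ} (hκ0 : 0 < κ) (hκ : ∀ᵐ s, s ∈ Ioo 0 ℓ → κ ≤ M.speed α s)
    {ψ : ℝ → SpacetimePt n} {B : ℝ≥0} (hψ : Measurable ψ) (hB : ∀ s, ‖ψ s‖ ≤ B)
    (hψ0 : ∫ u in (0:ℝ)..ℓ, ψ u = 0) :
    ∫ s in (0:ℝ)..ℓ, -(2 * bilForm (M.g (α s)) (deriv α s) (ψ s) +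
      bilForm (M.dg (α s) (∫ u in (0:ℝ)..s, ψ u)) (deriv α s) (deriv α s)) /
        (2 * M.speed α s) ≤ 0 := by
  set R := ‖α 0‖ + ℓ with hR
  set K := Metric.closedBall (0 : SpacetimePt n) (R + 1) with hKdef
  have hK : IsCompact K := isCompact_closedBall _ _
  have hαR : ∀ s, ‖α s‖ ≤ R := hα.toNCurve.norm_le
  have hαK : ∀ s, α s ∈ K := fun s => by
    rw [hKdef, mem_closedBall_zero_iff]; linarith [hαR s]
  obtain ⟨c₁, hc₁, C₂, hC₂, Kc, hKc, ρ, hρ, hvar⟩ :=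
    M.exists_variation_constants hK (convex_closedBall _ _)
  obtain ⟨C, hC0, hC⟩ := M.exists_variation_bound hK (convex_closedBall _ _)
  set D : ℝ := B * (1 + ℓ) + 1 with hD
  have hℓ := hα.pos
  have hD0 : 0 < D := by positivity
  have hψD : ∀ s, ‖ψ s‖ ≤ D := fun s => (hB s).trans (by
    have : (0:ℝ) ≤ B * ℓ := by positivity
    rw [hD]; linarith)
  set W : ℝ → SpacetimePt n := fun s => ∫ u in (0:ℝ)..s, ψ u with hW
  have hWl : LipschitzWith B W := by simpa using lipschitzWith_primitive hψ hB 0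
  have hWD : ∀ s ∈ Ioo 0 ℓ, ‖W s‖ ≤ D := fun s hs => by
    have := hWl.dist_le_mul s 0
    simp only [dist_eq_norm, hW, intervalIntegral.integral_same, sub_zero,
      Real.norm_of_nonneg hs.1.le] at this
    refine this.trans ?_
    have h1 : (B:ℝ) * s ≤ B * ℓ := by gcongr; exact hs.2.le
    rw [hD]; linarith [B.coe_nonneg]
  set b : ℝ → ℝ → ℝ := fun ε s => bilForm (M.g (α s + ε • W s)) (deriv α s + ε • ψ s)
    (deriv α s + ε • ψ s) with hb
  set F : ℝ → ℝ → ℝ := fun ε s => (√(-b ε s) - M.speed α s) / ε with hF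
  have hbm : ∀ ε, Measurable (b ε) := fun ε => by
    have h : Continuous fun x : SpacetimePt n × SpacetimePt n => bilForm (M.g x.1) x.2 x.2 :=
      M.continuous_bilForm continuous_fst continuous_snd continuous_snd
    have h1 : Measurable fun s => α s + ε • W s :=
      (hα.lip.continuous.add (hWl.continuous.const_smul ε)).measurable
    have h2 : Measurable fun s => deriv α s + ε • ψ s :=
      (measurable_deriv α).add (hψ.const_smul ε)
    have h3 := h.measurable.comp (h1.prodMk h2)
    simp only [hb]
    exact h3
  have hFm : ∀ ε, Measurable (F ε) := fun ε =>
    (((hbm ε).neg.sqrt).sub (measurable_speed hα.lip.continuous)).div_const ε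
  obtain ⟨ε₀, hε₀, hε1, hε2, hε3⟩ : ∃ ε > 0, ε * D ≤ ρ ∧ ε * D ≤ 1 ∧
      ε * (C₂ * D) ≤ κ ^ 2 := by
    refine ⟨min (min (ρ / D) (1 / D)) (κ ^ 2 / (C₂ * D)), by positivity, ?_, ?_, ?_⟩
    · rw [← le_div_iff₀ hD0]; exact (min_le_left _ _).trans (min_le_left _ _)
    · rw [← le_div_iff₀ hD0]; exact (min_le_left _ _).trans (min_le_right _ _)
    · rw [← le_div_iff₀ (by positivity)]; exact min_le_right _ _
  have hev : ∀ᶠ ε in 𝓝[>] (0:ℝ), ε ∈ Ioo 0 ε₀ := Ioo_mem_nhdsGT hε₀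
  have hpt : ∀ ε ∈ Ioo 0 ε₀, ∀ᵐ s, s ∈ Ioo 0 ℓ →
      M.FdVec (α s + ε • W s) (deriv α s + ε • ψ s) ∧ b ε s ≤ 0 ∧ ‖F ε s‖ ≤ C * D / κ := by
    intro ε hε
    filter_upwards [hα.ae, hκ] with s hs hκs hsℓ
    obtain ⟨-, hca, hfd, hu⟩ := hs hsℓ
    have hτ := speed_sq hca
    have hκs := hκs hsℓ
    have hεD : ε * D ≤ ε₀ * D := by gcongr; exact hε.2.le
    have hwK : α s + ε • W s ∈ K := by
      rw [hKdef, mem_closedBall_zero_iff]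
      refine (norm_add_le _ _).trans (add_le_add (hαR s) ?_)
      rw [norm_smul, Real.norm_of_nonneg hε.1.le]
      exact (mul_le_mul_of_nonneg_left (hWD s hsℓ) hε.1.le).trans (hεD.trans hε2)
    obtain ⟨v1, v2, -⟩ := hvar (α s) (hαK s) (deriv α s) hu hca hfd (W s) (ψ s) ε D hε.1
      (hWD s hsℓ) (hψD s) (hεD.trans hε1) hwK
    have v3 := hC (α s) (hαK s) (deriv α s) (norm_le_one_of_euclNorm_eq_one hu) (W s) (ψ s) ε D
      hε.1 (hWD s hsℓ) (hψD s) (hεD.trans hε2) hwK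
    have hb0 : b ε s ≤ 0 := by
      have h1 : ε * (C₂ * D) ≤ ε₀ * (C₂ * D) := by gcongr; exact hε.2.le
      have h2 : κ ^ 2 ≤ M.speed α s ^ 2 := by gcongr
      simp only [hb]; linarith
    refine ⟨v1, hb0, ?_⟩
    rw [hF]
    simp only
    rw [norm_div, Real.norm_of_nonneg hε.1.le, div_le_iff₀ hε.1, Real.norm_eq_abs]
    refine (abs_sqrt_sub_le (neg_nonneg.2 hb0) hκ0 hκs).trans ?_
    rw [div_mul_eq_mul_div, div_le_div_iff_of_pos_right hκ0, hτ, neg_sub_neg, abs_sub_comm]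
    linarith
  have hres : (volume.restrict (uIoc 0 ℓ) : Measure ℝ) = volume.restrict (Ioo 0 ℓ) := by
    rw [uIoc_of_le hℓ.le, restrict_Ioo_eq_restrict_Ioc]
  have hlim : Tendsto (fun ε => ∫ s in (0:ℝ)..ℓ, F ε s) (𝓝[>] 0)
      (𝓝 (∫ s in (0:ℝ)..ℓ, -(2 * bilForm (M.g (α s)) (deriv α s) (ψ s) +
      bilForm (M.dg (α s) (W s)) (deriv α s) (deriv α s)) / (2 * M.speed α s))) := by
    refine intervalIntegral.tendsto_integral_filter_of_dominated_convergence (fun _ => C * D / κ)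
      (Eventually.of_forall fun ε => (hFm ε).aestronglyMeasurable) ?_ (by simp) ?_
    · filter_upwards [hev] with ε hε
      rw [← ae_restrict_iff' measurableSet_uIoc, hres, ae_restrict_iff' measurableSet_Ioo]
      filter_upwards [hpt ε hε] with s hs h using (hs h).2.2
    · rw [← ae_restrict_iff' measurableSet_uIoc, hres, ae_restrict_iff' measurableSet_Ioo]
      filter_upwards [hα.ae, hκ] with s hs hκs hsℓ
      have hτ0 := hκ0.trans_le (hκs hsℓ)
      have h1 := (M.hasDerivAt_bilForm_variation (α s) (deriv α s) (W s) (ψ s)).neg.sqrt (by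
        simp only [zero_smul, add_zero, Pi.neg_apply, neg_ne_zero]
        intro h0
        rw [speed, h0, neg_zero, Real.sqrt_zero] at hτ0
        exact lt_irrefl _ hτ0)
      have h2 := (hasDerivAt_iff_tendsto_slope.1 h1).mono_left
        (nhdsWithin_mono (0:ℝ) (fun x (hx : 0 < x) => hx.ne') : 𝓝[>] (0:ℝ) ≤ 𝓝[≠] 0)
      simp only [Pi.neg_apply, zero_smul, add_zero] at h2
      refine h2.congr fun ε => ?_
      simp only [slope, vsub_eq_sub, sub_zero, smul_eq_mul, zero_smul, add_zero, hF,
        hb, speed]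
      ring
  refine le_of_tendsto hlim ?_
  filter_upwards [hev] with ε hε
  refine hα.integral_nonpos hψ hB hψ0 hε.1 ?_ ?_
  · refine IntervalIntegrable.mono_fun' (g := fun _ => C * D / κ) (by simp)
      (hFm ε).aestronglyMeasurable ?_
    rw [hres]
    refine (ae_restrict_iff' measurableSet_Ioo).2 ?_
    filter_upwards [hpt ε hε] with s hs h using (hs h).2.2
  · filter_upwards [hpt ε hε] with s hs h
    refine ⟨(hs h).1, (hs h).2.1, le_of_eq ?_⟩
    have := hε.1.ne'
    simp only [hF, hb, hW]
    field_simp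
    ring

end C1Spacetime

/-- The du Bois-Reymond lemma. -/
lemma exists_ae_eq_const_add_integral {p q : ℝ → ℝ} {ℓ B : ℝ} (hℓ : 0 < ℓ) (hp : Measurable p)
    (hq : Measurable q) (hpB : ∀ s, |p s| ≤ B) (hqB : ∀ s, |q s| ≤ B)
    (H : ∀ (φ : ℝ → ℝ) (C : ℝ), Measurable φ → (∀ s, |φ s| ≤ C) → ∫ u in (0:ℝ)..ℓ, φ u = 0 →
      ∫ s in (0:ℝ)..ℓ, (p s * φ s + q s * ∫ u in (0:ℝ)..s, φ u) = 0) :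
    ∃ c, ∀ᵐ s, s ∈ Ioo 0 ℓ → p s = c + ∫ u in (0:ℝ)..s, q u := by
  have hI : ∀ {f : ℝ → ℝ} {C : ℝ}, Measurable f → (∀ s, |f s| ≤ C) → ∀ a b,
      IntervalIntegrable f volume a b := fun hf hC a b =>
    .of_measurable_of_bound hf.aestronglyMeasurable hC
  have hqi := hI hq hqB
  set Q : ℝ → ℝ := fun s => ∫ u in (0:ℝ)..s, q u with hQ
  have hQc : Continuous Q := intervalIntegral.continuous_primitive hqi 0
  obtain ⟨A, hA⟩ := isCompact_Icc.exists_bound_of_continuousOn (s := Icc 0 ℓ) hQc.continuousOn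
  set I : Set ℝ := Icc 0 ℓ
  set r : ℝ → ℝ := I.indicator fun s => p s - Q s with hr
  have hrm : Measurable r := (hp.sub hQc.measurable).indicator measurableSet_Icc
  have hB0 : 0 ≤ B := (abs_nonneg _).trans (hpB 0)
  have hA0 : 0 ≤ A := (norm_nonneg _).trans (hA 0 ⟨le_rfl, hℓ.le⟩)
  have hrB : ∀ s, |r s| ≤ B + A := fun s => by
    by_cases hs : s ∈ I
    · simp only [hr, indicator_of_mem hs]
      exact (abs_sub _ _).trans (add_le_add (hpB s) (hA s hs))
    · simp only [hr, indicator_of_notMem hs, abs_zero]; positivity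
  set m := (∫ s in (0:ℝ)..ℓ, r s) / ℓ with hm
  set φ : ℝ → ℝ := fun s => r s - m with hφ
  have hφm : Measurable φ := hrm.sub_const m
  have hφB : ∀ s, |φ s| ≤ B + A + |m| := fun s =>
    (abs_sub _ _).trans (add_le_add (hrB s) le_rfl)
  have hφi := hI hφm hφB
  have hφ0 : ∫ u in (0:ℝ)..ℓ, φ u = 0 := by
    simp only [hφ]
    rw [intervalIntegral.integral_sub (hI hrm hrB 0 ℓ) (by simp), intervalIntegral.integral_const,
      smul_eq_mul, hm]
    field_simp
    ring
  have hH := H φ _ hφm hφB hφ0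
  set Φ : ℝ → ℝ := fun s => ∫ u in (0:ℝ)..s, φ u with hΦ
  have hΦc : Continuous Φ := intervalIntegral.continuous_primitive hφi 0
  have hQd : ∀ᵐ s, deriv Q s = q s := by
    filter_upwards [LocallyIntegrable.ae_hasDerivAt_integral
      (locallyIntegrable_of_measurable_of_bound hq.aestronglyMeasurable hqB)] with s hs
      using (hs 0).deriv
  have hΦd : ∀ᵐ s, deriv Φ s = φ s := by
    filter_upwards [LocallyIntegrable.ae_hasDerivAt_integral
      (locallyIntegrable_of_measurable_of_bound hφm.aestronglyMeasurable hφB)] with s hs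
      using (hs 0).deriv
  have hparts : ∫ s in (0:ℝ)..ℓ, Q s * φ s = - ∫ s in (0:ℝ)..ℓ, q s * Φ s := by
    have h1 := AbsolutelyContinuousOnInterval.integral_mul_deriv_eq_deriv_mul
      ((hqi 0 ℓ).absolutelyContinuousOnInterval_intervalIntegral (c := 0) (by simp))
      ((hφi 0 ℓ).absolutelyContinuousOnInterval_intervalIntegral (c := 0) (by simp))
    have h2 : ∫ s in (0:ℝ)..ℓ, Q s * deriv Φ s = ∫ s in (0:ℝ)..ℓ, Q s * φ s :=
      intervalIntegral.integral_congr_ae (hΦd.mono fun s hs _ => by rw [hs])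
    have h3 : ∫ s in (0:ℝ)..ℓ, deriv Q s * Φ s = ∫ s in (0:ℝ)..ℓ, q s * Φ s :=
      intervalIntegral.integral_congr_ae (hQd.mono fun s hs _ => by rw [hs])
    rw [← h2, ← h3]
    refine h1.trans ?_
    rw [hφ0]
    simp only [mul_zero, intervalIntegral.integral_same, sub_zero, zero_sub]
    rfl
  have hpφ : IntervalIntegrable (fun s => p s * φ s) volume 0 ℓ :=
    hI (hp.mul hφm) (C := B * (B + A + |m|)) (fun s => by
      rw [Pi.mul_apply, abs_mul]; exact mul_le_mul (hpB s) (hφB s) (abs_nonneg _) hB0) 0 ℓ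
  have hqΦ : IntervalIntegrable (fun s => q s * Φ s) volume 0 ℓ :=
    (hqi 0 ℓ).mul_continuousOn hΦc.continuousOn
  have hQφ : IntervalIntegrable (fun s => Q s * φ s) volume 0 ℓ :=
    (hφi 0 ℓ).continuousOn_mul hQc.continuousOn
  have hsq : ∫ s in (0:ℝ)..ℓ, φ s ^ 2 = 0 := by
    have h1 : ∫ s in (0:ℝ)..ℓ, φ s ^ 2 = ∫ s in (0:ℝ)..ℓ, ((p s * φ s - Q s * φ s) - m * φ s) := by
      refine intervalIntegral.integral_congr fun s hs => ?_
      rw [uIcc_of_le hℓ.le] at hs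
      have : φ s = p s - Q s - m := by simp only [hφ, hr]; rw [indicator_of_mem hs]
      change φ s ^ 2 = p s * φ s - Q s * φ s - m * φ s
      rw [sq]; nth_rw 1 [this]; ring
    rw [h1, intervalIntegral.integral_sub (hpφ.sub hQφ) ((hφi 0 ℓ).const_mul m),
      intervalIntegral.integral_sub hpφ hQφ, intervalIntegral.integral_const_mul, hφ0, hparts]
    rw [intervalIntegral.integral_add hpφ hqΦ] at hH
    linarith
  refine ⟨m, ?_⟩
  have h0 : φ ^ 2 =ᵐ[volume.restrict (Ioc 0 ℓ)] 0 := by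
    refine (setIntegral_eq_zero_iff_of_nonneg_ae (ae_of_all _ fun s => sq_nonneg (φ s)) ?_).1 ?_
    · have : IntervalIntegrable (fun s => φ s ^ 2) volume 0 ℓ :=
        hI (hφm.pow_const 2) (C := (B + A + |m|) ^ 2) (fun s => by
          rw [abs_pow]; exact pow_le_pow_left₀ (abs_nonneg _) (hφB s) 2) 0 ℓ
      exact this.1
    · rw [← intervalIntegral.integral_of_le hℓ.le]; exact hsq
  filter_upwards [(ae_restrict_iff' measurableSet_Ioc).1 h0] with s hs hsℓ
  have h1 : φ s = 0 := by simpa using hs ⟨hsℓ.1, hsℓ.2.le⟩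
  have h2 : φ s = p s - Q s - m := by
    simp only [hφ, hr, indicator_of_mem (show s ∈ I from ⟨hsℓ.1.le, hsℓ.2.le⟩)]
  linarith

lemma bilForm_single_right {n : ℕ} (G : Fin n → Fin n → ℝ) (u : Fin n → ℝ) (l : Fin n) :
    bilForm G u (Pi.single l 1) = ∑ i, G i l * u i := by
  simp only [bilForm]
  refine Finset.sum_congr rfl fun i _ => ?_
  rw [Finset.sum_eq_single l] <;> simp +contextual

lemma bilForm_smul_form {n : ℕ} (c : ℝ) (G : Fin n → Fin n → ℝ) (u v : Fin n → ℝ) :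
    bilForm (c • G) u v = c * bilForm G u v := by
  simp [bilForm, Finset.mul_sum, mul_assoc]

/-- A function which is an indefinite integral of a function agreeing almost everywhere with a
continuous one is continuously differentiable. -/
lemma hasDerivWithinAt_of_integral {E : Type*} [NormedAddCommGroup E] [NormedSpace ℝ E]
    [CompleteSpace E] {f h U : ℝ → E} {ℓ : ℝ} (hℓ : 0 < ℓ)
    (hf : ∀ s ∈ Icc 0 ℓ, f s = f 0 + ∫ u in (0:ℝ)..s, h u)
    (hU : ContinuousOn U (Icc 0 ℓ)) (hae : ∀ᵐ s, s ∈ Ioo 0 ℓ → h s = U s) :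
    ∀ s ∈ Icc 0 ℓ, HasDerivWithinAt f (U s) (Icc 0 ℓ) s := by
  set U' : ℝ → E := IccExtend hℓ.le ((Icc 0 ℓ).domRestrict U) with hU'
  have hU'c : Continuous U' := (continuousOn_iff_continuous_domRestrict.1 hU).Icc_extend'
  have hU'e : ∀ s ∈ Icc 0 ℓ, U' s = U s := fun s hs => by
    rw [hU', IccExtend_of_mem _ _ hs, domRestrict_apply]
  intro s hs
  have h1 : HasDerivAt (fun t => f 0 + ∫ u in (0:ℝ)..t, U' u) (U' s) s :=
    (intervalIntegral.integral_hasDerivAt_right (hU'c.intervalIntegrable _ _)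
      (hU'c.stronglyMeasurableAtFilter _ _) hU'c.continuousAt).const_add _
  rw [← hU'e s hs]
  have hcongr : ∀ t ∈ Icc 0 ℓ, f t = f 0 + ∫ u in (0:ℝ)..t, U' u := fun t ht => by
    rw [hf t ht]
    congr 1
    refine intervalIntegral.integral_congr_ae ?_
    filter_upwards [hae, Measure.ae_ne volume ℓ] with u hu hne hut
    rw [uIoc_of_le ht.1] at hut
    have hu0 : u ∈ Ioo 0 ℓ := ⟨hut.1, lt_of_le_of_ne (hut.2.trans ht.2) hne⟩
    rw [hu hu0, hU'e u (Ioo_subset_Icc_self hu0)]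
  exact h1.hasDerivWithinAt.congr hcongr (hcongr s hs)

lemma eqOn_Icc_of_ae_Ioo {f g : ℝ → ℝ} {ℓ : ℝ} (hℓ : 0 < ℓ) (hf : ContinuousOn f (Icc 0 ℓ))
    (hg : ContinuousOn g (Icc 0 ℓ)) (h : ∀ᵐ s, s ∈ Ioo 0 ℓ → f s = g s) :
    EqOn f g (Icc 0 ℓ) := by
  refine Measure.eqOn_Icc_of_ae_eq volume hℓ.ne ?_ hf hg
  rw [← restrict_Ioo_eq_restrict_Icc]
  exact (ae_restrict_iff' measurableSet_Ioo).2 h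

namespace C1Spacetime

variable {n : ℕ} (M : C1Spacetime n)

lemma isUnit_det_g (z : SpacetimePt n) : IsUnit (Matrix.of (M.g z)).det := by
  obtain ⟨L, hL⟩ := M.g_lorentz z
  rw [isUnit_iff_ne_zero, Ne, ← Matrix.exists_mulVec_eq_zero_iff]
  rintro ⟨v, hv, h0⟩
  have hb : ∀ u, bilForm (M.g z) u v = 0 := fun u => by
    have h1 : ∀ i, ∑ j, M.g z i j * v j = 0 := fun i => by
      have := congrFun h0 i
      simpa [Matrix.mulVec, dotProduct] using this
    have : bilForm (M.g z) u v = ∑ i, u i * ∑ j, M.g z i j * v j := by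
      simp only [bilForm, Finset.mul_sum]
      exact Finset.sum_congr rfl fun i _ => Finset.sum_congr rfl fun j _ => by ring
    rw [this]
    simp [h1]
  refine hv ?_
  have hv' : v = L (L.symm v) := (L.apply_symm_apply v).symm
  set c := L.symm v
  have hc : c = ∑ j, c j • (Pi.single j 1 : Fin n → ℝ) := by
    ext k; simp [Finset.sum_apply, Pi.single_apply]
  have hcj : ∀ i, c i = 0 := fun i => by
    have h1 := hb (L (Pi.single i 1))
    rw [hv', hc, map_sum, bilForm_sum_right] at h1
    simp only [map_smul, bilForm_smul_right, hL] at h1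
    rw [Finset.sum_eq_single i] at h1
    · simp only [minkowskiMatrix, if_true] at h1
      split_ifs at h1 <;> linarith
    · intro j _ hj
      simp [minkowskiMatrix, hj.symm]
    · simp
  rw [hv', show c = 0 from funext hcj, map_zero]

lemma continuous_ginv {Y : Type*} [TopologicalSpace Y] {f : Y → SpacetimePt n}
    (hf : Continuous f) (k l : Fin n) : Continuous fun y => M.ginv (f y) k l := by
  have hg : Continuous fun y => Matrix.of (M.g (f y)) := M.continuous_g.comp hf
  simp only [ginv, Matrix.inv_def, Ring.inverse_eq_inv', Matrix.smul_apply, smul_eq_mul]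
  refine Continuous.mul (hg.matrix_det.inv₀ fun y => (M.isUnit_det_g (f y)).ne_zero) ?_
  exact hg.matrix_adjugate.matrix_elem k l

lemma ginv_mul (z : SpacetimePt n) : M.ginv z * Matrix.of (M.g z) = 1 :=
  Matrix.nonsing_inv_mul _ (M.isUnit_det_g z)

lemma mul_ginv (z : SpacetimePt n) : Matrix.of (M.g z) * M.ginv z = 1 :=
  Matrix.mul_nonsing_inv _ (M.isUnit_det_g z)

lemma fderiv_g_apply (z w : SpacetimePt n) (i j : Fin n) :
    fderiv ℝ (fun q => M.g q i j) z w = M.dg z w i j := by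
  have h := (M.g_contDiff.differentiable one_ne_zero).differentiableAt.hasFDerivAt (x := z)
  have h1 := hasFDerivAt_pi'.1 (hasFDerivAt_pi'.1 h i) j
  rw [h1.fderiv]
  rfl

lemma dg_eq_sum (z w : SpacetimePt n) (i j : Fin n) :
    M.dg z w i j = ∑ l, w l * M.dg z (Pi.single l 1) i j := by
  have h : w = ∑ l, w l • (Pi.single l 1 : Fin n → ℝ) := by
    ext k; simp [Finset.sum_apply, Pi.single_apply]
  conv_lhs => rw [h]
  simp only [dg, map_sum, map_smul, Finset.sum_apply, Pi.smul_apply, smul_eq_mul]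

/-- The geodesic spray. -/
def geoVec (z v : SpacetimePt n) : SpacetimePt n := fun k =>
  -∑ i, ∑ j, M.christoffel k i j z * v i * v j

lemma geoVec_smul (c : ℝ) (z v : SpacetimePt n) : M.geoVec z (c • v) = c ^ 2 • M.geoVec z v := by
  ext k
  simp only [geoVec, Pi.smul_apply, smul_eq_mul, mul_neg, Finset.mul_sum]
  congr 1
  exact Finset.sum_congr rfl fun i _ => Finset.sum_congr rfl fun j _ => by ring

lemma geoVec_eq (z v : SpacetimePt n) (k : Fin n) :
    M.geoVec z v k = ∑ l, M.ginv z k l *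
      (bilForm (M.dg z (Pi.single l 1)) v v / 2 - bilForm (M.dg z v) v (Pi.single l 1)) := by
  have h1 : ∀ l, bilForm (M.dg z v) v (Pi.single l 1) =
      ∑ i, ∑ j, M.dg z (Pi.single i 1) j l * v i * v j := fun l => by
    rw [bilForm_single_right, Finset.sum_comm]
    refine Finset.sum_congr rfl fun j _ => ?_
    rw [M.dg_eq_sum, Finset.sum_mul]
    exact Finset.sum_congr rfl fun i _ => by ring
  have h2 : ∀ l, bilForm (M.dg z v) v (Pi.single l 1) =
      ∑ i, ∑ j, M.dg z (Pi.single j 1) i l * v i * v j := fun l => by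
    rw [h1, Finset.sum_comm]
    exact Finset.sum_congr rfl fun j _ => Finset.sum_congr rfl fun i _ => by ring
  have h3 : ∀ l, bilForm (M.dg z (Pi.single l 1)) v v / 2 - bilForm (M.dg z v) v (Pi.single l 1) =
      -∑ i, ∑ j, (1 / 2) * (M.dg z (Pi.single i 1) j l + M.dg z (Pi.single j 1) i l -
        M.dg z (Pi.single l 1) i j) * v i * v j := fun l => by
    have h4 : ∑ i, ∑ j, (1 / 2) * (M.dg z (Pi.single i 1) j l + M.dg z (Pi.single j 1) i l -
        M.dg z (Pi.single l 1) i j) * v i * v j =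
        (1 / 2) * (∑ i, ∑ j, M.dg z (Pi.single i 1) j l * v i * v j +
          ∑ i, ∑ j, M.dg z (Pi.single j 1) i l * v i * v j -
          ∑ i, ∑ j, M.dg z (Pi.single l 1) i j * v i * v j) := by
      simp only [← Finset.sum_add_distrib, ← Finset.sum_sub_distrib, Finset.mul_sum]
      exact Finset.sum_congr rfl fun i _ => Finset.sum_congr rfl fun j _ => by ring
    rw [h4, ← h1, ← h2, bilForm]
    ring
  simp only [h3, geoVec, christoffel, fderiv_g_apply, mul_neg, Finset.sum_neg_distrib]
  congr 1
  simp only [Finset.mul_sum, Finset.sum_mul]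
  rw [Finset.sum_congr rfl fun i _ => Finset.sum_comm, Finset.sum_comm]
  exact Finset.sum_congr rfl fun l _ => Finset.sum_congr rfl fun i _ =>
    Finset.sum_congr rfl fun j _ => by ring

lemma continuous_geoVec {Y : Type*} [TopologicalSpace Y] {f u : Y → SpacetimePt n}
    (hf : Continuous f) (hu : Continuous u) : Continuous fun y => M.geoVec (f y) (u y) := by
  refine continuous_pi fun k => ?_
  have hc : ∀ i j, Continuous fun y => M.christoffel k i j (f y) := fun i j => by
    simp only [christoffel, fderiv_g_apply]
    refine continuous_const.mul (continuous_finsetSum _ fun l _ => (M.continuous_ginv hf k l).mul ?_)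
    have hd : ∀ a b c, Continuous fun y => M.dg (f y) (Pi.single a 1) b c := fun a b c =>
      (continuous_apply c).comp ((continuous_apply b).comp (M.continuous_dg hf continuous_const))
    exact ((hd _ _ _).add (hd _ _ _)).sub (hd _ _ _)
  exact (continuous_finsetSum _ fun i _ => continuous_finsetSum _ fun j _ =>
    ((hc i j).mul ((continuous_apply i).comp hu)).mul ((continuous_apply j).comp hu)).neg

end C1Spacetime

/-- The product of a continuous function and a differentiable function vanishing at the point. -/
lemma hasDerivWithinAt_mul_of_eq_zero {a r : ℝ → ℝ} {r' : ℝ} {S : Set ℝ} {s : ℝ}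
    (ha : Continuous a) (hr : HasDerivWithinAt r r' S s) (h0 : r s = 0) :
    HasDerivWithinAt (fun t => a t * r t) (a s * r') S s := by
  rw [hasDerivWithinAt_iff_tendsto_slope] at hr ⊢
  refine ((ha.tendsto s).mono_left nhdsWithin_le_nhds |>.mul hr).congr fun t => ?_
  simp only [slope_def_field, h0]
  ring

namespace C1Spacetime

variable {n : ℕ} {M : C1Spacetime n}

/-- The momentum of a maximizer satisfies the integrated Euler-Lagrange equation. -/
lemma MaxCurve.exists_momentum {α : ℝ → SpacetimePt n} {ℓ : ℝ} (hα : M.MaxCurve α ℓ)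
    {κ : ℝ} (hκ0 : 0 < κ) (hκ : ∀ᵐ s, s ∈ Ioo 0 ℓ → κ ≤ M.speed α s) (i : Fin n) :
    ∃ (q : ℝ → ℝ) (c B : ℝ), Measurable q ∧ (∀ s, |q s| ≤ B) ∧
      (∀ᵐ s, s ∈ Ioo 0 ℓ → q s =
        bilForm (M.dg (α s) (Pi.single i 1)) (deriv α s) (deriv α s) / (2 * M.speed α s)) ∧
      ∀ᵐ s, s ∈ Ioo 0 ℓ → bilForm (M.g (α s)) (deriv α s) (Pi.single i 1) / M.speed α s =
        c + ∫ u in (0:ℝ)..s, q u := by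
  set e : SpacetimePt n := Pi.single i 1 with he
  have hαc := hα.lip.continuous
  have hd1 : ∀ s, ‖deriv α s‖ ≤ 1 := fun s => norm_deriv_le_of_lipschitzWith hα.lip s
  have he1 : ‖e‖ ≤ 1 := by
    rw [he, Pi.norm_single]; simp
  have hαR : ∀ s, α s ∈ Metric.closedBall (0 : SpacetimePt n) (‖α 0‖ + ℓ) := fun s => by
    rw [mem_closedBall_zero_iff]; exact hα.toNCurve.norm_le s
  obtain ⟨G, hG, hGb⟩ := M.exists_bilForm_bound
    (isCompact_closedBall (0 : SpacetimePt n) (‖α 0‖ + ℓ))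
  obtain ⟨D, hD⟩ := (isCompact_closedBall (0 : SpacetimePt n) (‖α 0‖ + ℓ)).exists_bound_of_continuousOn
    (M.continuous_dg (u := fun _ => e) continuous_id continuous_const).continuousOn
  have hD0 : 0 ≤ D := (norm_nonneg _).trans (hD _ (hαR 0))
  set τ : ℝ → ℝ := fun s => M.speed α s ⊔ κ with hτ
  have hτm : Measurable τ := (measurable_speed hαc).max measurable_const
  have hτκ : ∀ s, κ ≤ τ s := fun s => le_max_right _ _
  have hτ0 : ∀ s, 0 < τ s := fun s => hκ0.trans_le (hτκ s)
  have hτe : ∀ᵐ s, s ∈ Ioo 0 ℓ → τ s = M.speed α s := by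
    filter_upwards [hκ] with s hs h
    exact max_eq_left (hs h)
  set N : ℝ → ℝ := fun s => bilForm (M.g (α s)) (deriv α s) e with hN
  set Q : ℝ → ℝ := fun s => bilForm (M.dg (α s) e) (deriv α s) (deriv α s) with hQ
  have hNm : Measurable N := by
    have h : Continuous fun x : SpacetimePt n × SpacetimePt n => bilForm (M.g x.1) x.2 e :=
      M.continuous_bilForm continuous_fst continuous_snd continuous_const
    have h3 := h.measurable.comp (hαc.measurable.prodMk (measurable_deriv α))
    simp only [hN]
    exact h3
  have hQm : Measurable Q := by
    have h : Continuous fun x : SpacetimePt n × SpacetimePt n => bilForm (M.dg x.1 e) x.2 x.2 := by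
      have h1 : ∀ a b, Continuous fun x : SpacetimePt n × SpacetimePt n => M.dg x.1 e a b :=
        fun a b => (continuous_apply b).comp ((continuous_apply a).comp
          (M.continuous_dg continuous_fst continuous_const))
      simp only [bilForm]
      exact continuous_finsetSum _ fun a _ => continuous_finsetSum _ fun b _ =>
        ((h1 a b).mul ((continuous_apply a).comp continuous_snd)).mul
          ((continuous_apply b).comp continuous_snd)
    have h3 := h.measurable.comp (hαc.measurable.prodMk (measurable_deriv α))
    simp only [hQ]
    exact h3
  have hNb : ∀ s, |N s| ≤ G := fun s => by
    refine ((hGb _ (hαR s)).2 _ _).trans ?_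
    calc G * ‖deriv α s‖ * ‖e‖ ≤ G * 1 * 1 := by gcongr; exact hd1 s
      _ = G := by ring
  have hQb : ∀ s, |Q s| ≤ n ^ 2 * D := fun s => by
    refine (abs_bilForm_le _ _ _).trans ?_
    calc (n:ℝ) ^ 2 * ‖M.dg (α s) e‖ * ‖deriv α s‖ * ‖deriv α s‖ ≤ n ^ 2 * D * 1 * 1 := by
          gcongr
          · exact hD _ (hαR s)
          · exact hd1 s
          · exact hd1 s
      _ = n ^ 2 * D := by ring
  set B : ℝ := (G / κ) ⊔ (n ^ 2 * D / (2 * κ)) with hB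
  set p : ℝ → ℝ := fun s => N s / τ s with hp
  set q : ℝ → ℝ := fun s => Q s / (2 * τ s) with hq
  have hpm : Measurable p := hNm.div hτm
  have hqm : Measurable q := hQm.div (measurable_const.mul hτm)
  have hpB : ∀ s, |p s| ≤ B := fun s => by
    refine le_trans ?_ (le_max_left _ _)
    rw [hp, abs_div, abs_of_pos (hτ0 s)]
    exact div_le_div₀ hG.le (hNb s) hκ0 (hτκ s)
  have hqB : ∀ s, |q s| ≤ B := fun s => by
    refine le_trans ?_ (le_max_right _ _)
    rw [hq, abs_div, abs_of_pos (mul_pos two_pos (hτ0 s))]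
    exact div_le_div₀ (by positivity) (hQb s) (by positivity) (by linarith [hτκ s])
  have key : ∀ (φ : ℝ → ℝ) (C : ℝ), Measurable φ → (∀ s, |φ s| ≤ C) → ∫ u in (0:ℝ)..ℓ, φ u = 0 →
      0 ≤ ∫ s in (0:ℝ)..ℓ, (p s * φ s + q s * ∫ u in (0:ℝ)..s, φ u) := by
    intro φ C hφ hC h0
    have h1 := hα.first_variation_nonpos hκ0 hκ (ψ := fun s => φ s • e) (B := ⟨|C|, abs_nonneg C⟩)
      (hφ.smul_const e) (fun s => by
        rw [norm_smul]
        calc ‖φ s‖ * ‖e‖ ≤ |C| * 1 := by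
              gcongr
              exact (hC s).trans (le_abs_self C)
          _ = |C| := mul_one _) (by
        rw [intervalIntegral.integral_smul_const, h0, zero_smul])
    have h2 : ∫ s in (0:ℝ)..ℓ, (p s * φ s + q s * ∫ u in (0:ℝ)..s, φ u) =
        -∫ s in (0:ℝ)..ℓ, -(2 * bilForm (M.g (α s)) (deriv α s) (φ s • e) +
          bilForm (M.dg (α s) (∫ u in (0:ℝ)..s, φ u • e)) (deriv α s) (deriv α s)) /
            (2 * M.speed α s) := by
      rw [← intervalIntegral.integral_neg]
      refine intervalIntegral.integral_congr_ae ?_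
      filter_upwards [hτe, Measure.ae_ne volume ℓ] with s hs hne hs'
      rw [uIoc_of_le hα.pos.le] at hs'
      rw [← hs ⟨hs'.1, lt_of_le_of_ne hs'.2 hne⟩, intervalIntegral.integral_smul_const, dg_smul,
        bilForm_smul_form, bilForm_smul_right]
      have := (hτ0 s).ne'
      simp only [hp, hq, hN, hQ]
      field_simp
    rw [h2]
    linarith
  obtain ⟨c, hc⟩ := exists_ae_eq_const_add_integral hα.pos hpm hqm hpB hqB (by
    intro φ C hφ hC h0
    refine le_antisymm ?_ (key φ C hφ hC h0)
    have h1 := key (fun s => -φ s) C hφ.neg (fun s => by rw [abs_neg]; exact hC s)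
      (by rw [intervalIntegral.integral_neg, h0, neg_zero])
    have h2 : ∫ s in (0:ℝ)..ℓ, (p s * -φ s + q s * ∫ u in (0:ℝ)..s, -φ u) =
        -∫ s in (0:ℝ)..ℓ, (p s * φ s + q s * ∫ u in (0:ℝ)..s, φ u) := by
      rw [← intervalIntegral.integral_neg]
      refine intervalIntegral.integral_congr fun s _ => ?_
      simp only [intervalIntegral.integral_neg]
      ring
    linarith)
  refine ⟨q, c, B, hqm, hqB, ?_, ?_⟩
  · filter_upwards [hτe] with s hs h
    rw [← hs h]
  · filter_upwards [hτe, hc] with s hs hc h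
    rw [← hs h]
    exact hc h

/-- A maximizer of positive length carries a parallel causal velocity field solving the geodesic
equation in an arc length parametrization. -/
theorem MaxCurve.exists_geodesic_field {α : ℝ → SpacetimePt n} {ℓ : ℝ} (hα : M.MaxCurve α ℓ)
    (hpos : 0 < M.gLength α 0 ℓ) :
    ∃ V : ℝ → SpacetimePt n, euclNorm (V 0) = 1 ∧ ∀ s ∈ Icc 0 ℓ,
      HasDerivWithinAt α ((euclNorm (V s))⁻¹ • V s) (Icc 0 ℓ) s ∧
      HasDerivWithinAt V ((euclNorm (V s))⁻¹ • M.geoVec (α s) (V s)) (Icc 0 ℓ) s ∧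
      M.CausalVec (α s) (V s) ∧ M.FdVec (α s) (V s) := by
  obtain ⟨κ, hκ0, hκ⟩ := hα.exists_speed_lower_bound hpos
  choose q c B hqm hqB hqe hqp using hα.exists_momentum hκ0 hκ
  have hαc := hα.lip.continuous
  have hqi : ∀ i a b, IntervalIntegrable (q i) volume a b := fun i a b =>
    .of_measurable_of_bound (hqm i).aestronglyMeasurable (hqB i)
  set P : ℝ → SpacetimePt n := fun s i => c i + ∫ u in (0:ℝ)..s, q i u with hP
  have hPc : ∀ i, Continuous fun s => P s i := fun i =>
    continuous_const.add (intervalIntegral.continuous_primitive (hqi i) 0)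
  set W : ℝ → SpacetimePt n := fun s => (M.ginv (α s)).mulVec (P s) with hW
  have hWc : Continuous W := continuous_pi fun k => by
    simp only [hW, Matrix.mulVec, dotProduct]
    exact continuous_finsetSum _ fun l _ => (M.continuous_ginv hαc k l).mul (hPc l)
  have hPW : ∀ s l, P s l = bilForm (M.g (α s)) (W s) (Pi.single l 1) := fun s l => by
    have h1 : (Matrix.of (M.g (α s))).mulVec (W s) = P s := by
      rw [hW, Matrix.mulVec_mulVec, M.mul_ginv, Matrix.one_mulVec]
    rw [← h1, bilForm_single_right]
    simp only [Matrix.mulVec, dotProduct, Matrix.of_apply]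
    exact Finset.sum_congr rfl fun j _ => by rw [M.g_symm]
  have hWP : ∀ (z v : SpacetimePt n),
      (M.ginv z).mulVec (fun l => bilForm (M.g z) v (Pi.single l 1)) = v := fun z v => by
    have h1 : (fun l => bilForm (M.g z) v (Pi.single l 1)) = (Matrix.of (M.g z)).mulVec v := by
      funext l
      rw [bilForm_single_right]
      simp only [Matrix.mulVec, dotProduct, Matrix.of_apply]
      exact Finset.sum_congr rfl fun j _ => by rw [M.g_symm]
    rw [h1, Matrix.mulVec_mulVec, M.ginv_mul, Matrix.one_mulVec]
  have hWae : ∀ᵐ s, s ∈ Ioo 0 ℓ → 0 < M.speed α s ∧ W s = (M.speed α s)⁻¹ • deriv α s := by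
    filter_upwards [ae_all_iff.2 hqp, hκ] with s hs hk hs'
    refine ⟨hκ0.trans_le (hk hs'), ?_⟩
    rw [← hWP (α s) ((M.speed α s)⁻¹ • deriv α s)]
    simp only [hW]
    congr 1
    funext l
    rw [bilForm_smul_left, ← div_eq_inv_mul, hs l hs']
  have hWW : ∀ s ∈ Icc 0 ℓ, bilForm (M.g (α s)) (W s) (W s) = -1 := by
    refine eqOn_Icc_of_ae_Ioo hα.pos (M.continuous_bilForm hαc hWc hWc).continuousOn
      continuousOn_const ?_
    filter_upwards [hWae, hα.ae] with s hs hs2 hs'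
    have h1 := M.speed_sq (hs2 hs').2.1
    have h2 := (hs hs').1.ne'
    rw [(hs hs').2, bilForm_smul_left, bilForm_smul_right, ← neg_eq_iff_eq_neg.2 h1]
    field_simp
  have hWC : ∀ s ∈ Icc 0 ℓ, M.CausalVec (α s) (W s) := fun s hs => by
    refine ⟨fun h => ?_, by rw [hWW s hs]; norm_num⟩
    have := hWW s hs
    rw [h, bilForm_zero_left] at this
    norm_num at this
  have hX := M.continuous_bilForm hαc hWc (M.X0_cont.comp hαc)
  have hWF : ∀ s ∈ Icc 0 ℓ, M.FdVec (α s) (W s) := fun s hs => by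
    refine lt_of_le_of_ne ?_ (M.bilForm_X0_ne_zero (hWC s hs))
    have h1 : (fun s => bilForm (M.g (α s)) (W s) (M.X0 (α s)) ⊔ 0) s = 0 := by
      refine eqOn_Icc_of_ae_Ioo (g := fun _ => 0) hα.pos (hX.sup continuous_const).continuousOn
        continuousOn_const ?_ hs
      filter_upwards [hWae, hα.ae] with s hs hs2 hs'
      rw [(hs hs').2, bilForm_smul_left]
      refine sup_eq_right.2 (mul_nonpos_of_nonneg_of_nonpos (inv_nonneg.2 (hs hs').1.le) ?_)
      exact (hs2 hs').2.2.1.le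
    exact sup_eq_right.1 h1
  have hN0 : ∀ s ∈ Icc 0 ℓ, 0 < euclNorm (W s) := fun s hs => euclNorm_pos (hWC s hs).1
  have hNc : ContinuousOn (fun s => (euclNorm (W s))⁻¹) (Icc 0 ℓ) :=
    (continuous_euclNorm.comp hWc).continuousOn.inv₀ fun s hs => (hN0 s hs).ne'
  have hNae : ∀ᵐ s, s ∈ Ioo 0 ℓ → (euclNorm (W s))⁻¹ = M.speed α s := by
    filter_upwards [hWae, hα.ae] with s hs hs2 hs'
    rw [(hs hs').2, euclNorm_smul, (hs2 hs').2.2.2, mul_one, abs_inv, inv_inv,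
      abs_of_pos (hs hs').1]
  have hα' : ∀ s ∈ Icc 0 ℓ, HasDerivWithinAt α ((euclNorm (W s))⁻¹ • W s) (Icc 0 ℓ) s := by
    refine hasDerivWithinAt_of_integral (h := deriv α) hα.pos (fun s _ => ?_)
      (hNc.smul hWc.continuousOn) ?_
    · rw [hα.lip.integral_deriv_eq_sub_pi]; abel
    · filter_upwards [hWae, hNae] with s hs hs2 hs'
      rw [hs2 hs', (hs hs').2, smul_smul, mul_inv_cancel₀ (hs hs').1.ne', one_smul]
  have hdgc : ∀ l, Continuous fun s => bilForm (M.dg (α s) (Pi.single l 1)) (W s) (W s) := by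
    intro l
    have h1 : ∀ a b, Continuous fun s => M.dg (α s) (Pi.single l 1) a b :=
      fun a b => (continuous_apply b).comp ((continuous_apply a).comp
        (M.continuous_dg hαc continuous_const))
    simp only [bilForm]
    exact continuous_finsetSum _ fun a _ => continuous_finsetSum _ fun b _ =>
      ((h1 a b).mul ((continuous_apply a).comp hWc)).mul ((continuous_apply b).comp hWc)
  have hP' : ∀ l, ∀ s ∈ Icc 0 ℓ, HasDerivWithinAt (fun s => P s l)
      ((euclNorm (W s))⁻¹ * (bilForm (M.dg (α s) (Pi.single l 1)) (W s) (W s) / 2))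
      (Icc 0 ℓ) s := by
    intro l
    refine hasDerivWithinAt_of_integral (h := q l) hα.pos (fun s _ => ?_)
      (hNc.mul ((hdgc l).div_const 2).continuousOn) ?_
    · simp [hP]
    · filter_upwards [hWae, hNae, hqe l] with s hs hs2 hs3 hs'
      have := (hs hs').1.ne'
      rw [hs3 hs', hs2 hs', (hs hs').2, bilForm_smul_left, bilForm_smul_right]
      field_simp
  have hW' : ∀ s ∈ Icc 0 ℓ,
      HasDerivWithinAt W ((euclNorm (W s))⁻¹ • M.geoVec (α s) (W s)) (Icc 0 ℓ) s := by
    intro s hs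
    set R : Fin n → ℝ → ℝ := fun l t =>
      P t l - bilForm (M.g (α t)) (W s) (Pi.single l 1) with hR
    have hR' : ∀ l, HasDerivWithinAt (R l) ((euclNorm (W s))⁻¹ *
        (bilForm (M.dg (α s) (Pi.single l 1)) (W s) (W s) / 2 -
          bilForm (M.dg (α s) (W s)) (W s) (Pi.single l 1))) (Icc 0 ℓ) s := fun l => by
      have h1 := (M.hasDerivWithinAt_g (hα' s hs)).bilForm
        (hasDerivWithinAt_const s (Icc 0 ℓ) (W s))
        (hasDerivWithinAt_const s (Icc 0 ℓ) (Pi.single l 1 : SpacetimePt n))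
      refine ((hP' l s hs).sub h1).congr_deriv ?_
      rw [bilForm_zero_left, bilForm_zero_right, dg_smul, bilForm_smul_form]
      ring
    have hR0 : ∀ l, R l s = 0 := fun l => sub_eq_zero.2 (hPW s l)
    have hWR : ∀ t k, W t k = W s k + ∑ l, M.ginv (α t) k l * R l t := fun t k => by
      have h1 := congrFun (hWP (α t) (W s)) k
      simp only [Matrix.mulVec, dotProduct] at h1
      conv_rhs => rw [← h1]
      simp only [hR, hW, Matrix.mulVec, dotProduct, mul_sub, Finset.sum_sub_distrib]
      ring
    rw [hasDerivWithinAt_pi]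
    intro k
    have h2 : HasDerivWithinAt (fun t => W s k + ∑ l, M.ginv (α t) k l * R l t)
        (∑ l, M.ginv (α s) k l * ((euclNorm (W s))⁻¹ *
        (bilForm (M.dg (α s) (Pi.single l 1)) (W s) (W s) / 2 -
          bilForm (M.dg (α s) (W s)) (W s) (Pi.single l 1)))) (Icc 0 ℓ) s :=
      (HasDerivWithinAt.fun_sum fun l _ => hasDerivWithinAt_mul_of_eq_zero
        (M.continuous_ginv hαc k l) (hR' l) (hR0 l)).const_add _
    have h3 : (fun t => W t k) = fun t => W s k + ∑ l, M.ginv (α t) k l * R l t :=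
      funext fun t => hWR t k
    rw [h3]
    refine h2.congr_deriv ?_
    rw [Pi.smul_apply, geoVec_eq, smul_eq_mul, Finset.mul_sum]
    exact Finset.sum_congr rfl fun l _ => by ring
  have hz : (0:ℝ) ∈ Icc 0 ℓ := left_mem_Icc.2 hα.pos.le
  set a := (euclNorm (W 0))⁻¹ with ha
  have ha0 : 0 < a := inv_pos.2 (hN0 0 hz)
  have hnorm : ∀ s, euclNorm (a • W s) = a * euclNorm (W s) := fun s => by
    rw [euclNorm_smul, abs_of_pos ha0]
  refine ⟨fun s => a • W s, ?_, fun s hs => ⟨?_, ?_, ?_, ?_⟩⟩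
  · rw [hnorm, ha, inv_mul_cancel₀ (hN0 0 hz).ne']
  · refine (hα' s hs).congr_deriv ?_
    rw [hnorm, smul_smul]
    congr 1
    have := (hN0 s hs).ne'
    field_simp
  · refine ((hW' s hs).const_smul a).congr_deriv ?_
    rw [hnorm, geoVec_smul, smul_smul, smul_smul]
    congr 1
    have := (hN0 s hs).ne'
    field_simp
  · exact (hWC s hs).smul ha0
  · exact (hWF s hs).smul ha0

end C1Spacetime

/-- A pointwise limit, along an arbitrary filter, of solutions of an autonomous differential
equation with continuous right hand side which stay in a compact set is a solution. -/
lemma hasDerivWithinAt_of_tendsto_solutions {E ι : Type*} [NormedAddCommGroup E] [NormedSpace ℝ E]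
    {l : Filter ι} [l.NeBot] {F : E → E} {K : Set E} (hK : IsCompact K) (hF : ContinuousOn F K)
    {y : ι → ℝ → E} {y' : ℝ → E} {T : ℝ}
    (hy : ∀ᶠ k in l, ∀ s ∈ Icc 0 T, y k s ∈ K ∧ HasDerivWithinAt (y k) (F (y k s)) (Icc 0 T) s)
    (hlim : ∀ s ∈ Icc 0 T, Tendsto (fun k => y k s) l (𝓝 (y' s))) :
    ∀ s ∈ Icc 0 T, y' s ∈ K ∧ HasDerivWithinAt y' (F (y' s)) (Icc 0 T) s := by
  have hmem : ∀ s ∈ Icc 0 T, y' s ∈ K := fun s hs =>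
    hK.isClosed.mem_of_tendsto (hlim s hs) (hy.mono fun k hk => (hk s hs).1)
  intro s hs
  refine ⟨hmem s hs, ?_⟩
  obtain ⟨C, hC⟩ := hK.exists_bound_of_continuousOn hF
  have hC0 : 0 ≤ C := (norm_nonneg _).trans (hC _ (hmem s hs))
  have huc := Metric.uniformContinuousOn_iff.1 (hK.uniformContinuousOn_of_continuous hF)
  rw [hasDerivWithinAt_iff_isLittleO, Asymptotics.isLittleO_iff]
  intro ε hε
  obtain ⟨δ, hδ, hFδ⟩ := huc ε hε
  have hev : ∀ᶠ t in 𝓝[Icc 0 T] s, t ∈ Icc 0 T ∧ C * |t - s| < δ := by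
    refine eventually_mem_nhdsWithin.and (Filter.Tendsto.eventually_lt_const hδ ?_)
    have : Continuous fun t => C * |t - s| := by fun_prop
    simpa using (this.tendsto s).mono_left nhdsWithin_le_nhds
  filter_upwards [hev] with t ht
  have hsub : uIcc s t ⊆ Icc 0 T := ordConnected_Icc.uIcc_subset hs ht.1
  have hFlim : Tendsto (fun k => F (y k s)) l (𝓝 (F (y' s))) := by
    refine ((hF (y' s) (hmem s hs)).tendsto).comp (tendsto_nhdsWithin_iff.2 ⟨hlim s hs, ?_⟩)
    exact hy.mono fun k hk => (hk s hs).1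
  refine le_of_tendsto (((hlim t ht.1).sub (hlim s hs)).sub (hFlim.const_smul (t - s))).norm ?_
  filter_upwards [hy] with k hk
  have hlip : ∀ u ∈ uIcc s t, ‖y k u - y k s‖ ≤ C * ‖u - s‖ := fun u hu =>
    (convex_Icc 0 T).norm_image_sub_le_of_norm_hasDerivWithin_le (fun x hx => (hk x hx).2)
      (fun x hx => hC _ (hk x hx).1) hs (hsub hu)
  have h1 := (convex_uIcc s t).norm_image_sub_le_of_norm_hasDerivWithin_le
    (f := fun u => y k u - u • F (y k s)) (f' := fun u => F (y k u) - (1:ℝ) • F (y k s)) (C := ε)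
    (x := s) (y := t)
    (fun u hu => ((hk u (hsub hu)).2.mono hsub).sub
      ((hasDerivWithinAt_id u _).smul_const (F (y k s))))
    (fun u hu => ?_) left_mem_uIcc right_mem_uIcc
  · refine le_trans (le_of_eq ?_) h1
    congr 1
    rw [sub_smul]
    abel
  · rw [one_smul, ← dist_eq_norm]
    refine (hFδ _ (hk u (hsub hu)).1 _ (hk s hs).1 ?_).le
    rw [dist_eq_norm]
    refine (hlip u hu).trans_lt (lt_of_le_of_lt ?_ ht.2)
    gcongr
    exact abs_sub_left_of_mem_uIcc hu

/-- Two-sided exponential bounds for a solution of a linearly bounded differential inequality. -/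
lemma norm_bounds_of_norm_deriv_le {E : Type*} [NormedAddCommGroup E] [NormedSpace ℝ E]
    {V V' : ℝ → E} {C T : ℝ} (hV : ∀ s ∈ Icc 0 T, HasDerivWithinAt V (V' s) (Icc 0 T) s)
    (hC : ∀ s ∈ Icc 0 T, ‖V' s‖ ≤ C * ‖V s‖) (hC0 : 0 ≤ C) :
    ∀ s ∈ Icc 0 T, ‖V s‖ ≤ ‖V 0‖ * Real.exp (C * T) ∧ ‖V 0‖ ≤ ‖V s‖ * Real.exp (C * T) := by
  intro s hs
  have hcont : ContinuousOn V (Icc 0 T) := fun t ht => (hV t ht).continuousWithinAt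
  constructor
  · have h := norm_le_gronwallBound_of_norm_deriv_right_le (f := V) (f' := V') (δ := ‖V 0‖)
      (K := C) (ε := 0) hcont (fun x hx => (hV x ⟨hx.1, hx.2.le⟩).mono_of_mem_nhdsWithin
        (mem_of_superset (Icc_mem_nhdsGE hx.2) (Icc_subset_Icc_left hx.1))) le_rfl
      (fun x hx => by rw [add_zero]; exact hC x ⟨hx.1, hx.2.le⟩) s hs
    rw [gronwallBound_ε0, sub_zero] at h
    refine h.trans ?_
    gcongr
    exact hs.2
  · have hmaps : ∀ u ∈ Icc 0 s, s - u ∈ Icc 0 T := fun u hu =>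
      ⟨by linarith [hu.2], by linarith [hu.1, hs.2]⟩
    have hW : ∀ u ∈ Icc 0 s, HasDerivWithinAt (fun u => V (s - u)) (-V' (s - u)) (Icc 0 s) u :=
      fun u hu => by
        have := (hV (s - u) (hmaps u hu)).scomp u (((hasDerivWithinAt_id u (Icc 0 s)).const_sub s))
          hmaps
        simpa [Function.comp_def] using this
    have h := norm_le_gronwallBound_of_norm_deriv_right_le (f := fun u => V (s - u))
      (f' := fun u => -V' (s - u)) (δ := ‖V s‖)
      (K := C) (ε := 0) (a := 0) (b := s) (fun u hu => (hW u hu).continuousWithinAt)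
      (fun x hx => (hW x ⟨hx.1, hx.2.le⟩).mono_of_mem_nhdsWithin
        (mem_of_superset (Icc_mem_nhdsGE hx.2) (Icc_subset_Icc_left hx.1))) (by simp)
      (fun x hx => by rw [add_zero, norm_neg]; exact hC _ (hmaps x ⟨hx.1, hx.2.le⟩)) s
        ⟨hs.1, le_rfl⟩
    rw [gronwallBound_ε0, sub_zero, sub_self] at h
    refine h.trans ?_
    gcongr
    exact hs.2

namespace C1Spacetime

variable {n : ℕ} {M : C1Spacetime n}

lemma exists_geoVec_bound (M : C1Spacetime n) {K : Set (SpacetimePt n)} (hK : IsCompact K) :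
    ∃ C ≥ 0, ∀ z ∈ K, ∀ v, ‖M.geoVec z v‖ ≤ C * ‖v‖ ^ 2 := by
  obtain ⟨C, hC⟩ := (hK.prod (isCompact_closedBall (0 : SpacetimePt n) 1)).exists_bound_of_continuousOn
    (M.continuous_geoVec continuous_fst continuous_snd).continuousOn
  refine ⟨|C|, abs_nonneg C, fun z hz v => ?_⟩
  by_cases hv : v = 0
  · subst hv
    have : M.geoVec z 0 = 0 := by ext k; simp [geoVec]
    simp [this]
  have hv' : ‖v‖ ≠ 0 := norm_ne_zero_iff.2 hv
  have h1 : v = ‖v‖ • (‖v‖⁻¹ • v) := by rw [smul_smul, mul_inv_cancel₀ hv', one_smul]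
  have h2 := hC (z, ‖v‖⁻¹ • v) ⟨hz, by
    rw [mem_closedBall_zero_iff, norm_smul, norm_inv, norm_norm, inv_mul_cancel₀ hv']⟩
  conv_lhs => rw [h1]
  rw [geoVec_smul, norm_smul, norm_pow, norm_norm, mul_comm]
  gcongr
  exact h2.trans (le_abs_self C)

/-- `V` is the velocity direction of the geodesic with arc length parametrization `α`. -/
def GeodesicField (M : C1Spacetime n) (α V : ℝ → SpacetimePt n) (I : Set ℝ) : Prop :=
  ∀ s ∈ I, HasDerivWithinAt α ((euclNorm (V s))⁻¹ • V s) I s ∧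
    HasDerivWithinAt V ((euclNorm (V s))⁻¹ • M.geoVec (α s) (V s)) I s ∧
    M.CausalVec (α s) (V s) ∧ M.FdVec (α s) (V s)

/-- Limits of longer and longer geodesics are geodesics. -/
theorem exists_limit_geodesicField (U : Ultrafilter ℕ) {γ V : ℕ → ℝ → SpacetimePt n} {ℓ : ℕ → ℝ}
    {R : ℝ} (hγ : ∀ k, LipschitzWith 1 (γ k)) (hR : ∀ k, ‖γ k 0‖ ≤ R)
    (hV : ∀ k, M.GeodesicField (γ k) (V k) (Icc 0 (ℓ k))) (hV0 : ∀ k, euclNorm (V k 0) = 1)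
    (hℓ : ∀ s, ∀ᶠ k in (U : Filter ℕ), s < ℓ k) :
    ∃ γ' V' : ℝ → SpacetimePt n, (∀ s, Tendsto (fun k => γ k s) U (𝓝 (γ' s))) ∧
      M.GeodesicField γ' V' (Ici 0) := by
  obtain ⟨γ', -, hlim, -⟩ := exists_ultralimit (M := M) U hγ hR
  have hγR : ∀ T, ∀ k, ∀ s ∈ Icc 0 T, γ k s ∈ Metric.closedBall (0 : SpacetimePt n) (R + T) := by
    intro T k s hs
    rw [mem_closedBall_zero_iff]
    have h1 := (hγ k).norm_sub_le s 0
    have h3 := norm_le_norm_add_norm_sub' (γ k s) (γ k 0)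
    rw [NNReal.coe_one, one_mul, sub_zero, Real.norm_of_nonneg hs.1] at h1
    linarith [hR k, hs.2]
  have hbounds : ∀ T, ∃ a > 0, ∃ b, ∀ᶠ k in (U : Filter ℕ), ∀ s ∈ Icc 0 T,
      a ≤ ‖V k s‖ ∧ ‖V k s‖ ≤ b ∧ Icc 0 T ⊆ Icc 0 (ℓ k) := by
    intro T
    obtain ⟨C, hC0, hC⟩ := M.exists_geoVec_bound (isCompact_closedBall (0 : SpacetimePt n) (R + T))
    refine ⟨1 / (n + 1 : ℝ) / Real.exp (C * T), by positivity, Real.exp (C * T), ?_⟩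
    filter_upwards [hℓ T] with k hk
    have hsub : Icc 0 T ⊆ Icc 0 (ℓ k) := Icc_subset_Icc_right hk.le
    intro s hs
    have h := norm_bounds_of_norm_deriv_le (V := V k)
      (V' := fun s => (euclNorm (V k s))⁻¹ • M.geoVec (γ k s) (V k s)) (C := C) (T := T)
      (fun s hs => ((hV k s (hsub hs)).2.1.mono hsub)) (fun s hs => by
        have hne : 0 < ‖V k s‖ := norm_pos_iff.2 (hV k s (hsub hs)).2.2.1.1
        have h1 := hC _ (hγR T k s hs) (V k s)
        have h2 := norm_le_euclNorm (V k s)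
        rw [norm_smul, norm_inv, Real.norm_of_nonneg (euclNorm_nonneg _)]
        rw [inv_mul_le_iff₀ (hne.trans_le h2)]
        refine h1.trans ?_
        calc C * ‖V k s‖ ^ 2 = ‖V k s‖ * (C * ‖V k s‖) := by ring
          _ ≤ _ := by gcongr) hC0 s hs
    have hle := norm_le_one_of_euclNorm_eq_one (hV0 k)
    refine ⟨?_, h.1.trans ?_, hsub⟩
    · rw [div_le_iff₀ (Real.exp_pos _)]
      exact (one_div_le_norm_of_euclNorm_eq_one (hV0 k)).trans h.2
    · exact mul_le_of_le_one_left (Real.exp_pos _).le hle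
  have hVlim : ∀ s, ∃ v, 0 ≤ s → Tendsto (fun k => V k s) U (𝓝 v) := fun s => by
    by_cases hs : 0 ≤ s
    · obtain ⟨a, -, b, hab⟩ := hbounds s
      obtain ⟨v, -, hv⟩ := U.exists_tendsto_of_isCompact (f := fun k => V k s)
        (isCompact_closedBall (0 : SpacetimePt n) b) (hab.mono fun k hk => by
          rw [mem_closedBall_zero_iff]; exact (hk s ⟨hs, le_rfl⟩).2.1)
      exact ⟨v, fun _ => hv⟩
    · exact ⟨0, fun h => absurd h hs⟩
  choose V' hV' using hVlim
  refine ⟨γ', V', hlim, fun s hs => ?_⟩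
  have hs0 : (0:ℝ) ≤ s := hs
  obtain ⟨a, ha, b, hab⟩ := hbounds (s + 1)
  set K : Set (SpacetimePt n × SpacetimePt n) :=
    Metric.closedBall 0 (R + (s + 1)) ×ˢ (Metric.closedBall 0 b ∩ {v | a ≤ ‖v‖}) with hKdef
  have hK : IsCompact K := (isCompact_closedBall _ _).prod
    ((isCompact_closedBall _ _).inter_right (isClosed_le continuous_const continuous_norm))
  have hne : ∀ x ∈ K, euclNorm x.2 ≠ 0 := fun x hx =>
    ((ha.trans_le hx.2.2).trans_le (norm_le_euclNorm _)).ne'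
  set F : SpacetimePt n × SpacetimePt n → SpacetimePt n × SpacetimePt n := fun x =>
    ((euclNorm x.2)⁻¹ • x.2, (euclNorm x.2)⁻¹ • M.geoVec x.1 x.2) with hFdef
  have hF : ContinuousOn F K := by
    have h1 : ContinuousOn (fun x : SpacetimePt n × SpacetimePt n => (euclNorm x.2)⁻¹) K :=
      (continuous_euclNorm.comp continuous_snd).continuousOn.inv₀ hne
    exact (h1.smul continuous_snd.continuousOn).prodMk
      (h1.smul (M.continuous_geoVec continuous_fst continuous_snd).continuousOn)
  have hsT : s ∈ Icc 0 (s + 1) := ⟨hs0, by linarith⟩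
  have hmain := hasDerivWithinAt_of_tendsto_solutions (l := (U : Filter ℕ)) hK hF (T := s + 1)
    (y := fun k t => (γ k t, V k t)) (y' := fun t => (γ' t, V' t)) (by
      filter_upwards [hab] with k hk t ht
      obtain ⟨h1, h2, h3⟩ := hk t ht
      obtain ⟨h4, h5, -⟩ := hV k t (h3 ht)
      exact ⟨⟨hγR _ k t ht, by rw [mem_closedBall_zero_iff]; exact h2, h1⟩,
        (h4.mono h3).prodMk (h5.mono h3)⟩)
    (fun t ht => (hlim t).prodMk_nhds (hV' t ht.1)) s hsT
  have hnhds : Icc 0 (s + 1) ∈ 𝓝[Ici 0] s := by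
    rw [← Ici_inter_Iic]
    exact inter_mem self_mem_nhdsWithin (mem_nhdsWithin_of_mem_nhds (Iic_mem_nhds (by linarith)))
  have hd := hmain.2.mono_of_mem_nhdsWithin hnhds
  have hb := fun (w : SpacetimePt n × SpacetimePt n → SpacetimePt n) (hw : Continuous w) =>
    ((M.continuous_bilForm (f := Prod.fst) (u := Prod.snd) continuous_fst continuous_snd hw).tendsto
      (γ' s, V' s)).comp ((hlim s).prodMk_nhds (hV' s hs0))
  have hev : ∀ᶠ k in (U : Filter ℕ), M.CausalVec (γ k s) (V k s) ∧ M.FdVec (γ k s) (V k s) :=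
    hab.mono fun k hk => (hV k s ((hk s hsT).2.2 hsT)).2.2
  have hc : M.CausalVec (γ' s) (V' s) := by
    refine ⟨norm_pos_iff.1 (ha.trans_le hmain.1.2.2), ?_⟩
    exact le_of_tendsto (hb Prod.snd continuous_snd) (hev.mono fun k hk => hk.1.2)
  refine ⟨hd.fst, hd.snd, hc, lt_of_le_of_ne ?_ (M.bilForm_X0_ne_zero hc)⟩
  exact le_of_tendsto (hb (M.X0 ∘ Prod.fst) (M.X0_cont.comp continuous_fst))
    (hev.mono fun k hk => hk.2.le)

end C1Spacetime

namespace C1Spacetime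

variable {n : ℕ} {M : C1Spacetime n}

lemma isFdCausalGeodesicOn_of_hasDerivWithinAt {σ w : ℝ → SpacetimePt n} {I : Set ℝ}
    (hI : UniqueDiffOn ℝ I) (hσ : ∀ t ∈ I, HasDerivWithinAt σ (w t) I t)
    (hw : ∀ t ∈ I, HasDerivWithinAt w (M.geoVec (σ t) (w t)) I t)
    (hc : ∀ t ∈ I, M.CausalVec (σ t) (w t) ∧ M.FdVec (σ t) (w t)) :
    M.IsFdCausalGeodesicOn σ I := by
  have hσ' : ∀ t ∈ I, derivWithin σ I t = w t := fun t ht => (hσ t ht).derivWithin (hI t ht)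
  have hw' : ∀ t ∈ I, derivWithin w I t = M.geoVec (σ t) (w t) := fun t ht =>
    (hw t ht).derivWithin (hI t ht)
  have hσc : ContinuousOn σ I := fun t ht => (hσ t ht).continuousWithinAt
  have hwc : ContinuousOn w I := fun t ht => (hw t ht).continuousWithinAt
  have hw1 : ContDiffOn ℝ 1 w I := by
    rw [show (1 : WithTop ℕ∞) = 0 + 1 by rfl, contDiffOn_succ_iff_derivWithin hI]
    refine ⟨fun t ht => (hw t ht).differentiableWithinAt, by simp, ?_⟩
    rw [contDiffOn_zero]
    have h := (M.continuous_geoVec continuous_fst continuous_snd).comp_continuousOn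
      (hσc.prodMk hwc)
    exact h.congr hw'
  refine ⟨⟨?_, fun t ht k => ?_⟩, fun t ht => by rw [hσ' t ht]; exact hc t ht⟩
  · rw [show (2 : WithTop ℕ∞) = 1 + 1 by rfl, contDiffOn_succ_iff_derivWithin hI]
    refine ⟨fun t ht => (hσ t ht).differentiableWithinAt, by simp, hw1.congr hσ'⟩
  · have h1 : derivWithin (fun s => derivWithin σ I s k) I t = M.geoVec (σ t) (w t) k := by
      have h2 : HasDerivWithinAt (fun s => w s k) (M.geoVec (σ t) (w t) k) I t :=
        hasDerivWithinAt_pi.1 (hw t ht) k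
      exact (h2.congr (fun s hs => by rw [hσ' s hs]) (by rw [hσ' t ht])).derivWithin (hI t ht)
    rw [h1, hσ' t ht, geoVec]
    ring

/-- Along an inextendible geodesic in arc length parametrization, Condition A makes the distance
tend to infinity. -/
theorem ConditionA.tendsto_ldist (hA : M.ConditionA) {x : SpacetimePt n}
    {γ V : ℝ → SpacetimePt n} (hx : M.chron x (γ 0)) (hF : M.GeodesicField γ V (Ici 0))
    (hlim : ¬ ∃ z, Tendsto γ atTop (𝓝 z)) :
    Tendsto (fun s => M.ldist x (γ s)) atTop (𝓝 ⊤) := by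
  set N : ℝ → ℝ := fun s => euclNorm (V (max s 0)) with hN
  have hVc : ContinuousOn V (Ici 0) := fun s hs => (hF s hs).2.1.continuousWithinAt
  have hNc : Continuous N := continuous_euclNorm.comp
    (hVc.comp_continuous (continuous_id.max continuous_const) fun s => le_max_right s 0)
  have hN0 : ∀ s, 0 < N s := fun s => euclNorm_pos (hF _ (le_max_right s 0)).2.2.1.1
  have hNe : ∀ s, 0 ≤ s → N s = euclNorm (V s) := fun s hs => by rw [hN]; simp only [max_eq_left hs]
  set r : ℝ → ℝ := fun s => ∫ u in (0:ℝ)..s, (N u)⁻¹ with hr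
  have hic : Continuous fun s => (N s)⁻¹ := hNc.inv₀ fun s => (hN0 s).ne'
  have hr' : ∀ s, HasStrictDerivAt r (N s)⁻¹ s := fun s =>
    intervalIntegral.integral_hasStrictDerivAt_right (hic.intervalIntegrable _ _)
      (hic.stronglyMeasurableAtFilter _ _) hic.continuousAt
  have hrc : Continuous r := continuous_iff_continuousAt.2 fun s => (hr' s).hasDerivAt.continuousAt
  have hmono : StrictMono r := strictMono_of_deriv_pos fun s => by
    rw [(hr' s).hasDerivAt.deriv]; exact inv_pos.2 (hN0 s)
  have hr0 : r 0 = 0 := intervalIntegral.integral_same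
  set ρ : ℝ → ℝ := Function.invFun r with hρ
  have hρr : ∀ s, ρ (r s) = s := Function.leftInverse_invFun hmono.injective
  have hρ' : ∀ s, HasDerivAt ρ (N s) (r s) := fun s => by
    have := (hr' s).to_local_left_inverse (inv_ne_zero (hN0 s).ne') (Eventually.of_forall hρr)
    rw [inv_inv] at this
    exact this.hasDerivAt
  have hgeo : UniqueDiffOn ℝ (r '' Ici 0) → M.IsFdCausalGeodesicOn (γ ∘ ρ) (r '' Ici 0) := by
    intro hI
    have hmaps : MapsTo ρ (r '' Ici 0) (Ici 0) := by
      rintro _ ⟨s, hs, rfl⟩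
      rw [hρr]; exact hs
    refine isFdCausalGeodesicOn_of_hasDerivWithinAt (w := V ∘ ρ) hI ?_ ?_ ?_
    · rintro _ ⟨s, hs, rfl⟩
      have h1 := (hF (ρ (r s)) (by rw [hρr]; exact hs)).1
      refine (h1.scomp (r s) (hρ' s).hasDerivWithinAt hmaps).congr_deriv ?_
      rw [Function.comp_apply, hρr, smul_smul, hNe s hs, mul_inv_cancel₀, one_smul]
      rw [← hNe s hs]; exact (hN0 s).ne'
    · rintro _ ⟨s, hs, rfl⟩
      have h1 := (hF (ρ (r s)) (by rw [hρr]; exact hs)).2.1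
      refine (h1.scomp (r s) (hρ' s).hasDerivWithinAt hmaps).congr_deriv ?_
      rw [Function.comp_apply, Function.comp_apply, hρr, smul_smul, hNe s hs, mul_inv_cancel₀,
        one_smul]
      rw [← hNe s hs]; exact (hN0 s).ne'
    · rintro _ ⟨s, hs, rfl⟩
      rw [Function.comp_apply, Function.comp_apply, hρr]
      exact (hF s hs).2.2
  have hγ0 : (γ ∘ ρ) 0 = γ 0 := by
    have := hρr 0
    rw [hr0] at this
    rw [Function.comp_apply, this]
  have hcomp : (fun s => (γ ∘ ρ) (r s)) = γ := funext fun s => by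
    rw [Function.comp_apply, hρr]
  have himage : ∀ t, 0 ≤ t → (∃ s, t ≤ r s) → t ∈ r '' Ici 0 := by
    rintro t ht ⟨s, hs⟩
    have hs0 : 0 ≤ s := by
      by_contra h
      have := hmono (not_le.1 h)
      linarith
    obtain ⟨u, hu, rfl⟩ := intermediate_value_Icc hs0 hrc.continuousOn
      (show t ∈ Icc (r 0) (r s) by rw [hr0]; exact ⟨ht, hs⟩)
    exact ⟨u, hu.1, rfl⟩
  have hnonneg : ∀ s ∈ Ici (0:ℝ), 0 ≤ r s := fun s hs => hr0 ▸ hmono.monotone hs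
  rcases tendsto_atTop_of_monotone hmono.monotone with htop | ⟨c, hc⟩
  · have hI : r '' Ici 0 = Ici 0 := by
      refine Subset.antisymm (image_subset_iff.2 hnonneg) fun t ht => himage t ht ?_
      exact (htop.eventually_ge_atTop t).exists
    rw [hI] at hgeo
    have h1 := (hA.1 x (γ 0) hx).2 (γ ∘ ρ) (hgeo (uniqueDiffOn_Ici 0)) hγ0 (by
      rintro ⟨z, hz⟩
      have := hz.comp htop
      exact hlim ⟨z, hcomp ▸ this⟩)
    refine (h1.comp htop).congr fun s => ?_
    simp only [Function.comp_apply, hρr]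
  · have hlt : ∀ s, r s < c := fun s =>
      (hmono (lt_add_one s)).trans_le (hmono.monotone.ge_of_tendsto hc _)
    have hc0 : 0 < c := hr0 ▸ hlt 0
    have hI : r '' Ici 0 = Ico 0 c := by
      refine Subset.antisymm (image_subset_iff.2 fun s hs => ⟨hnonneg s hs, hlt s⟩) fun t ht =>
        himage t ht.1 ?_
      exact (hc.eventually (lt_mem_nhds ht.2)).exists.imp fun _ h => le_of_lt h
    rw [hI] at hgeo
    have hc' : Tendsto r atTop (𝓝[<] c) :=
      tendsto_nhdsWithin_iff.2 ⟨hc, Eventually.of_forall hlt⟩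
    have h1 := (hA.1 x (γ 0) hx).1 c hc0 (γ ∘ ρ) (hgeo (uniqueDiffOn_Ico 0 c)) hγ0 (by
      rintro ⟨z, hz⟩
      have := hz.comp hc'
      exact hlim ⟨z, hcomp ▸ this⟩)
    refine (h1.comp hc').congr fun s => ?_
    simp only [Function.comp_apply, hρr]

/-- Lower semicontinuity of the distance in its second argument. -/
theorem GloballyHyperbolic.eventually_lt_ldist (hM : M.GloballyHyperbolic) {p z : SpacetimePt n}
    (hne : p ≠ z) {B : ℝ} (hB : 0 ≤ B) (h : ENNReal.ofReal B < M.ldist p z) :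
    ∀ᶠ z' in 𝓝 z, ENNReal.ofReal B < M.ldist p z' := by
  simp only [ldist, lt_iSup_iff] at h
  obtain ⟨γ, a, b, hab, hγ, h0, h1, hlt⟩ := h
  obtain ⟨α, ℓ, hα, hα0, hα1⟩ := hM.exists_maxCurve (Or.inr ⟨γ, a, b, hab, hγ, h0, h1⟩) hne
  have hBα : B < M.gLength α 0 ℓ :=
    ((ENNReal.ofReal_lt_ofReal_iff_of_nonneg hB).1 hlt).trans_le
      (hα.max γ a b hab hγ (h0.trans hα0.symm) (h1.trans hα1.symm))
  obtain ⟨κ, hκ0, hκ⟩ := hα.exists_speed_lower_bound (hB.trans_lt hBα)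
  set K := Metric.closedBall (0 : SpacetimePt n) (‖α 0‖ + ℓ + 1) with hKdef
  have hℓ := hα.pos
  have hαR : ∀ s, ‖α s‖ ≤ ‖α 0‖ + ℓ := hα.toNCurve.norm_le
  have hαK : ∀ s, α s ∈ K := fun s => by
    rw [hKdef, mem_closedBall_zero_iff]; linarith [hαR s]
  obtain ⟨_, -, C₂, hC₂, _, -, ρ, hρ, hvar⟩ := M.exists_variation_constants
    (isCompact_closedBall (0 : SpacetimePt n) (‖α 0‖ + ℓ + 1)) (convex_closedBall _ _)
  set D := 1 + ℓ⁻¹ with hD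
  have hD0 : 0 < D := by positivity
  set A := C₂ * D / κ with hA
  have hA0 : 0 < A := by positivity
  have hsmall : ∀ c : ℝ, ∀ d > 0, ∀ᶠ z' in 𝓝 z, ‖z' - z‖ * c < d := fun c d hd => by
    have hc : Continuous fun z' => ‖z' - z‖ * c := by fun_prop
    have := hc.tendsto z
    rw [sub_self, norm_zero, zero_mul] at this
    exact this.eventually_lt_const hd
  filter_upwards [hsmall D ρ hρ, hsmall 1 1 one_pos, hsmall A κ hκ0,
    hsmall (ℓ * A) (M.gLength α 0 ℓ - B) (sub_pos.2 hBα)] with z' e1 e2 e3 e4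
  by_cases hz : z' = z
  · subst hz
    refine lt_of_lt_of_le ?_ (hα0 ▸ hα1 ▸ le_ldist hℓ (hα.toNCurve.isFdCausalPathOn le_rfl hℓ.le le_rfl))
    exact (ENNReal.ofReal_lt_ofReal_iff_of_nonneg hB).2 hBα
  set ε := ‖z' - z‖ with hε
  have hε0 : 0 < ε := norm_pos_iff.2 (sub_ne_zero.2 hz)
  set u : SpacetimePt n := ε⁻¹ • (z' - z) with hu
  have hu1 : ‖u‖ = 1 := by
    rw [hu, norm_smul, norm_inv, Real.norm_of_nonneg hε0.le, ← hε, inv_mul_cancel₀ hε0.ne']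
  have hψn : ‖ℓ⁻¹ • u‖ = ℓ⁻¹ := by
    rw [norm_smul, hu1, mul_one, norm_inv, Real.norm_of_nonneg hℓ.le]
  have hInt : ∀ s, (0 : SpacetimePt n) + ∫ _ in (0:ℝ)..s, ℓ⁻¹ • u = (s / ℓ) • u := fun s => by
    rw [intervalIntegral.integral_const, zero_add, smul_smul, sub_zero, div_eq_mul_inv]
  obtain ⟨hβ, hlen⟩ := hα.toNCurve.variation (ψ := fun _ => ℓ⁻¹ • u)
    (B := ⟨ℓ⁻¹, inv_nonneg.2 hℓ.le⟩) measurable_const (fun s => hψn.le) 0 ε (h := fun _ => -A)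
    intervalIntegrable_const (by
      filter_upwards [hα.ae, hκ] with s hs hk hs'
      obtain ⟨-, hc, hf, hun⟩ := hs hs'
      rw [hInt]
      have hw : ‖(s / ℓ) • u‖ ≤ 1 := by
        rw [norm_smul, hu1, mul_one, Real.norm_of_nonneg (div_nonneg hs'.1.le hℓ.le)]
        exact (div_le_one hℓ).2 hs'.2.le
      have hwK : α s + ε • (s / ℓ) • u ∈ K := by
        rw [hKdef, mem_closedBall_zero_iff]
        refine (norm_add_le _ _).trans (add_le_add (hαR s) ?_)
        rw [norm_smul, Real.norm_of_nonneg hε0.le]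
        calc ε * ‖(s / ℓ) • u‖ ≤ ε * 1 := by gcongr
          _ ≤ 1 := e2.le
      obtain ⟨v1, v2, -⟩ := hvar (α s) (hαK s) (deriv α s) hun hc hf ((s / ℓ) • u) (ℓ⁻¹ • u) ε D hε0
        (hw.trans (by rw [hD]; linarith [inv_pos.2 hℓ])) (hψn.le.trans (by rw [hD]; linarith)) e1.le
        hwK
      have h3 := sub_sq_le_of_le (mul_pos hε0 hA0).le e3.le (hk hs')
      have h4 : ε * A * κ = ε * (C₂ * D) := by rw [hA]; field_simp
      rw [h4, M.speed_sq hc] at h3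
      have h5 := h3.trans v2
      refine ⟨v1, by nlinarith [sq_nonneg (M.speed α s - ε * A)], ?_⟩
      refine Real.le_sqrt_of_sq_le ?_
      rwa [mul_neg, ← sub_eq_add_neg])
  have hβ0 : α 0 + ε • ((0 : SpacetimePt n) + ∫ _ in (0:ℝ)..0, ℓ⁻¹ • u) = p := by
    rw [hInt, zero_div, zero_smul, smul_zero, add_zero, hα0]
  have hβ1 : α ℓ + ε • ((0 : SpacetimePt n) + ∫ _ in (0:ℝ)..ℓ, ℓ⁻¹ • u) = z' := by
    rw [hInt, div_self hℓ.ne', one_smul, hα1, hu, smul_smul, mul_inv_cancel₀ hε0.ne', one_smul,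
      add_sub_cancel]
  have hle := le_ldist hℓ hβ
  rw [hβ0, hβ1] at hle
  refine lt_of_lt_of_le ?_ hle
  rw [ENNReal.ofReal_lt_ofReal_iff_of_nonneg hB]
  refine lt_of_lt_of_le ?_ hlen
  rw [intervalIntegral.integral_const, smul_eq_mul, sub_zero]
  linarith

/-- The initial point of a causal curve can be pushed slightly to the past so that the resulting
curve has positive length. -/
theorem exists_pos_length_of_causalLe {q x : SpacetimePt n} (h : M.causalLe q x) (hne : q ≠ x)
    {δ : ℝ} (hδ : 0 < δ) :
    ∃ (β : ℝ → SpacetimePt n) (ℓ : ℝ), 0 < ℓ ∧ M.IsFdCausalPathOn β (Icc 0 ℓ) ∧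
      ‖β 0 - q‖ ≤ δ ∧ β ℓ = x ∧ 0 < M.gLength β 0 ℓ := by
  obtain ⟨γ, a, b, hab, hγ, h0, h1⟩ := h.resolve_left hne
  obtain ⟨α, ℓ, hα, hα0, hα1, -⟩ := hγ.exists_ncurve hab
  rw [h0] at hα0
  rw [h1] at hα1
  have hℓ := hα.pos
  have hαc := hα.lip.continuous
  set K := Metric.closedBall (0 : SpacetimePt n) (‖α 0‖ + ℓ + 1) with hKdef
  have hαR : ∀ s, ‖α s‖ ≤ ‖α 0‖ + ℓ := hα.norm_le
  have hαK : ∀ s, α s ∈ K := fun s => by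
    rw [hKdef, mem_closedBall_zero_iff]; linarith [hαR s]
  obtain ⟨c₁, hc₁, C₂, hC₂, Kc, hKc, ρ, hρ, hvar⟩ := M.exists_variation_constants
    (isCompact_closedBall (0 : SpacetimePt n) (‖α 0‖ + ℓ + 1)) (convex_closedBall _ _)
  obtain ⟨G, hG, hGb⟩ := M.exists_bilForm_bound
    (isCompact_closedBall (0 : SpacetimePt n) (‖α 0‖ + ℓ + 1))
  set C := Kc * G with hC
  have hC0 : 0 < C := mul_pos hKc hG
  set φ : ℝ → ℝ := fun s => Real.exp (C * (ℓ - s ⊔ 0)) with hφ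
  have hφc : Continuous φ := by fun_prop
  set E := Real.exp (C * ℓ) with hE
  have hE0 : 0 < E := Real.exp_pos _
  have hφE : ∀ s, φ s ≤ E := fun s => Real.exp_le_exp.2 (by
    have : 0 ≤ s ⊔ 0 := le_sup_right
    gcongr; linarith)
  have hφ0 : ∀ s, 0 < φ s := fun s => Real.exp_pos _
  set ψ : ℝ → SpacetimePt n := fun s => φ s • M.X0 (α s) with hψ
  have hψc : Continuous ψ := hφc.smul (M.X0_cont.comp hαc)
  have hψn : ∀ s, ‖ψ s‖ ≤ G * φ s := fun s => by
    rw [hψ, norm_smul, Real.norm_of_nonneg (hφ0 s).le, mul_comm]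
    gcongr
    exact (hGb _ (hαK s)).1
  set v₀ : SpacetimePt n := -∫ u in (0:ℝ)..ℓ, ψ u with hv₀
  set w : ℝ → SpacetimePt n := fun s => v₀ + ∫ u in (0:ℝ)..s, ψ u with hw
  have hwℓ : w ℓ = 0 := neg_add_cancel _
  have hwn : ∀ s ∈ Icc 0 ℓ, Kc * ‖w s‖ ≤ φ s := fun s hs => by
    have hws : w s = -∫ u in s..ℓ, ψ u := by
      rw [hw, hv₀, ← intervalIntegral.integral_add_adjacent_intervals
        (hψc.intervalIntegrable 0 s) (hψc.intervalIntegrable s ℓ)]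
      simp only
      abel
    have hi1 : IntervalIntegrable (fun u => G * φ u) volume s ℓ :=
      (continuous_const.mul hφc).intervalIntegrable _ _
    have hd : ∀ u ∈ uIcc s ℓ, HasDerivAt (fun u => -(Real.exp (C * (ℓ - u)) / Kc))
        (G * Real.exp (C * (ℓ - u))) u := fun u _ => by
      have h1 := ((((hasDerivAt_id u).const_sub ℓ).const_mul C).exp.div_const Kc).neg
      refine h1.congr_deriv ?_
      simp only [id, hC]
      field_simp
    have hval : ∫ u in s..ℓ, G * φ u = Real.exp (C * (ℓ - s)) / Kc - 1 / Kc := by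
      have h2 : ∫ u in s..ℓ, G * φ u = ∫ u in s..ℓ, G * Real.exp (C * (ℓ - u)) := by
        refine intervalIntegral.integral_congr fun u hu => ?_
        rw [uIcc_of_le hs.2] at hu
        simp only [hφ, sup_eq_left.2 (hs.1.trans hu.1)]
      rw [h2, intervalIntegral.integral_eq_sub_of_hasDerivAt hd
        ((by fun_prop : Continuous fun u => G * Real.exp (C * (ℓ - u))).intervalIntegrable _ _)]
      simp only [sub_self, mul_zero, Real.exp_zero]
      ring
    have h3 : ‖w s‖ ≤ Real.exp (C * (ℓ - s)) / Kc - 1 / Kc := by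
      rw [hws, norm_neg, ← hval]
      exact intervalIntegral.norm_integral_le_of_norm_le hs.2
        (ae_of_all _ fun u _ => hψn u) hi1
    have h4 : φ s = Real.exp (C * (ℓ - s)) := by simp only [hφ, sup_eq_left.2 hs.1]
    rw [h4]
    calc Kc * ‖w s‖ ≤ Kc * (Real.exp (C * (ℓ - s)) / Kc - 1 / Kc) := by gcongr
      _ = Real.exp (C * (ℓ - s)) - 1 := by field_simp
      _ ≤ _ := by linarith
  set D := E / Kc + G * E with hD
  have hD0 : 0 < D := by positivity
  have hwD : ∀ s ∈ Icc 0 ℓ, ‖w s‖ ≤ D := fun s hs => by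
    have h1 : ‖w s‖ ≤ E / Kc := by
      rw [le_div_iff₀ hKc, mul_comm]; exact (hwn s hs).trans (hφE s)
    have : 0 < G * E := by positivity
    linarith
  have hψE : ∀ s, ‖ψ s‖ ≤ G * E := fun s => (hψn s).trans (by gcongr; exact hφE s)
  have hψD : ∀ s, ‖ψ s‖ ≤ D := fun s => by
    have : 0 < E / Kc := by positivity
    linarith [hψE s]
  set S := G + 1 with hS
  have hS0 : 0 < S := by positivity
  set k := c₁ / (4 * S) with hk
  have hk0 : 0 < k := by positivity
  obtain ⟨ε, hε0, e1, e2, e3, e4⟩ : ∃ ε > 0, ε * D ≤ ρ ∧ ε * D ≤ 1 ∧ ε * D ≤ δ ∧ ε * k ≤ S := by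
    refine ⟨(ρ / D) ⊓ (1 / D) ⊓ (δ / D) ⊓ (S / k), ?_, ?_, ?_, ?_, ?_⟩
    · simp only [gt_iff_lt, lt_inf_iff]
      exact ⟨⟨⟨by positivity, by positivity⟩, by positivity⟩, by positivity⟩
    · rw [← le_div_iff₀ hD0]; exact inf_le_left.trans (inf_le_left.trans inf_le_left)
    · rw [← le_div_iff₀ hD0]; exact inf_le_left.trans (inf_le_left.trans inf_le_right)
    · rw [← le_div_iff₀ hD0]; exact inf_le_left.trans inf_le_right
    · rw [← le_div_iff₀ hk0]; exact inf_le_right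
  have hεw : ∀ s ∈ Icc 0 ℓ, ‖ε • w s‖ ≤ ε * D := fun s hs => by
    rw [norm_smul, Real.norm_of_nonneg hε0.le]
    gcongr
    exact hwD s hs
  obtain ⟨hβ, hlen⟩ := hα.variation (ψ := ψ) (B := ⟨D, hD0.le⟩) hψc.measurable hψD v₀ ε
    (h := fun _ => k) intervalIntegrable_const (by
      filter_upwards [hα.ae] with s hs hs'
      obtain ⟨-, hc, hf, hun⟩ := hs hs'
      have hsI := Ioo_subset_Icc_self hs'
      have hwK : α s + ε • w s ∈ K := by
        rw [hKdef, mem_closedBall_zero_iff]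
        exact (norm_add_le _ _).trans (add_le_add (hαR s) ((hεw s hsI).trans e2))
      obtain ⟨v1, -, v3⟩ := hvar (α s) (hαK s) (deriv α s) hun hc hf (w s) (ψ s) ε D hε0
        (hwD s hsI) (hψD s) e1 hwK
      have v4 := v3 (φ s) rfl (hwn s hsI)
      have hφ1 : 1 ≤ φ s := Real.one_le_exp (by
        rw [sup_eq_left.2 hs'.1.le]
        exact mul_nonneg hC0.le (by linarith [hs'.2]))
      have hτ2 := M.speed_sq hc
      have hτS : M.speed α s ≤ S := by
        refine abs_le_of_sq_le_sq' ?_ hS0.le |>.2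
        rw [hτ2]
        have h5 := neg_abs_le (bilForm (M.g (α s)) (deriv α s) (deriv α s))
        have h6 := (hGb _ (hαK s)).2 (deriv α s) (deriv α s)
        have h7 := norm_le_one_of_euclNorm_eq_one hun
        have h8 : G * ‖deriv α s‖ * ‖deriv α s‖ ≤ G * 1 * 1 := by gcongr
        rw [hS]
        nlinarith
      have h9 := add_sq_le_of_le hτS (mul_pos hε0 hk0).le e4
      have h10 : ε * k * (4 * S) = ε * c₁ := by rw [hk]; field_simp
      rw [h10, hτ2] at h9
      have h11 : ε * c₁ ≤ ε * (c₁ * φ s) := by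
        have := mul_le_mul_of_nonneg_left hφ1 (mul_pos hε0 hc₁).le
        linarith
      refine ⟨v1, ?_, Real.le_sqrt_of_sq_le (by linarith)⟩
      linarith [hc.2, mul_pos hε0 hc₁])
  refine ⟨_, ℓ, hℓ, hβ, ?_, ?_, ?_⟩
  · rw [hα0, add_sub_cancel_left]
    exact (hεw 0 ⟨le_rfl, hℓ.le⟩).trans e3
  · change α ℓ + ε • w ℓ = x
    rw [hwℓ, smul_zero, add_zero, hα1]
  · refine lt_of_lt_of_le ?_ hlen
    rw [intervalIntegral.integral_const, sub_zero, smul_eq_mul]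
    have := M.gLength_nonneg α hℓ.le
    positivity

/-- Points on, and almost at, the future of `q` are joined by long geodesics. -/
lemma GloballyHyperbolic.exists_geodesicField (hM : M.GloballyHyperbolic) {q y : SpacetimePt n}
    (hqy : M.causalLe q y) {k δ : ℝ} (hk : 0 ≤ k) (hδ : 0 < δ) (hδ1 : δ ≤ 1)
    (hy : ‖q‖ + k + 1 < ‖y‖) :
    ∃ (γ V : ℝ → SpacetimePt n) (ℓ : ℝ), M.NCurve γ ℓ ∧ ‖γ 0 - q‖ ≤ δ ∧ γ ℓ = y ∧ k < ℓ ∧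
      euclNorm (V 0) = 1 ∧ M.GeodesicField γ V (Icc 0 ℓ) := by
  have hne : q ≠ y := by rintro rfl; linarith
  obtain ⟨β, ℓ', hℓ', hβ, hβ0, hβ1, hpos⟩ := exists_pos_length_of_causalLe hqy hne hδ
  have hn0 : ‖β 0‖ ≤ ‖q‖ + δ := (norm_le_norm_add_norm_sub' (β 0) q).trans (by linarith)
  have hne' : β 0 ≠ y := by rintro h; rw [h] at hn0; linarith
  obtain ⟨γ, ℓ, hγ, hγ0, hγ1⟩ := hM.exists_maxCurve (Or.inr ⟨β, 0, ℓ', hℓ', hβ, rfl, hβ1⟩) hne'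
  obtain ⟨V, hV0, hV⟩ := hγ.exists_geodesic_field
    (hpos.trans_le (hγ.max β 0 ℓ' hℓ' hβ hγ0.symm (hβ1.trans hγ1.symm)))
  refine ⟨γ, V, ℓ, hγ.toNCurve, by rwa [hγ0], hγ1, ?_, hV0, hV⟩
  have h1 := hγ.lip.norm_sub_le ℓ 0
  rw [NNReal.coe_one, one_mul, sub_zero, Real.norm_of_nonneg hγ.pos.le, hγ0, hγ1] at h1
  have h2 := norm_le_norm_add_norm_sub' y (β 0)
  linarith

/-- The future half of finite compactness. -/
theorem GloballyHyperbolic.exists_mapClusterPt (hM : M.GloballyHyperbolic) (hA : M.ConditionA)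
    {B : ℝ} (hB : 0 < B) {p q : SpacetimePt n} {x : ℕ → SpacetimePt n} (hpq : M.chron p q)
    (hqx : ∀ m, M.causalLe q (x m)) (hd : ∀ m, M.ldist p (x m) ≤ ENNReal.ofReal B) :
    ∃ z, MapClusterPt z atTop x := by
  by_contra hno
  have hfar : ∀ k : ℕ, ∃ m, ‖q‖ + k + 1 < ‖x m‖ := fun k => by
    by_contra! h
    obtain ⟨z, -, hz⟩ := @isCompact_closedBall _ _ _ (0 : SpacetimePt n) (‖q‖ + k + 1) (map x atTop)
      _ (tendsto_principal.2 (Eventually.of_forall fun m => by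
        rw [mem_closedBall_zero_iff]; exact h m))
    exact hno ⟨z, hz⟩
  choose m hm using hfar
  have hex := fun k : ℕ => hM.exists_geodesicField (hqx (m k)) k.cast_nonneg
    (Nat.one_div_pos_of_nat (α := ℝ) (n := k))
    (by rw [div_le_one (by positivity)]; linarith [k.cast_nonneg (α := ℝ)]) (hm k)
  choose γ V ℓ hγ hγ0 hγ1 hkℓ hV0 hV using hex
  let U : Ultrafilter ℕ := hyperfilter ℕ
  have hU : (U : Filter ℕ) ≤ atTop := by
    rw [← Nat.cofinite_eq_atTop]; exact hyperfilter_le_cofinite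
  have hℓ : ∀ s, ∀ᶠ k in (U : Filter ℕ), s < ℓ k := fun s => by
    obtain ⟨N, hN⟩ := exists_nat_gt s
    filter_upwards [hU (eventually_ge_atTop N)] with k hk
    exact (hN.trans_le (Nat.cast_le.2 hk)).trans (hkℓ k)
  have hR : ∀ k, ‖γ k 0‖ ≤ ‖q‖ + 1 := fun k => by
    have h1 := norm_le_norm_add_norm_sub' (γ k 0) q
    have h2 : 1 / ((k:ℝ) + 1) ≤ 1 := by
      rw [div_le_one (by positivity)]; linarith [k.cast_nonneg (α := ℝ)]
    linarith [hγ0 k]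
  obtain ⟨γ', V', hlim, hF⟩ := exists_limit_geodesicField U (fun k => (hγ k).lip) hR hV hV0 hℓ
  have hγ'0 : γ' 0 = q := by
    refine tendsto_nhds_unique (hlim 0) (tendsto_iff_norm_sub_tendsto_zero.2 ?_)
    exact squeeze_zero (fun _ => norm_nonneg _) hγ0
      ((tendsto_one_div_add_atTop_nhds_zero_nat (𝕜 := ℝ)).mono_left hU)
  have hnl := limit_not_tendsto hγ hlim hℓ
  have htop := hA.tendsto_ldist (x := p) (by rw [hγ'0]; exact hpq) hF hnl
  have hfreq : ∃ᶠ s in atTop, p ≠ γ' s := by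
    intro h
    simp only [ne_eq, not_not] at h
    exact hnl ⟨p, tendsto_const_nhds.congr' h⟩
  obtain ⟨s, ⟨hps, hBs⟩, hs0⟩ := ((hfreq.and_eventually
    (htop.eventually (lt_mem_nhds ENNReal.ofReal_lt_top))).and_eventually
    (eventually_ge_atTop 0)).exists
  obtain ⟨k, hk, hkℓ⟩ := (((hlim s).eventually (hM.eventually_lt_ldist hps hB.le hBs)).and
    (hℓ s)).exists
  have h1 := M.ldist_mono_right (p := p) ((hγ k).causalLe hs0 hkℓ.le le_rfl)
  rw [hγ1] at h1
  exact absurd (hk.trans_le (h1.trans (hd _))) (lt_irrefl _)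

/-- The spacetime with the opposite time orientation. -/
def rev (M : C1Spacetime n) : C1Spacetime n where
  g := M.g
  g_contDiff := M.g_contDiff
  g_symm := M.g_symm
  g_lorentz := M.g_lorentz
  X0 := fun p => -M.X0 p
  X0_cont := M.X0_cont.neg
  X0_timelike := fun p => by simpa [bilForm] using M.X0_timelike p

lemma lipschitz_and_ae_comp_neg {P P' : SpacetimePt n → SpacetimePt n → Prop}
    (hP : ∀ z v, P z v → P' z (-v)) {γ : ℝ → SpacetimePt n} {I : Set ℝ}
    (h : I.OrdConnected ∧ I.Nonempty ∧
      (∀ t ∈ I, ∃ K : ℝ≥0, ∃ U ∈ 𝓝[I] t, LipschitzOnWith K γ U) ∧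
      ∀ᵐ t ∂(volume.restrict I), DifferentiableAt ℝ γ t ∧ P (γ t) (deriv γ t)) :
    (-I).OrdConnected ∧ (-I).Nonempty ∧
      (∀ t ∈ -I, ∃ K : ℝ≥0, ∃ U ∈ 𝓝[-I] t, LipschitzOnWith K (fun s => γ (-s)) U) ∧
      ∀ᵐ t ∂(volume.restrict (-I)), DifferentiableAt ℝ (fun s => γ (-s)) t ∧
        P' (γ (-t)) (deriv (fun s => γ (-s)) t) := by
  obtain ⟨hI, hne, hL, hae⟩ := h
  have hI' : (-I).OrdConnected := ⟨fun a ha b hb c hc =>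
    hI.out hb ha ⟨neg_le_neg hc.2, neg_le_neg hc.1⟩⟩
  refine ⟨hI', hne.neg, fun t ht => ?_, ?_⟩
  · obtain ⟨K, U, hU, hK⟩ := hL (-t) ht
    refine ⟨K, Neg.neg ⁻¹' U, ?_, ?_⟩
    · have h1 : Tendsto (fun s : ℝ => -s) (𝓝[-I] t) (𝓝[I] (-t)) :=
        tendsto_nhdsWithin_iff.2 ⟨(continuous_neg.tendsto t).mono_left nhdsWithin_le_nhds,
          eventually_mem_nhdsWithin⟩
      exact h1 hU
    · intro a ha b hb
      have := hK ha hb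
      rwa [edist_neg_neg] at this
  · rw [ae_restrict_iff' hI.measurableSet] at hae
    rw [ae_restrict_iff' hI'.measurableSet]
    filter_upwards [(Measure.measurePreserving_neg (volume : Measure ℝ)).quasiMeasurePreserving.ae
      hae] with t ht htI
    obtain ⟨h1, h2⟩ := ht htI
    exact ⟨h1.comp t differentiableAt_id.neg, by rw [deriv_comp_neg]; exact hP _ _ h2⟩

lemma rev_fdVec_iff {p v : SpacetimePt n} : M.rev.FdVec p v ↔ M.PdVec p v := by
  show bilForm (M.g p) v (-M.X0 p) < 0 ↔ _
  rw [bilForm_neg_right, neg_lt_zero]; rfl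

lemma rev_pdVec_iff {p v : SpacetimePt n} : M.rev.PdVec p v ↔ M.FdVec p v := by
  show 0 < bilForm (M.g p) v (-M.X0 p) ↔ _
  rw [bilForm_neg_right, neg_pos]; rfl

lemma rev_fdVec_neg_iff {p v : SpacetimePt n} : M.rev.FdVec p (-v) ↔ M.FdVec p v := by
  rw [rev_fdVec_iff, PdVec, bilForm_neg_left, neg_pos]; rfl

lemma causalVec_neg {p v : SpacetimePt n} (h : M.CausalVec p v) : M.CausalVec p (-v) :=
  ⟨neg_ne_zero.2 h.1, by rw [bilForm_neg_left, bilForm_neg_right, neg_neg]; exact h.2⟩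

lemma timelikeVec_neg {p v : SpacetimePt n} (h : M.TimelikeVec p v) : M.TimelikeVec p (-v) := by
  rw [TimelikeVec, bilForm_neg_left, bilForm_neg_right, neg_neg]; exact h

lemma IsFdCausalPathOn.rev {γ : ℝ → SpacetimePt n} {I : Set ℝ} (h : M.IsFdCausalPathOn γ I) :
    M.rev.IsFdCausalPathOn (fun t => γ (-t)) (-I) :=
  lipschitz_and_ae_comp_neg (P := fun z v => M.CausalVec z v ∧ M.FdVec z v)
    (P' := fun z v => M.rev.CausalVec z v ∧ M.rev.FdVec z v)
    (fun _ _ hv => ⟨causalVec_neg (M := M) hv.1, rev_fdVec_neg_iff.2 hv.2⟩) h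

lemma IsFdCausalPathOn.of_rev {γ : ℝ → SpacetimePt n} {I : Set ℝ}
    (h : M.rev.IsFdCausalPathOn γ I) : M.IsFdCausalPathOn (fun t => γ (-t)) (-I) :=
  lipschitz_and_ae_comp_neg (P := fun z v => M.rev.CausalVec z v ∧ M.rev.FdVec z v)
    (P' := fun z v => M.CausalVec z v ∧ M.FdVec z v)
    (fun _ v hv => ⟨causalVec_neg (M := M) hv.1,
      rev_fdVec_neg_iff.1 (by rw [neg_neg]; exact hv.2)⟩) h

lemma chron.rev {p q : SpacetimePt n} (h : M.chron p q) : M.rev.chron q p := by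
  obtain ⟨γ, a, b, hab, hγ, ha, hb⟩ := h
  refine ⟨fun t => γ (-t), -b, -a, neg_lt_neg hab, ?_, by simpa, by simpa⟩
  rw [← Set.neg_Icc]
  exact lipschitz_and_ae_comp_neg (P := fun z v => M.TimelikeVec z v ∧ M.FdVec z v)
    (P' := fun z v => M.rev.TimelikeVec z v ∧ M.rev.FdVec z v)
    (fun _ _ hv => ⟨timelikeVec_neg (M := M) hv.1, rev_fdVec_neg_iff.2 hv.2⟩) hγ

lemma chron.of_rev {p q : SpacetimePt n} (h : M.rev.chron p q) : M.chron q p := by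
  obtain ⟨γ, a, b, hab, hγ, ha, hb⟩ := h
  refine ⟨fun t => γ (-t), -b, -a, neg_lt_neg hab, ?_, by simpa, by simpa⟩
  rw [← Set.neg_Icc]
  exact lipschitz_and_ae_comp_neg (P := fun z v => M.rev.TimelikeVec z v ∧ M.rev.FdVec z v)
    (P' := fun z v => M.TimelikeVec z v ∧ M.FdVec z v)
    (fun _ _ hv => ⟨timelikeVec_neg (M := M) hv.1,
      rev_fdVec_neg_iff.1 (by rw [neg_neg]; exact hv.2)⟩) hγ

lemma rev_causalLe_iff {p q : SpacetimePt n} : M.rev.causalLe p q ↔ M.causalLe q p := by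
  constructor
  · rintro (rfl | ⟨γ, a, b, hab, hγ, ha, hb⟩)
    · exact Or.inl rfl
    · refine Or.inr ⟨fun t => γ (-t), -b, -a, neg_lt_neg hab, ?_, by simpa, by simpa⟩
      rw [← Set.neg_Icc]
      exact hγ.of_rev
  · rintro (rfl | ⟨γ, a, b, hab, hγ, ha, hb⟩)
    · exact Or.inl rfl
    · refine Or.inr ⟨fun t => γ (-t), -b, -a, neg_lt_neg hab, ?_, by simpa, by simpa⟩
      rw [← Set.neg_Icc]
      exact hγ.rev

lemma gLength_comp_neg (γ : ℝ → SpacetimePt n) (a b : ℝ) :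
    M.gLength (fun t => γ (-t)) (-b) (-a) = M.gLength γ a b := by
  unfold gLength
  have := intervalIntegral.integral_comp_neg (a := -b) (b := -a)
    (fun t => Real.sqrt (-bilForm (M.g (γ t)) (deriv γ t) (deriv γ t)))
  rw [neg_neg, neg_neg] at this
  rw [← this]
  simp only [deriv_comp_neg, bilForm_neg_left, bilForm_neg_right, neg_neg]

lemma rev_ldist (p q : SpacetimePt n) : M.rev.ldist p q = M.ldist q p := by
  apply le_antisymm
  · refine iSup_le fun γ => iSup_le fun a => iSup_le fun b => iSup_le fun hab => iSup_le fun hγ =>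
      iSup_le fun ha => iSup_le fun hb => ?_
    refine le_trans (le_of_eq ?_) (le_iSup_of_le (fun t => γ (-t)) <| le_iSup_of_le (-b) <|
      le_iSup_of_le (-a) <| le_iSup_of_le (neg_lt_neg hab) <|
      le_iSup_of_le (by rw [← Set.neg_Icc]; exact hγ.of_rev) <|
      le_iSup_of_le (by simpa) <| le_iSup_of_le (by simpa) le_rfl)
    rw [gLength_comp_neg]; rfl
  · refine iSup_le fun γ => iSup_le fun a => iSup_le fun b => iSup_le fun hab => iSup_le fun hγ =>
      iSup_le fun ha => iSup_le fun hb => ?_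
    refine le_trans (le_of_eq ?_) (le_iSup_of_le (fun t => γ (-t)) <| le_iSup_of_le (-b) <|
      le_iSup_of_le (-a) <| le_iSup_of_le (neg_lt_neg hab) <|
      le_iSup_of_le (by rw [← Set.neg_Icc]; exact hγ.rev) <|
      le_iSup_of_le (by simpa) <| le_iSup_of_le (by simpa) le_rfl)
    rw [gLength_comp_neg]; rfl

lemma NonImprisoning.rev (h : M.NonImprisoning) : M.rev.NonImprisoning := by
  have key : ∀ {γ : ℝ → SpacetimePt n} {l l' : Filter ℝ}, Tendsto (fun t : ℝ => -t) l l' →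
      (¬ ∃ q, Tendsto γ l (𝓝 q)) → ¬ ∃ q, Tendsto (fun t => γ (-t)) l' (𝓝 q) := by
    rintro γ l l' hl hn ⟨q, hq⟩
    exact hn ⟨q, by simpa [Function.comp_def] using hq.comp hl⟩
  intro K hK
  obtain ⟨h1, h2, h3, h4⟩ := h K hK
  refine ⟨fun a b γ hγ hn hmem => ?_, fun a γ hγ hn hmem => ?_, fun a b γ hγ hn hmem => ?_,
    fun b γ hγ hn hmem => ?_⟩
  · refine h3 (-b) (-a) (fun t => γ (-t)) (by rw [← Set.neg_Ico]; exact hγ.of_rev)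
      (key tendsto_neg_nhdsLT hn) fun t ht => hmem _ ?_
    rwa [← Set.neg_Ico] at ht
  · refine h4 (-a) (fun t => γ (-t)) (by rw [← Set.neg_Ici]; exact hγ.of_rev)
      (key tendsto_neg_atTop_atBot hn) fun t ht => hmem _ ?_
    rwa [← Set.neg_Ici] at ht
  · refine h1 (-b) (-a) (fun t => γ (-t)) (by rw [← Set.neg_Ioc]; exact hγ.of_rev)
      (key tendsto_neg_nhdsGT hn) fun t ht => hmem _ ?_
    rwa [← Set.neg_Ioc] at ht
  · refine h2 (-b) (fun t => γ (-t)) (by rw [← Set.neg_Iic]; exact hγ.of_rev)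
      (key tendsto_neg_atBot_atTop hn) fun t ht => hmem _ ?_
    rwa [← Set.neg_Iic] at ht

lemma GloballyHyperbolic.rev (h : M.GloballyHyperbolic) : M.rev.GloballyHyperbolic := by
  refine ⟨h.1.rev, fun p q => ?_⟩
  simp only [rev_causalLe_iff]
  simpa only [and_comm] using h.2 q p

lemma IsFdCausalGeodesicOn.of_rev {γ : ℝ → SpacetimePt n} {I : Set ℝ}
    (h : M.rev.IsFdCausalGeodesicOn γ I) : M.IsPdCausalGeodesicOn γ I :=
  ⟨h.1, fun t ht => ⟨(h.2 t ht).1, rev_fdVec_iff.1 (h.2 t ht).2⟩⟩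

lemma IsPdCausalGeodesicOn.of_rev {γ : ℝ → SpacetimePt n} {I : Set ℝ}
    (h : M.rev.IsPdCausalGeodesicOn γ I) : M.IsFdCausalGeodesicOn γ I :=
  ⟨h.1, fun t ht => ⟨(h.2 t ht).1, rev_pdVec_iff.1 (h.2 t ht).2⟩⟩

lemma ConditionA.rev (h : M.ConditionA) : M.rev.ConditionA := by
  simp only [ConditionA, rev_ldist]
  exact ⟨fun x y hxy => ⟨fun c hc γ hγ => (h.2 x y hxy.of_rev).1 c hc γ hγ.of_rev,
      fun γ hγ => (h.2 x y hxy.of_rev).2 γ hγ.of_rev⟩,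
    fun x y hxy => ⟨fun c hc γ hγ => (h.1 x y hxy.of_rev).1 c hc γ hγ.of_rev,
      fun γ hγ => (h.1 x y hxy.of_rev).2 γ hγ.of_rev⟩⟩

end C1Spacetime

open C1Spacetime in
/-- Theorem 4.12: a globally hyperbolic, causally non-branching, non-intertwining
C¹-spacetime satisfying Condition A is finitely compact. -/
theorem finitelyCompact_of_conditionA
    {n : ℕ} (hn : 2 ≤ n) (M : C1Spacetime n) (hGH : M.GloballyHyperbolic)
    (hnb : M.CausallyNonBranching) (hni : M.NonIntertwining)
    (hA : M.ConditionA) :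
    M.FinitelyCompact := by
  intro B hB p q x
  refine ⟨fun h => hGH.exists_mapClusterPt hA hB (h 0).1 (fun m => (h m).2.1)
    (fun m => (h m).2.2), fun h => ?_⟩
  exact hGH.rev.exists_mapClusterPt hA.rev hB (h 0).2.1.rev
    (fun m => rev_causalLe_iff.2 (h m).1) (fun m => by rw [rev_ldist]; exact (h m).2.2)
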